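/- arXiv:1602.06796 — 3 statements merged into one kernel-verified Lean document; each statement's English description precedes it below -/
import Mathlib

section
/- (MacMahon) The number of plane partitions in the n-cube, i.e. the number of lower sets of Fin n × Fin n × Fin n under the componentwise (product) order, equals ∏_{i=0}^{n-1} i!·(i+2n)! / ((i+n)!)². -/
open Finset in
/-- Hockey-stick summation on an interval. -/
lemma pp_sum_choose (a b j : ℕ) (h : a ≤ b) :
    ∑ x ∈ Finset.Ico a b, (Nat.choose x j : ℚ) =
      (Nat.choose b (j + 1) : ℚ) - (Nat.choose a (j + 1) : ℚ) := by
  induction b, h using Nat.le_induction with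
  | base => simp
  | succ b hb ih =>
    rw [Finset.sum_Ico_succ_top hb, ih, Nat.choose_succ_succ]
    push_cast
    ring

/-- The determinant of binomial coefficients. -/
def ppDet (m : ℕ) (l : Fin m → ℕ) : ℚ :=
  Matrix.det (Matrix.of fun i j : Fin m => (Nat.choose (l i) j : ℚ))

/-- Branching rule for the determinant. -/
lemma ppDet_succ (m : ℕ) (l : Fin (m + 1) → ℕ) (h : ∀ i : Fin m, l i.castSucc ≤ l i.succ) :
    ppDet (m + 1) l =
      ∑ v ∈ Fintype.piFinset (fun i : Fin m => Finset.Ico (l i.castSucc) (l i.succ)),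
        ppDet m v := by
  let B : Matrix (Fin (m + 1)) (Fin (m + 1)) ℚ := Matrix.of fun i j =>
    Fin.cases (motive := fun _ => ℚ) ((Nat.choose (l 0) j : ℚ))
      (fun i => (Nat.choose (l i.succ) j : ℚ) - (Nat.choose (l i.castSucc) j : ℚ)) i
  have h1 : ppDet (m + 1) l = B.det := by
    apply Matrix.det_eq_of_forall_row_eq_smul_add_pred (fun _ => 1)
    · intro j
      simp [B]
    · intro i j
      simp [B]
  have h2 : B.det = (B.submatrix Fin.succ Fin.succ).det := by
    rw [Matrix.det_succ_column_zero, Fin.sum_univ_succ]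
    simp [B]
  have h3 : B.submatrix Fin.succ Fin.succ =
      fun i => ∑ x ∈ Finset.Ico (l i.castSucc) (l i.succ),
        (fun j : Fin m => (Nat.choose x j : ℚ)) := by
    ext i j
    rw [Finset.sum_apply, pp_sum_choose _ _ _ (h i)]
    simp [B]
  rw [h1, h2, h3]
  exact (Matrix.detRowAlternating (R := ℚ) (n := Fin m)).toMultilinearMap.map_sum_finset
    (fun _ x => (fun j : Fin m => (Nat.choose x j : ℚ)))
    (fun i : Fin m => Finset.Ico (l i.castSucc) (l i.succ))

lemma ppDet_eq (m : ℕ) (l : Fin m → ℕ) :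
    (∏ i : Fin m, (Nat.factorial i : ℚ)) * ppDet m l =
      ∏ i : Fin m, ∏ j ∈ Finset.Ioi i, ((l j : ℚ) - (l i : ℚ)) := by
  rw [← Matrix.det_vandermonde (fun i => (l i : ℚ)),
    Matrix.det_eval_matrixOfPolynomials_eq_det_vandermonde (fun i => (l i : ℚ))
      (fun i => descPochhammer ℚ i)
      (fun i => descPochhammer_natDegree ℚ i)
      (fun i => monic_descPochhammer ℚ i), ppDet,
      ← Matrix.det_mul_row (fun (i : Fin m) => ((Nat.factorial (i : ℕ)) : ℚ))]
  congr 1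
  ext i j
  simp only [Matrix.of_apply]
  rw [descPochhammer_eval_eq_descFactorial ℚ, Nat.descFactorial_eq_factorial_mul_choose]
  push_cast
  rfl

/-- Add a top row to a triangular array. -/
def ppExt (m : ℕ) (x : Fin (m + 2) → ℕ) (g : ℕ → ℕ → ℕ) (a b : ℕ) : ℕ :=
  if h : a + b = m + 1 then x ⟨a, by omega⟩ else g a b

/-- Gelfand-Tsetlin patterns with given top row. -/
noncomputable def ppGT : (m : ℕ) → (Fin (m + 1) → ℕ) → Finset (ℕ → ℕ → ℕ)
  | 0, x => {fun a b => if a = 0 ∧ b = 0 then x 0 else 0}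
  | m + 1, x =>
    open Classical in
    (Fintype.piFinset (fun i : Fin (m + 1) => Finset.Icc (x i.castSucc) (x i.succ))).biUnion
      (fun y => (ppGT m y).image (ppExt m x))

lemma mem_ppGT (m : ℕ) (x : Fin (m + 1) → ℕ) (g : ℕ → ℕ → ℕ) :
    g ∈ ppGT m x ↔ (∀ a b, a + b < m → g a (b + 1) ≤ g a b ∧ g a b ≤ g (a + 1) b) ∧
      (∀ a b, ∀ h : a + b = m, g a b = x ⟨a, by omega⟩) ∧ (∀ a b, m < a + b → g a b = 0) := by
  induction m generalizing g with
  | zero =>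
    simp only [ppGT, Finset.mem_singleton]
    constructor
    · rintro rfl
      refine ⟨by simp, ?_, ?_⟩
      · intro a b h
        obtain ⟨rfl, rfl⟩ : a = 0 ∧ b = 0 := by omega
        simp
      · intro a b h
        exact if_neg (by omega)
    · rintro ⟨-, h2, h3⟩
      ext a b
      split_ifs with h
      · obtain ⟨rfl, rfl⟩ := h
        exact h2 0 0 rfl
      · exact h3 a b (by omega)
  | succ m ih =>
    simp only [ppGT, Finset.mem_biUnion, Fintype.mem_piFinset, Finset.mem_image, Finset.mem_Icc]
    constructor
    · rintro ⟨y, hy, g, hg, rfl⟩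
      rw [ih] at hg
      obtain ⟨h1, h2, h3⟩ := hg
      refine ⟨?_, ?_, ?_⟩
      · intro a b hab
        rcases Nat.lt_or_ge (a + b) m with h | h
        · have := h1 a b h
          simp only [ppExt]
          rw [dif_neg (by omega), dif_neg (by omega), dif_neg (by omega)]
          exact this
        · have h : a + b = m := by omega
          simp only [ppExt]
          rw [dif_pos (by omega), dif_neg (by omega), dif_pos (by omega), h2 a b h]
          exact hy ⟨a, by omega⟩
      · intro a b h
        simp [ppExt, h]
      · intro a b h
        simp only [ppExt]
        rw [dif_neg (by omega), h3 a b (by omega)]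
    · rintro ⟨h1, h2, h3⟩
      refine ⟨fun i => g i (m - i), ?_, fun a b => if a + b ≤ m then g a b else 0, ?_, ?_⟩
      · intro i
        have := h1 i (m - i) (by omega)
        rw [h2 i (m - i + 1) (by omega), h2 (i + 1) (m - i) (by omega)] at this
        exact this
      · rw [ih]
        refine ⟨?_, ?_, ?_⟩
        · intro a b h
          rw [if_pos (by omega), if_pos (by omega), if_pos (by omega)]
          exact h1 a b (by omega)
        · intro a b h
          rw [if_pos (by omega)]
          simp only
          congr 1
          omega
        · intro a b h
          exact if_neg (by omega)
      · ext a b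
        simp only [ppExt]
        split_ifs with h h'
        · exact (h2 a b h).symm
        · rfl
        · exact (h3 a b (by omega)).symm

lemma card_ppGT (m : ℕ) (x : Fin (m + 1) → ℕ) (hx : ∀ i : Fin m, x i.castSucc ≤ x i.succ) :
    ((ppGT m x).card : ℚ) = ppDet (m + 1) (fun i => x i + i) := by
  classical
  induction m with
  | zero => simp [ppGT, ppDet]
  | succ m ih =>
    have hinj : ∀ y, Set.InjOn (ppExt m x) (ppGT m y : Set (ℕ → ℕ → ℕ)) := by
      intro y g hg g' hg' h
      rw [Finset.mem_coe, mem_ppGT] at hg hg'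
      ext a b
      by_cases hab : a + b = m + 1
      · rw [hg.2.2 a b (by omega), hg'.2.2 a b (by omega)]
      · have := congrFun (congrFun h a) b
        simpa [ppExt, hab] using this
    rw [ppGT, Finset.card_biUnion]
    · rw [ppDet_succ]
      · push_cast
        refine Finset.sum_bij' (fun y _ => fun i => y i + i) (fun v _ => fun i => v i - i)
          ?_ ?_ ?_ ?_ ?_
        · intro y hy
          simp only [Fintype.mem_piFinset, Finset.mem_Icc, Finset.mem_Ico] at hy ⊢
          intro i
          have := hy i
          simp only [Fin.val_castSucc, Fin.val_succ]
          omega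
        · intro y hy
          simp only [Fintype.mem_piFinset, Finset.mem_Icc, Finset.mem_Ico] at hy ⊢
          intro i
          have := hy i
          simp only [Fin.val_castSucc, Fin.val_succ] at this
          omega
        · intro y hy
          ext i
          simp
        · intro v hv
          simp only [Fintype.mem_piFinset, Finset.mem_Ico] at hv
          ext i
          have := hv i
          simp only [Fin.val_castSucc, Fin.val_succ] at this
          simp only
          omega
        · intro y hy
          rw [Finset.card_image_of_injOn (hinj y), ih]
          intro i
          simp only [Fintype.mem_piFinset, Finset.mem_Icc] at hy
          have h1 := (hy i.castSucc).2
          have h2 := (hy i.succ).1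
          rw [Fin.succ_castSucc] at h1
          omega
      · intro i
        have := hx i
        simp only [Fin.val_castSucc, Fin.val_succ]
        omega
    · intro y _ y' _ hne
      rw [Function.onFun, Finset.disjoint_left]
      intro g hg hg'
      rw [Finset.mem_image] at hg hg'
      obtain ⟨g, hg, rfl⟩ := hg
      obtain ⟨g', hg', h⟩ := hg'
      apply hne
      rw [mem_ppGT] at hg hg'
      ext i
      have h1 := hg.2.1 i (m - i) (by omega)
      have h2 := hg'.2.1 i (m - i) (by omega)
      have := congrFun (congrFun h i) (m - i)
      simp only [ppExt] at this
      rw [dif_neg (by omega), dif_neg (by omega)] at this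
      rw [h1, h2] at this
      exact this.symm

/-- Initial segments of `Fin n`. -/
lemma pp_lower_count (n : ℕ) (T : Set (Fin n)) (hT : IsLowerSet T) :
    ∃ c : ℕ, c ≤ n ∧ ∀ k : Fin n, k ∈ T ↔ (k : ℕ) < c := by
  classical
  by_cases h : ∃ c : ℕ, ∃ hc : c < n, (⟨c, hc⟩ : Fin n) ∉ T
  · obtain ⟨hc, hT'⟩ := Nat.find_spec h
    refine ⟨Nat.find h, hc.le, fun k => ⟨fun hk => ?_, fun hk => ?_⟩⟩
    · by_contra hlt
      exact hT' (hT (Fin.mk_le_of_le_val (not_lt.mp hlt)) hk)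
    · have := Nat.find_min h hk
      by_contra hkT
      exact this ⟨k.2, hkT⟩
  · push Not at h
    exact ⟨n, le_rfl, fun k => ⟨fun _ => k.2, fun _ => h k k.2⟩⟩

/-- Top row. -/
def ppTop (k : ℕ) (i : Fin (2 * k + 1 + 1)) : ℕ := if (i : ℕ) < k + 1 then 0 else k + 1

lemma mem_ppGT_top (k : ℕ) (g : ℕ → ℕ → ℕ) (hg : g ∈ ppGT (2 * k + 1) (ppTop k)) :
    (∀ a a' b, a ≤ a' → a' + b ≤ 2 * k + 1 → g a b ≤ g a' b) ∧
    (∀ a b b', b ≤ b' → a + b' ≤ 2 * k + 1 → g a b' ≤ g a b) ∧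
    (∀ a b, k + 1 ≤ b → g a b = 0) ∧
    (∀ a b, k + 1 ≤ a → a + b ≤ 2 * k + 1 → g a b = k + 1) ∧
    (∀ a b, g a b ≤ k + 1) ∧ (∀ a b, 2 * k + 1 < a + b → g a b = 0) := by
  rw [mem_ppGT] at hg
  obtain ⟨h1, h2, h3⟩ := hg
  have A : ∀ a a' b, a ≤ a' → a' + b ≤ 2 * k + 1 → g a b ≤ g a' b := by
    intro a a' b h
    induction a', h using Nat.le_induction with
    | base => intro _; exact le_rfl
    | succ a' ha ih =>
      intro h
      exact (ih (by omega)).trans (h1 a' b (by omega)).2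
  have B : ∀ a b b', b ≤ b' → a + b' ≤ 2 * k + 1 → g a b' ≤ g a b := by
    intro a b b' h
    induction b', h using Nat.le_induction with
    | base => intro _; exact le_rfl
    | succ b' ha ih =>
      intro h
      exact (h1 a b' (by omega)).1.trans (ih (by omega))
  have C : ∀ a b, g a b ≤ k + 1 := by
    intro a b
    rcases Nat.lt_or_ge (2 * k + 1) (a + b) with h | h
    · rw [h3 a b h]; omega
    · refine (A a (2 * k + 1 - b) b (by omega) (by omega)).trans ?_
      rw [h2 _ _ (by omega), ppTop]
      split_ifs <;> omega
  refine ⟨A, B, ?_, ?_, C, h3⟩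
  · intro a b hb
    rcases Nat.lt_or_ge (2 * k + 1) (a + b) with h | h
    · exact h3 a b h
    · have := A a (2 * k + 1 - b) b (by omega) (by omega)
      rw [h2 (2 * k + 1 - b) b (by omega), ppTop] at this
      split_ifs at this with h'
      · omega
      · exact absurd (show 2 * k + 1 - b < k + 1 by omega) h'
  · intro a b ha hab
    have := B a b (2 * k + 1 - a) (by omega) (by omega)
    rw [h2 _ _ (by omega), ppTop, if_neg (by simp only; omega)] at this
    have := C a b
    omega

/-- The lower set of a pattern. -/
def ppSet (k : ℕ) (g : ℕ → ℕ → ℕ) : Set (Fin (k + 1) × Fin (k + 1) × Fin (k + 1)) :=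
  {p | (p.2.2 : ℕ) < g (k - p.1) p.2.1}

lemma ppSet_lower (k : ℕ) (g : ℕ → ℕ → ℕ) (hg : g ∈ ppGT (2 * k + 1) (ppTop k)) :
    IsLowerSet (ppSet k g) := by
  obtain ⟨A, B, -⟩ := mem_ppGT_top k g hg
  rintro ⟨i, j, l⟩ ⟨i', j', l'⟩ ⟨hi, hj, hl⟩ hm
  simp only [ppSet, Set.mem_ofPred_eq] at hm ⊢
  simp only [Fin.le_def] at hi hj hl
  have h1 := B (k - i) j' j hj (by omega)
  have h2 := A (k - i) (k - i') j' (by omega) (by omega)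
  omega

lemma ppSet_bij (k : ℕ) : Nat.card {S : Set (Fin (k + 1) × Fin (k + 1) × Fin (k + 1)) //
    IsLowerSet S} = (ppGT (2 * k + 1) (ppTop k)).card := by
  let F : {g // g ∈ ppGT (2 * k + 1) (ppTop k)} →
      {S : Set (Fin (k + 1) × Fin (k + 1) × Fin (k + 1)) // IsLowerSet S} :=
    fun g => ⟨ppSet k g.1, ppSet_lower k g.1 g.2⟩
  have hF : Function.Bijective F := by
    constructor
    · rintro ⟨g, hg⟩ ⟨g', hg'⟩ h
      have h : ppSet k g = ppSet k g' := congrArg Subtype.val h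
      obtain ⟨-, -, h1, h2, h3, h4⟩ := mem_ppGT_top k g hg
      obtain ⟨-, -, h1', h2', h3', h4'⟩ := mem_ppGT_top k g' hg'
      ext a b
      show g a b = g' a b
      rcases Nat.lt_or_ge (2 * k + 1) (a + b) with hab | hab
      · rw [h4 a b hab, h4' a b hab]
      rcases Nat.lt_or_ge b (k + 1) with hb | hb
      swap
      · rw [h1 a b hb, h1' a b hb]
      rcases Nat.lt_or_ge a (k + 1) with ha | ha
      swap
      · rw [h2 a b ha hab, h2' a b ha hab]
      have key : ∀ c, c < k + 1 → (c < g a b ↔ c < g' a b) := by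
        intro c hc
        have := Set.ext_iff.mp h (⟨k - a, by omega⟩, ⟨b, hb⟩, ⟨c, hc⟩)
        simp only [ppSet, Set.mem_ofPred_eq] at this
        rwa [show k - (k - a) = a by omega] at this
      have u := h3 a b
      have u' := h3' a b
      by_contra hne
      rcases Nat.lt_or_gt_of_ne hne with hlt | hlt
      · have := key (g a b) (by omega)
        omega
      · have := key (g' a b) (by omega)
        omega
    · rintro ⟨S, hS⟩
      have hc : ∀ i j : Fin (k + 1), ∃ c : ℕ, c ≤ k + 1 ∧
          ∀ l : Fin (k + 1), (i, j, l) ∈ S ↔ (l : ℕ) < c := by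
        intro i j
        apply pp_lower_count (k + 1) {l | (i, j, l) ∈ S}
        intro l l' hl h
        exact hS (show (i, j, l') ≤ (i, j, l) from ⟨le_rfl, le_rfl, hl⟩) h
      choose c hc1 hc2 using hc
      have mono : ∀ i j i' j', i' ≤ i → j' ≤ j → c i j ≤ c i' j' := by
        intro i j i' j' hi hj
        by_contra hlt
        have h1 := hc1 i j
        have h2 := (hc2 i j ⟨c i' j', by omega⟩).2 (by simp only; omega)
        have h3 := hS (show (i', j', (⟨c i' j', by omega⟩ : Fin (k + 1))) ≤
          (i, j, (⟨c i' j', by omega⟩ : Fin (k + 1))) from ⟨hi, hj, le_rfl⟩) h2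
        have h4 := (hc2 _ _ _).1 h3
        simp at h4
      let g : ℕ → ℕ → ℕ := fun a b =>
        if 2 * k + 1 < a + b then 0 else
        if hb : k + 1 ≤ b then 0 else
        if ha : k + 1 ≤ a then k + 1 else c ⟨k - a, by omega⟩ ⟨b, by omega⟩
      have hg : g ∈ ppGT (2 * k + 1) (ppTop k) := by
        rw [mem_ppGT]
        refine ⟨?_, ?_, ?_⟩
        · intro a b hab
          constructor
          · simp only [g]
            split_ifs <;> first | omega | exact hc1 _ _ | skip
            apply mono
            · exact le_rfl
            · simp [Fin.le_def]
          · simp only [g]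
            split_ifs <;> first | omega | exact hc1 _ _ | skip
            apply mono
            · simp only [Fin.le_def]; omega
            · exact le_rfl
        · intro a b hab
          simp only [g, ppTop]
          split_ifs <;> omega
        · intro a b hab
          simp only [g]
          rw [if_pos hab]
      refine ⟨⟨g, hg⟩, ?_⟩
      apply Subtype.ext
      ext ⟨i, j, l⟩
      simp only [F, ppSet, Set.mem_ofPred_eq, hc2]
      have : g (k - i) j = c i j := by
        simp only [g]
        rw [if_neg (by omega), dif_neg (by omega), dif_neg (by omega)]
        congr 1
        ext
        simp only
        omega
      rw [this]
  rw [← Nat.card_congr (Equiv.ofBijective F hF)]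
  simp

lemma pp_prod_pairs (m : ℕ) (l : ℕ → ℚ) :
    ∏ i : Fin m, ∏ j ∈ Finset.Ioi i, (l j - l i) =
      ∏ j ∈ Finset.range m, ∏ i ∈ Finset.range j, (l j - l i) := by
  rw [Finset.prod_range (fun j => ∏ i ∈ Finset.range j, (l j - l i))]
  rw [Finset.prod_comm' (s' := Finset.Iio) (t' := Finset.univ) (by simp)]
  refine Finset.prod_congr rfl fun j _ => ?_
  symm
  refine Finset.prod_bij' (fun i hi => ⟨i, (Finset.mem_range.mp hi).trans j.2⟩)
    (fun i _ => (i : ℕ)) ?_ ?_ ?_ ?_ ?_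
  · intro i hi
    first
    | exact Finset.mem_Iio.mpr (Finset.mem_range.mp hi)
    | exact Finset.mem_range.mpr (Fin.lt_def.mp (Finset.mem_Iio.mp hi))
  · intro i hi
    first
    | exact Finset.mem_Iio.mpr (Finset.mem_range.mp hi)
    | exact Finset.mem_range.mpr (Fin.lt_def.mp (Finset.mem_Iio.mp hi))
  · simp
  · simp
  · simp

lemma pp_prod_self (j : ℕ) : ∏ i ∈ Finset.range j, ((j : ℚ) - (i : ℚ)) = Nat.factorial j := by
  rw [← Finset.prod_range_reflect, ← Finset.prod_range_add_one_eq_factorial]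
  push_cast
  refine Finset.prod_congr rfl fun i hi => ?_
  rw [Finset.mem_range] at hi
  rw [show j - 1 - i = j - (i + 1) by omega, Nat.cast_sub (by omega)]
  push_cast
  ring

lemma pp_prod_cross (N n : ℕ) : (∏ i ∈ Finset.range n, (((N + n : ℕ) : ℚ) - (i : ℚ))) *
    Nat.factorial N = Nat.factorial (N + n) := by
  have := Nat.factorial_mul_descFactorial (show n ≤ N + n by omega)
  rw [Nat.add_sub_cancel] at this
  rw [← this, Nat.descFactorial_eq_prod_range]
  push_cast
  rw [mul_comm]
  congr 1
  refine Finset.prod_congr rfl fun i hi => ?_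
  rw [Finset.mem_range] at hi
  rw [Nat.cast_sub (by omega)]
  push_cast
  ring

lemma pp_final (n : ℕ) (l : ℕ → ℚ) (h1 : ∀ i < n, l i = i) (h2 : ∀ i, l (n + i) = 2 * n + i) :
    (∏ j ∈ Finset.range (n + n), ∏ i ∈ Finset.range j, (l j - l i)) =
      (∏ i ∈ Finset.range (n + n), (Nat.factorial i : ℚ)) * ∏ i ∈ Finset.range n,
        (Nat.factorial i * Nat.factorial (i + 2 * n) : ℚ) /
          (Nat.factorial (i + n) : ℚ) ^ 2 := by
  have hf : ∀ i, (Nat.factorial i : ℚ) ≠ 0 := fun i => by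
    exact_mod_cast Nat.factorial_ne_zero i
  rw [Finset.prod_range_add, Finset.prod_range_add, ← Finset.prod_mul_distrib,
    ← Finset.prod_mul_distrib, ← Finset.prod_mul_distrib]
  refine Finset.prod_congr rfl fun j hj => ?_
  rw [Finset.mem_range] at hj
  have e1 : ∏ i ∈ Finset.range j, (l j - l i) = Nat.factorial j := by
    rw [← pp_prod_self]
    refine Finset.prod_congr rfl fun i hi => ?_
    rw [Finset.mem_range] at hi
    rw [h1 j hj, h1 i (by omega)]
  have e2 : ∏ i ∈ Finset.range j, (l (n + j) - l (n + i)) = Nat.factorial j := by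
    rw [← pp_prod_self]
    refine Finset.prod_congr rfl fun i hi => ?_
    rw [h2, h2]
    ring
  have e3 : (∏ i ∈ Finset.range n, (l (n + j) - l i)) * Nat.factorial (j + n)
      = Nat.factorial (j + 2 * n) := by
    rw [show j + 2 * n = (j + n) + n by ring, ← pp_prod_cross (j + n) n]
    congr 1
    refine Finset.prod_congr rfl fun i hi => ?_
    rw [Finset.mem_range] at hi
    rw [h2, h1 i hi]
    push_cast
    ring
  rw [Finset.prod_range_add, e1, e2, ← e3, add_comm n j]
  have := hf (j + n)
  field_simp


/-- (MacMahon) The number of plane partitions in the `n`-cube, i.e. the number of lower sets of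
`Fin n × Fin n × Fin n` under the componentwise order, equals
`∏_{i=0}^{n-1} i!·(i+2n)!/((i+n)!)²`. -/
theorem card_planePartitions (n : ℕ) :
    (Nat.card {S : Set (Fin n × Fin n × Fin n) // IsLowerSet S} : ℚ) =
      ∏ i ∈ Finset.range n,
        (Nat.factorial i * Nat.factorial (i + 2 * n) : ℚ) /
          (Nat.factorial (i + n) : ℚ) ^ 2 := by
  rcases n with _ | k
  · have : Nat.card {S : Set (Fin 0 × Fin 0 × Fin 0) // IsLowerSet S} = 1 := by
      rw [Nat.card_eq_one_iff_unique]
      refine ⟨⟨fun a b => Subtype.ext (Set.ext fun p => p.1.elim0)⟩, ⟨⟨∅, isLowerSet_empty⟩⟩⟩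
    simp [this]
  · rw [ppSet_bij, card_ppGT]
    · have h := ppDet_eq (2 * k + 1 + 1) (fun i => ppTop k i + i)
      let l : ℕ → ℚ := fun i => if i < k + 1 then (i : ℚ) else (k + 1 : ℚ) + i
      have hl : ∀ i : Fin (2 * k + 1 + 1), (((ppTop k i + i : ℕ)) : ℚ) = l i := by
        intro i
        simp only [ppTop, l]
        split_ifs <;> push_cast <;> ring
      simp only [hl] at h
      have h' := pp_final (k + 1) l ?_ ?_
      · have hne : (∏ i : Fin (2 * k + 1 + 1), (Nat.factorial i : ℚ)) ≠ 0 :=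
          Finset.prod_ne_zero_iff.mpr fun i _ => by exact_mod_cast Nat.factorial_ne_zero i
        rw [show (k + 1) + (k + 1) = 2 * k + 1 + 1 by ring, ← pp_prod_pairs, ← h,
          Finset.prod_range (fun i => (Nat.factorial i : ℚ))] at h'
        exact mul_left_cancel₀ hne h'
      · intro i hi
        simp only [l]
        rw [if_pos hi]
      · intro i
        simp only [l]
        rw [if_neg (by omega)]
        push_cast
        ring
    · intro i
      simp only [ppTop, Fin.val_castSucc, Fin.val_succ]
      split_ifs <;> omega
end

section
/- (Andrews) The number of symmetric plane partitions in the n-cube, i.e. the number of lower sets S of Fin n × Fin n × Fin n under the componentwise order satisfying (i,j,k) ∈ S ↔ (j,i,k) ∈ S, equals ∏_{i=0}^{n-1} (2i)!·(i+2n)! / ((2i+n)!·(i+n)!). -/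
namespace SPP

open Finset Matrix

/-- Lagrange-type identity on a finset. -/
lemma key_finset {ι : Type*} [DecidableEq ι] (s : Finset ι) (x : ι → ℝ)
    (hx : Function.Injective x) (hpos : ∀ i, 0 < x i) :
    ∑ j ∈ s, (x j - 1) * ∏ i ∈ s.erase j, (x i * x j - 1) / (x j - x i) = ∏ i ∈ s, x i - 1 := by
  classical
  let v : Option ι → ℝ := fun o => o.elim (-1) x
  let P : Polynomial ℝ := ∏ i ∈ s, (Polynomial.C (x i) * Polynomial.X + Polynomial.C (-1))
  have hdeg : P.natDegree = #s := by
    rw [Polynomial.natDegree_prod]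
    · rw [Finset.sum_congr rfl (fun i _ => Polynomial.natDegree_linear (hpos i).ne')]
      simp
    · intro i _ h
      have := Polynomial.natDegree_linear (b := -1) (hpos i).ne'
      rw [h] at this; simp at this
  have hlc : P.leadingCoeff = ∏ i ∈ s, x i := by
    rw [Polynomial.leadingCoeff_prod]
    exact Finset.prod_congr rfl (fun i _ => Polynomial.leadingCoeff_linear (hpos i).ne')
  have hinj : Function.Injective v := by
    intro a b hab
    rcases a with _ | a <;> rcases b with _ | b <;> simp [v] at hab ⊢
    · linarith [hpos b]
    · linarith [hpos a]
    · exact hx hab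
  have hP0 : P ≠ 0 := by
    intro h; rw [h] at hlc; simp at hlc
    exact (Finset.prod_ne_zero_iff.mpr (fun i _ => (hpos i).ne')) hlc.symm
  have h := Lagrange.leadingCoeff_eq_sum (s := Finset.insertNone s) (v := v) (P := P)
    (hinj.injOn) (by rw [Polynomial.degree_eq_natDegree hP0, hdeg]; simp)
  rw [hlc, Finset.sum_insertNone] at h
  have e1 : (Finset.insertNone s).erase none = s.map Function.Embedding.some := by
    ext o; rcases o with _ | o <;> simp
  have hev : ∀ y, P.eval y = ∏ i ∈ s, (x i * y - 1) := by
    intro y; simp [P, Polynomial.eval_prod, sub_eq_add_neg]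
  have h1 : P.eval (v none) / ∏ j ∈ (Finset.insertNone s).erase none, (v none - v j) = 1 := by
    rw [e1, Finset.prod_map, hev, ← Finset.prod_div_distrib]
    apply Finset.prod_eq_one
    intro i _
    simp only [v, Function.Embedding.some_apply, Option.elim]
    rw [div_eq_one_iff_eq]
    · ring
    · have := hpos i; linarith
  rw [h1] at h
  rw [h, add_sub_cancel_left]
  apply Finset.sum_congr rfl
  intro j hj
  have e2 : (Finset.insertNone s).erase (some j) = insert none ((s.erase j).map Function.Embedding.some) := by
    ext o; rcases o with _ | o <;> simp
  rw [e2, Finset.prod_insert (by simp), Finset.prod_map, hev, ← Finset.mul_prod_erase _ _ hj]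
  simp only [v, Function.Embedding.some_apply, Option.elim]
  rw [Finset.prod_div_distrib, mul_div_mul_comm]
  congr 1
  have := hpos j
  rw [eq_div_iff (by linarith)]
  ring

lemma prod_pairs_succAbove {n : ℕ} (g : Fin (n+1) → Fin (n+1) → ℝ) (hg : ∀ i j, g i j = g j i)
    (j : Fin (n+1)) :
    ∏ i, ∏ k ∈ Ioi i, g i k =
      (∏ i, ∏ k ∈ Ioi i, g (j.succAbove i) (j.succAbove k)) * ∏ i, g (j.succAbove i) j := by
  have H : ∀ (m : ℕ) (f : Fin m → Fin m → ℝ),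
      ∏ i, ∏ k ∈ Ioi i, f i k = ∏ i, ∏ k, if i < k then f i k else 1 := by
    intro m f
    refine Finset.prod_congr rfl (fun i _ => ?_)
    rw [← Finset.prod_filter]
    refine Finset.prod_congr ?_ (fun _ _ => rfl)
    ext; simp
  rw [H, H, Fin.prod_univ_succAbove _ j, Fin.prod_univ_succAbove _ j]
  simp only [lt_irrefl, if_false, one_mul]
  rw [Finset.prod_congr rfl (fun i _ => Fin.prod_univ_succAbove _ j), Finset.prod_mul_distrib]
  rw [← mul_assoc, ← Finset.prod_mul_distrib, mul_comm]
  congr 1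
  · simp [Fin.succAbove_lt_succAbove_iff]
  · refine Finset.prod_congr rfl (fun i _ => ?_)
    rcases lt_or_gt_of_ne (Fin.succAbove_ne j i) with h | h
    · simp [h, h.not_gt]
    · simp [h, h.not_gt, hg j]

lemma vand_succAbove {n : ℕ} (y : Fin (n+1) → ℝ) (j : Fin (n+1)) :
    (vandermonde y).det = (-1) ^ (j : ℕ) * ((vandermonde (y ∘ j.succAbove)).det *
      ∏ i, (y (j.succAbove i) - y j)) := by
  have h1 : vandermonde (y ∘ j.cycleRange.symm) = (vandermonde y).submatrix j.cycleRange.symm id := by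
    ext; simp [vandermonde_apply]
  have h2 := congrArg Matrix.det h1
  rw [Matrix.det_permute, Equiv.Perm.sign_symm, Fin.sign_cycleRange, det_vandermonde,
    Fin.prod_univ_succ] at h2
  have h3 : (vandermonde y).det = (-1) ^ (j : ℕ) * ((-1) ^ (j : ℕ) * (vandermonde y).det) := by
    rw [← mul_assoc, ← mul_pow]; simp
  rw [h3]
  congr 1
  push_cast at h2
  rw [← h2, det_vandermonde, mul_comm]
  congr 1
  · refine Finset.prod_congr rfl (fun i _ => ?_)
    rw [Fin.Ioi_succ]
    simp [Finset.prod_map, Fin.cycleRange_symm_succ]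
  · rw [Fin.Ioi_zero_eq_map]
    simp [Finset.prod_map, Fin.cycleRange_symm_succ]

lemma key_bool {n : ℕ} (x : Fin (n+1) → ℝ) (hx : Function.Injective x) (hpos : ∀ i, 0 < x i)
    (ε : Fin (n+1) → Bool) :
    (∏ i, if ε i then x i else 1) - 1 = ∑ j, if ε j then (x j - 1) * ∏ i : Fin n,
      (if ε (j.succAbove i) then (x (j.succAbove i) * x j - 1) / (x j - x (j.succAbove i)) else 1)
      else 0 := by
  have h := key_finset (univ.filter (fun i => ε i = true)) x hx hpos
  rw [Finset.prod_filter, Finset.sum_filter] at h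
  rw [← h]
  refine Finset.sum_congr rfl (fun j _ => ?_)
  split_ifs with hj
  · congr 1
    have e : (univ.filter (fun i => ε i = true)).erase j
        = univ.filter (fun i => ε i = true ∧ i ≠ j) := by
      ext; simp [and_comm]
    rw [e, Finset.prod_filter, Fin.prod_univ_succAbove _ j]
    simp [Fin.succAbove_ne]
  · rfl

/-- bialternant -/
noncomputable def M {n : ℕ} (N : ℕ) (x : Fin n → ℝ) : ℝ :=
  Matrix.det (Matrix.of fun j i : Fin n => x j ^ N * x j ^ n * (x j)⁻¹ * ((x j)⁻¹) ^ (i : ℕ) - x j ^ (i : ℕ))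

noncomputable def E {n : ℕ} (x : Fin n → ℝ) : ℝ :=
  (∏ i, (x i - 1)) * ∏ i, ∏ k ∈ Ioi i, (x i * x k - 1)

noncomputable def L (n N : ℕ) : Finset (Fin n → ℕ) := by
  classical
  exact (Fintype.piFinset fun _ : Fin n => range N).filter StrictAnti

noncomputable def F {n : ℕ} (N : ℕ) (x : Fin n → ℝ) : ℝ :=
  ∑ l ∈ L n N, Matrix.det (Matrix.of fun i j : Fin n => x j ^ l i)

lemma mem_L {n N : ℕ} {l : Fin n → ℕ} : l ∈ L n N ↔ (∀ i, l i < N) ∧ StrictAnti l := by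
  simp [L]

noncomputable def T {n : ℕ} (N : ℕ) (x : Fin n → ℝ) (ε : Fin n → Bool) : ℝ :=
  (∏ j, if ε j then x j ^ N * x j ^ n * (x j)⁻¹ else -1) *
    (vandermonde (fun j => if ε j then (x j)⁻¹ else x j)).det

lemma M_eq {n : ℕ} (N : ℕ) (x : Fin n → ℝ) : M N x = ∑ ε : Fin n → Bool, T N x ε := by
  have h := (Matrix.detRowAlternating (n := Fin n) (R := ℝ)).toMultilinearMap.map_sum
    (fun (j : Fin n) (b : Bool) =>
      (if b then x j ^ N * x j ^ n * (x j)⁻¹ else -1) •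
        (fun i : Fin n => (if b then (x j)⁻¹ else x j) ^ (i : ℕ)))
  unfold M T
  trans
  · refine Eq.trans ?_ h
    show Matrix.det _ = Matrix.det _
    congr 1
    ext j i
    simp [Fintype.sum_bool]
    ring
  · refine Finset.sum_congr rfl (fun ε _ => ?_)
    exact MultilinearMap.map_smul_univ _ _ _

lemma E_succAbove {n : ℕ} (x : Fin (n+1) → ℝ) (j : Fin (n+1)) :
    E x = E (x ∘ j.succAbove) * ((x j - 1) * ∏ i, (x (j.succAbove i) * x j - 1)) := by
  unfold E
  rw [prod_pairs_succAbove (fun i k => x i * x k - 1) (fun i k => by ring) j,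
    Fin.prod_univ_succAbove _ j]
  simp only [Function.comp]
  ring

lemma T_rec {n : ℕ} (N : ℕ) (x : Fin (n+1) → ℝ) (hx : Function.Injective x) (hpos : ∀ i, 0 < x i)
    (ε : Fin (n+1) → Bool) (j : Fin (n+1)) (hj : ε j = true) :
    T N x ε * ((x j - 1) * ∏ i : Fin n,
      (if ε (j.succAbove i) then (x (j.succAbove i) * x j - 1) / (x j - x (j.succAbove i)) else 1))
    = (-1) ^ (j : ℕ) * x j ^ N * ((x j - 1) * ∏ i, (x (j.succAbove i) * x j - 1)) *
      T N (x ∘ j.succAbove) (ε ∘ j.succAbove) := by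
  unfold T
  rw [vand_succAbove _ j, Fin.prod_univ_succAbove _ j]
  simp only [hj, if_true, Function.comp_def]
  generalize (vandermonde (fun i => if ε (j.succAbove i) = true then (x (j.succAbove i))⁻¹
    else x (j.succAbove i))).det = V
  have hxj := (hpos j).ne'
  have e1 : x j ^ N * x j ^ (n+1) * (x j)⁻¹ = x j ^ N * ∏ i : Fin n, x j := by
    simp; field_simp; ring
  rw [e1]
  have e2 : (∏ i : Fin n, x j) *
      (∏ i : Fin n, if ε (j.succAbove i) then x (j.succAbove i) ^ N * x (j.succAbove i) ^ (n+1) *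
        (x (j.succAbove i))⁻¹ else -1) *
      (∏ i : Fin n, ((if ε (j.succAbove i) then (x (j.succAbove i))⁻¹ else x (j.succAbove i)) - (x j)⁻¹))
      * (∏ i : Fin n,
      (if ε (j.succAbove i) then (x (j.succAbove i) * x j - 1) / (x j - x (j.succAbove i)) else 1))
      = (∏ i, (x (j.succAbove i) * x j - 1)) *
      (∏ i : Fin n, if ε (j.succAbove i) then x (j.succAbove i) ^ N * x (j.succAbove i) ^ n *
        (x (j.succAbove i))⁻¹ else -1) := by
    simp only [← Finset.prod_mul_distrib]
    refine Finset.prod_congr rfl (fun i _ => ?_)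
    have h1 := (hpos (j.succAbove i)).ne'
    have h2 : x j - x (j.succAbove i) ≠ 0 :=
      sub_ne_zero.mpr (fun h => Fin.succAbove_ne j i (hx h).symm)
    split_ifs
    · field_simp
      ring
    · field_simp
  linear_combination (x j ^ N * (-1) ^ (j:ℕ) * V * (x j - 1)) * e2

lemma M_rec {n : ℕ} (N : ℕ) (x : Fin (n+1) → ℝ) (hx : Function.Injective x) (hpos : ∀ i, 0 < x i) :
    M (N+1) x - M N x = ∑ j : Fin (n+1), (-1) ^ (j : ℕ) * x j ^ N *
      ((x j - 1) * ∏ i, (x (j.succAbove i) * x j - 1)) * M N (x ∘ j.succAbove) := by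
  simp only [M_eq, Finset.mul_sum]
  rw [← Finset.sum_sub_distrib]
  have h1 : ∀ ε : Fin (n+1) → Bool, T (N+1) x ε - T N x ε = ∑ j, if ε j then
     (-1) ^ (j : ℕ) * x j ^ N * ((x j - 1) * ∏ i, (x (j.succAbove i) * x j - 1)) *
      T N (x ∘ j.succAbove) (ε ∘ j.succAbove) else 0 := by
    intro ε
    have : T (N+1) x ε = T N x ε * (∏ i, if ε i then x i else 1) := by
      unfold T
      rw [mul_right_comm, ← Finset.prod_mul_distrib]
      congr 1
      refine Finset.prod_congr rfl (fun i _ => ?_)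
      split_ifs
      · ring
      · ring
    rw [this]
    have := key_bool x hx hpos ε
    rw [← mul_sub_one, this, Finset.mul_sum]
    refine Finset.sum_congr rfl (fun j _ => ?_)
    split_ifs with hj
    · exact T_rec N x hx hpos ε j hj
    · simp
  rw [Finset.sum_congr rfl (fun ε _ => h1 ε), Finset.sum_comm]
  refine Finset.sum_congr rfl (fun j _ => ?_)
  rw [← (Fin.insertNthEquiv (fun _ => Bool) j).sum_comp, Fintype.sum_prod_type]
  simp [Function.comp_def, Fintype.sum_bool]

lemma M_zero {n : ℕ} (x : Fin (n+1) → ℝ) (hpos : ∀ i, 0 < x i) : M 0 x = 0 := by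
  unfold M
  rw [← Matrix.exists_mulVec_eq_zero_iff]
  refine ⟨fun _ => 1, fun h => one_ne_zero (congrFun h 0), ?_⟩
  ext j
  simp only [Matrix.mulVec, dotProduct, Matrix.of_apply, mul_one, Pi.zero_apply]
  rw [Finset.sum_sub_distrib, sub_eq_zero, ← Equiv.sum_comp Fin.revPerm]
  refine Finset.sum_congr rfl (fun i _ => ?_)
  have hj := (hpos j).ne'
  simp only [Fin.revPerm_apply, Fin.val_rev, pow_zero, one_mul]
  have : x j ^ (n+1) = x j ^ (i:ℕ) * x j ^ (n + 1 - (i+1)) * x j := by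
    rw [← pow_add, ← pow_succ]; congr 1; omega
  rw [this, inv_pow]
  field_simp

lemma F_rec {n : ℕ} (N : ℕ) (x : Fin (n+1) → ℝ) :
    F (N+1) x = F N x + ∑ j : Fin (n+1), (-1) ^ (j : ℕ) * x j ^ N * F N (x ∘ j.succAbove) := by
  classical
  have hL : L (n+1) (N+1) = L (n+1) N ∪ (L n N).image (fun l => Fin.cons N l) := by
    ext l
    simp only [mem_L, Finset.mem_union, Finset.mem_image]
    constructor
    · rintro ⟨h1, h2⟩
      rcases Nat.lt_succ_iff_lt_or_eq.mp (h1 0) with h | h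
      · left; exact ⟨fun i => lt_of_le_of_lt (h2.antitone (Fin.zero_le i)) h, h2⟩
      · right
        refine ⟨Fin.tail l, ⟨fun i => ?_, fun a b hab => h2 (Fin.succ_lt_succ_iff.mpr hab)⟩, ?_⟩
        · rw [← h]; exact h2 (Fin.succ_pos i)
        · rw [← h]; exact Fin.cons_self_tail l
    · rintro (⟨h1, h2⟩ | ⟨l', ⟨h1, h2⟩, rfl⟩)
      · exact ⟨fun i => (h1 i).trans (Nat.lt_succ_self N), h2⟩
      · constructor
        · intro i
          refine Fin.cases ?_ (fun i => ?_) i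
          · simp
          · simpa using (h1 i).trans (Nat.lt_succ_self N)
        · intro a b
          refine Fin.cases ?_ (fun a => ?_) a <;> refine Fin.cases ?_ (fun b => ?_) b
          · simp
          · simpa using h1 b
          · simp
          · simpa using fun h => h2 h
  have hd : Disjoint (L (n+1) N) ((L n N).image (fun l => Fin.cons N l)) := by
    rw [Finset.disjoint_left]
    intro l hl hl'
    rw [Finset.mem_image] at hl'
    obtain ⟨l', _, rfl⟩ := hl'
    have := (mem_L.mp hl).1 0
    simp at this
  unfold F
  rw [hL, Finset.sum_union hd, Finset.sum_image]
  · congr 1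
    simp only [Finset.mul_sum]
    rw [Finset.sum_comm]
    refine Finset.sum_congr rfl (fun l _ => ?_)
    rw [Matrix.det_succ_row_zero]
    refine Finset.sum_congr rfl (fun j _ => ?_)
    simp only [Matrix.of_apply, Fin.cons_zero]
    congr 1
  · intro a _ b _ h
    exact (Fin.cons_injective2 h).2

theorem M_eq_E_mul_F (N : ℕ) : ∀ (n : ℕ) (x : Fin n → ℝ), Function.Injective x → (∀ i, 0 < x i) →
    M N x = E x * F N x := by
  induction N with
  | zero =>
    intro n x hx hpos
    cases n with
    | zero =>
      have : L 0 0 = {fun i => i.elim0} := by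
        ext l; simp [mem_L, Subsingleton.elim l (fun i => i.elim0), Subsingleton.strictAnti]
      simp [M, E, F, this]
    | succ n =>
      have : L (n+1) 0 = ∅ := by
        ext l; simp [mem_L]
      simp [M_zero x hpos, F, this]
  | succ N ih =>
    intro n x hx hpos
    cases n with
    | zero =>
      have : L 0 (N+1) = {fun i => i.elim0} := by
        ext l; simp [mem_L, Subsingleton.elim l (fun i => i.elim0), Subsingleton.strictAnti]
      simp [M, E, F, this]
    | succ n =>
      have h := M_rec N x hx hpos
      rw [sub_eq_iff_eq_add] at h
      rw [h, ih _ x hx hpos, F_rec, mul_add, add_comm]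
      congr 1
      rw [Finset.mul_sum]
      refine Finset.sum_congr rfl (fun j _ => ?_)
      rw [ih _ _ (hx.comp Fin.succAbove_right_injective) (fun i => hpos _), E_succAbove x j]
      ring

noncomputable def c (n : ℕ) (l : Fin n → ℕ) : ℝ :=
  Matrix.det (Matrix.of fun i j : Fin n => (-1 : ℝ) ^ (j : ℕ) * (Nat.choose (l i) j : ℝ))

lemma sum_Ico_choose (j a b : ℕ) (hab : a ≤ b) :
    ∑ k ∈ Finset.Ico a b, (Nat.choose k j : ℝ) = Nat.choose b (j+1) - Nat.choose a (j+1) := by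
  induction b, hab using Nat.le_induction with
  | base => simp
  | succ b hb ih =>
    rw [Finset.sum_Ico_succ_top hb, ih, Nat.choose_succ_succ]
    push_cast; ring

lemma c_rec (n : ℕ) (l : Fin (n+1) → ℕ) (hl : Antitone l) :
    c (n+1) l = ∑ k ∈ Fintype.piFinset (fun i : Fin n => Finset.Ico (l i.succ) (l i.castSucc)), c n k := by
  have h := (Matrix.detRowAlternating (n := Fin n) (R := ℝ)).toMultilinearMap.map_sum_finset
    (fun (_ : Fin n) (k : ℕ) => (fun j : Fin n => (-1 : ℝ) ^ (j : ℕ) * (Nat.choose k j : ℝ)))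
    (fun i : Fin n => Finset.Ico (l i.succ) (l i.castSucc))
  refine Eq.trans ?_ h
  show _ = Matrix.det _
  let A : Matrix (Fin (n+1)) (Fin (n+1)) ℝ :=
    Matrix.of fun i j => (-1 : ℝ) ^ (j : ℕ) * (Nat.choose (l i) j : ℝ)
  let B : Matrix (Fin (n+1)) (Fin (n+1)) ℝ :=
    Matrix.of fun i j => Fin.cases (A 0 j) (fun i' => A i'.succ j - A i'.castSucc j) i
  have hAB : A.det = B.det := by
    apply Matrix.det_eq_of_forall_row_eq_smul_add_pred (fun _ => 1)
    · intro j; simp [B]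
    · intro i j; simp [B]
  show A.det = _
  rw [hAB, Matrix.det_succ_column_zero, Fin.sum_univ_succ, Finset.sum_eq_zero]
  · have : B 0 0 = 1 := by simp [B, A]
    simp only [this, Fin.val_zero, pow_zero, one_mul, add_zero]
    congr 1
    ext i j
    simp only [Matrix.submatrix_apply, Fin.succAbove_zero, B, A, Matrix.of_apply, Fin.cases_succ,
      Finset.sum_apply, Fin.val_succ]
    rw [← Finset.mul_sum, sum_Ico_choose _ _ _ (hl (Fin.castSucc_lt_succ).le)]
    ring
  · intro i _
    simp [B, A]

lemma prod_fact (n : ℕ) : (∏ j : Fin n, (Nat.factorial j : ℝ)) =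
    ∏ i : Fin n, ∏ k ∈ Ioi i, ((k : ℝ) - (i : ℝ)) := by
  cases n with
  | zero => simp
  | succ n =>
    have h := Matrix.det_vandermonde_id_eq_superFactorial (R := ℝ) n
    rw [det_vandermonde] at h
    rw [h, ← Nat.prod_range_succ_factorial, Fin.prod_univ_eq_prod_range (fun j => (Nat.factorial j : ℝ))]
    push_cast; rfl

lemma c_eq (n : ℕ) (l : Fin n → ℕ) :
    (∏ i : Fin n, ∏ k ∈ Ioi i, ((k : ℝ) - (i : ℝ))) * c n l =
      ∏ i : Fin n, ∏ k ∈ Ioi i, ((l i : ℝ) - (l k : ℝ)) := by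
  have h := det_eval_matrixOfPolynomials_eq_det_vandermonde (fun i => -(l i : ℝ))
      (fun i => ascPochhammer ℝ i)
      (fun i => ascPochhammer_natDegree ℝ i)
      (fun i => monic_ascPochhammer ℝ i)
  rw [det_vandermonde] at h
  have h1 : ∏ i : Fin n, ∏ k ∈ Ioi i, ((l i : ℝ) - (l k : ℝ)) =
    ∏ i : Fin n, ∏ k ∈ Ioi i, (-(l k : ℝ) - -(l i : ℝ)) := by
    refine Finset.prod_congr rfl (fun i _ => Finset.prod_congr rfl (fun k _ => by ring))
  rw [h1, h, ← prod_fact]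
  unfold c
  rw [← Matrix.det_mul_row]
  congr 1
  ext i j
  simp only [Matrix.of_apply]
  rw [ascPochhammer_eval_neg_eq_descPochhammer, descPochhammer_eval_eq_descFactorial,
    Nat.descFactorial_eq_factorial_mul_choose]
  push_cast; ring

/-- extend an array by a new diagonal -/
def extd (n : ℕ) (l : Fin (n+1) → ℕ) (h : ℕ → ℕ → ℕ) : ℕ → ℕ → ℕ := fun i j =>
  if i < j then h i (j - 1) else if hi : i = j ∧ i < n + 1 then l ⟨i, hi.2⟩ else 0

noncomputable def A : (n : ℕ) → (Fin n → ℕ) → Finset (ℕ → ℕ → ℕ)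
  | 0, _ => {fun _ _ => 0}
  | n+1, l => by
    classical
    exact (Fintype.piFinset (fun i : Fin n => Finset.Ico (l i.succ) (l i.castSucc))).biUnion
      (fun k => (A n k).image (extd n l))

def U (n : ℕ) (l : Fin n → ℕ) (h : ℕ → ℕ → ℕ) : Prop :=
  (∀ i j, ¬ (i ≤ j ∧ j < n) → h i j = 0) ∧ (∀ i j, i ≤ j → j + 1 < n → h i (j+1) < h i j) ∧
  (∀ i j, i < j → j < n → h (i+1) j ≤ h i j) ∧ ∀ i : Fin n, h i i = l i

lemma mem_A : ∀ (n : ℕ) (l : Fin n → ℕ) (h : ℕ → ℕ → ℕ), h ∈ A n l ↔ U n l h := by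
  classical
  intro n
  induction n with
  | zero =>
    intro l h
    simp only [A, Finset.mem_singleton, U]
    constructor
    · rintro rfl; simp
    · rintro ⟨h1, -⟩; ext i j; exact h1 i j (by omega)
  | succ n ih =>
    intro l h
    simp only [A, Finset.mem_biUnion, Finset.mem_image, Fintype.mem_piFinset, Finset.mem_Ico]
    constructor
    · rintro ⟨k, hk, h', hh', rfl⟩
      rw [ih] at hh'
      obtain ⟨h1, h2, h3, h4⟩ := hh'
      refine ⟨?_, ?_, ?_, ?_⟩
      · intro i j hij
        unfold extd
        split_ifs with ha hb
        · exact h1 _ _ (by omega)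
        · omega
        · rfl
      · intro i j hij hj
        unfold extd
        rw [if_pos (by omega)]
        rcases hij.lt_or_eq with hlt | rfl
        · rw [if_pos hlt]
          have := h2 i (j-1) (by omega) (by omega)
          rwa [Nat.sub_add_cancel (by omega)] at this
        · rw [if_neg (lt_irrefl _), dif_pos ⟨rfl, by omega⟩]
          have := (hk ⟨i, by omega⟩).2
          rw [← h4] at this
          exact this
      · intro i j hij hj
        unfold extd
        rw [if_pos hij]
        rcases (Nat.succ_le_of_lt hij).lt_or_eq with hlt | rfl
        · rw [if_pos hlt]
          exact h3 i (j-1) (by omega) (by omega)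
        · rw [if_neg (lt_irrefl _), dif_pos ⟨rfl, by omega⟩]
          have := (hk ⟨i, by omega⟩).1
          rw [← h4] at this
          exact this
      · intro i
        unfold extd
        rw [if_neg (lt_irrefl _), dif_pos ⟨rfl, i.2⟩]
    · rintro ⟨h1, h2, h3, h4⟩
      refine ⟨fun i => h i (i+1), ?_, fun i j => if i ≤ j then h i (j+1) else 0, ?_, ?_⟩
      · intro i
        have e1 := h4 i.succ
        have e2 := h4 i.castSucc
        rw [← e1, ← e2]
        exact ⟨h3 i (i+1) (by omega) (by omega), h2 i i le_rfl (by omega)⟩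
      · rw [ih]
        refine ⟨?_, ?_, ?_, ?_⟩
        · intro i j hij
          dsimp only
          split_ifs
          · exact h1 _ _ (by omega)
          · rfl
        · intro i j hij hj
          dsimp only
          rw [if_pos (by omega), if_pos hij]
          exact h2 _ _ (by omega) (by omega)
        · intro i j hij hj
          dsimp only
          rw [if_pos (by omega), if_pos (by omega)]
          exact h3 _ _ (by omega) (by omega)
        · intro i; simp
      · ext i j
        unfold extd
        split_ifs with ha hc
        · dsimp only
          rw [if_pos (by omega), Nat.sub_add_cancel (by omega)]
        · obtain ⟨rfl, hi⟩ := hc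
          exact (h4 ⟨i, hi⟩).symm
        · exact (h1 _ _ (by omega)).symm

lemma card_A : ∀ (n : ℕ) (l : Fin n → ℕ), Antitone l → ((A n l).card : ℝ) = c n l := by
  classical
  intro n
  induction n with
  | zero => intro l _; simp [A, c]
  | succ n ih =>
    intro l hl
    rw [c_rec n l hl]
    simp only [A]
    rw [Finset.card_biUnion]
    · push_cast
      refine Finset.sum_congr rfl (fun k hk => ?_)
      rw [Finset.card_image_of_injOn, ih]
      · simp only [Fintype.mem_piFinset, Finset.mem_Ico] at hk
        rcases n with _ | n
        · intro a; exact a.elim0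
        · refine Fin.antitone_iff_succ_le.mpr (fun i => ?_)
          have a1 := (hk i.succ).2
          have a2 := (hk i.castSucc).1
          rw [Fin.succ_castSucc] at a2
          omega
      · intro h hh h' hh' e
        rw [Finset.mem_coe, mem_A] at hh hh'
        ext i j
        by_cases hij : i ≤ j
        · have := congrFun (congrFun e i) (j+1)
          unfold extd at this
          rw [if_pos (by omega), if_pos (by omega)] at this
          simpa using this
        · rw [hh.1 i j (by omega), hh'.1 i j (by omega)]
    · intro k _ k' _ hkk'
      rw [Function.onFun, Finset.disjoint_left]
      intro h hh hh'
      rw [Finset.mem_image] at hh hh'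
      obtain ⟨a, ha, rfl⟩ := hh
      obtain ⟨b, hb, e⟩ := hh'
      rw [mem_A] at ha hb
      apply hkk'
      ext i
      rw [← ha.2.2.2, ← hb.2.2.2]
      have := congrFun (congrFun e i) (i+1)
      unfold extd at this
      rw [if_pos (by omega), if_pos (by omega)] at this
      simpa using this.symm

noncomputable def B (n : ℕ) : Finset (ℕ → ℕ → ℕ) := by
  classical
  exact (L n (2 * n)).biUnion (A n)

lemma card_B (n : ℕ) : ((B n).card : ℝ) = ∑ l ∈ L n (2 * n), c n l := by
  classical
  unfold B
  rw [Finset.card_biUnion]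
  · push_cast
    refine Finset.sum_congr rfl (fun l hl => ?_)
    exact card_A n l (mem_L.mp hl).2.antitone
  · intro k _ k' _ hkk'
    rw [Function.onFun, Finset.disjoint_left]
    intro h hh hh'
    rw [mem_A] at hh hh'
    apply hkk'
    ext i
    rw [← hh.2.2.2, ← hh'.2.2.2]

lemma mem_B (n : ℕ) (h : ℕ → ℕ → ℕ) : h ∈ B n ↔
    (∀ i j, ¬ (i ≤ j ∧ j < n) → h i j = 0) ∧ (∀ i j, i ≤ j → j + 1 < n → h i (j+1) < h i j) ∧
    (∀ i j, i < j → j < n → h (i+1) j ≤ h i j) ∧ ∀ i, i < n → h i i < 2 * n := by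
  unfold B
  simp only [Finset.mem_biUnion, mem_A]
  constructor
  · rintro ⟨l, hl, h1, h2, h3, h4⟩
    refine ⟨h1, h2, h3, fun i hi => ?_⟩
    have := h4 ⟨i, hi⟩
    dsimp only at this
    rw [this]
    exact (mem_L.mp hl).1 _
  · rintro ⟨h1, h2, h3, h4⟩
    refine ⟨fun i => h i i, mem_L.mpr ⟨fun i => h4 i i.2, ?_⟩, h1, h2, h3, fun _ => rfl⟩
    rcases n with _ | n
    · intro a; exact a.elim0
    · refine Fin.strictAnti_iff_succ_lt.mpr (fun i => ?_)
      have a1 := h2 i i le_rfl (by omega)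
      have a2 := h3 i (i+1) (by omega) (by omega)
      exact lt_of_le_of_lt a2 a1

lemma mono_B {n : ℕ} {h : ℕ → ℕ → ℕ} (hh : h ∈ B n) {i j i' j' : ℕ} (hij : i ≤ j) (hj : j ≤ j')
    (hi : i ≤ i') (hij' : i' ≤ j') (hn : j' < n) : h i' j' + j' ≤ h i j + j := by
  obtain ⟨h1, h2, h3, h4⟩ := (mem_B n h).mp hh
  have s1 : h i j' + j' ≤ h i j + j := by
    clear hij'
    induction j', hj using Nat.le_induction with
    | base => rfl
    | succ m hm ih =>
      have := h2 i m (by omega) hn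
      have := ih (by omega)
      omega
  have s2 : h i' j' ≤ h i j' := by
    clear s1
    induction i', hi using Nat.le_induction with
    | base => rfl
    | succ m hm ih =>
      have := h3 m j' (by omega) hn
      have := ih (by omega)
      omega
  omega

lemma lower_card {n : ℕ} (s : Finset (Fin n)) (hs : ∀ a b : Fin n, a ≤ b → b ∈ s → a ∈ s)
    (k : Fin n) : k ∈ s ↔ (k : ℕ) < s.card := by
  constructor
  · intro hk
    have : Finset.Iic k ⊆ s := fun a ha => hs a k (Finset.mem_Iic.mp ha) hk
    have := Finset.card_le_card this
    rw [Fin.card_Iic] at this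
    omega
  · intro hk
    by_contra hks
    have : s ⊆ Finset.Iio k := by
      intro a ha
      rw [Finset.mem_Iio]
      by_contra hak
      exact hks (hs k a (not_lt.mp hak) ha)
    have := Finset.card_le_card this
    rw [Fin.card_Iio] at this
    omega

open Classical in
noncomputable def ht {n : ℕ} (S : Set (Fin n × Fin n × Fin n)) (i j : Fin n) : ℕ :=
  (univ.filter (fun k => (i, j, k) ∈ S)).card

lemma mem_iff_ht {n : ℕ} {S : Set (Fin n × Fin n × Fin n)} (hS : IsLowerSet S) (i j k : Fin n) :
    (i, j, k) ∈ S ↔ (k : ℕ) < ht S i j := by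
  classical
  unfold ht
  rw [← lower_card]
  · simp
  · intro a b hab hb
    simp only [Finset.mem_filter, Finset.mem_univ, true_and] at hb ⊢
    exact hS (show (i, j, a) ≤ (i, j, b) from ⟨le_rfl, le_rfl, hab⟩) hb

lemma ht_le {n : ℕ} (S : Set (Fin n × Fin n × Fin n)) (i j : Fin n) : ht S i j ≤ n := by
  classical
  unfold ht
  exact (Finset.card_le_univ _).trans (by simp)

lemma ht_anti {n : ℕ} {S : Set (Fin n × Fin n × Fin n)} (hS : IsLowerSet S) {i j i' j' : Fin n}
    (hi : i ≤ i') (hj : j ≤ j') : ht S i' j' ≤ ht S i j := by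
  classical
  unfold ht
  apply Finset.card_le_card
  intro k
  simp only [Finset.mem_filter, Finset.mem_univ, true_and]
  exact fun h => hS (show (i, j, k) ≤ (i', j', k) from ⟨hi, hj, le_rfl⟩) h

noncomputable def arr {n : ℕ} (S : Set (Fin n × Fin n × Fin n)) : ℕ → ℕ → ℕ := fun i j =>
  if h : i ≤ j ∧ j < n then ht S ⟨i, by omega⟩ ⟨j, h.2⟩ + (n - 1 - j) else 0

lemma arr_mem {n : ℕ} {S : Set (Fin n × Fin n × Fin n)} (hS : IsLowerSet S) : arr S ∈ B n := by
  rw [mem_B]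
  refine ⟨?_, ?_, ?_, ?_⟩
  · intro i j h; simp only [arr]; rw [dif_neg h]
  · intro i j hij hj
    simp only [arr]
    rw [dif_pos ⟨by omega, hj⟩, dif_pos ⟨hij, by omega⟩]
    have := ht_anti hS (i := ⟨i, by omega⟩) (i' := ⟨i, by omega⟩) (j := ⟨j, by omega⟩)
      (j' := ⟨j+1, hj⟩) le_rfl (by simp)
    omega
  · intro i j hij hj
    simp only [arr]
    rw [dif_pos ⟨by omega, hj⟩, dif_pos ⟨by omega, by omega⟩]
    have := ht_anti hS (i := ⟨i, by omega⟩) (i' := ⟨i+1, by omega⟩) (j := ⟨j, by omega⟩)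
      (j' := ⟨j, hj⟩) (by simp) le_rfl
    omega
  · intro i hi
    simp only [arr]
    rw [dif_pos ⟨le_rfl, hi⟩]
    have := ht_le S ⟨i, hi⟩ ⟨i, hi⟩
    omega

lemma card_spp (n : ℕ) : Nat.card {S : Set (Fin n × Fin n × Fin n) // IsLowerSet S ∧
        ∀ i j k : Fin n, (i, j, k) ∈ S ↔ (j, i, k) ∈ S} = (B n).card := by
  have hB : Nat.card {h // h ∈ B n} = (B n).card := by simp
  rw [← hB]
  apply Nat.card_eq_of_bijective (fun S => ⟨arr S.1, arr_mem S.2.1⟩)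
  constructor
  · rintro ⟨S, hS, hs⟩ ⟨S', hS', hs'⟩ e
    have e : arr S = arr S' := congrArg Subtype.val e
    have key : ∀ i j k : Fin n, i ≤ j → ((i, j, k) ∈ S ↔ (i, j, k) ∈ S') := by
      intro i j k hij
      have := congrFun (congrFun e i) j
      simp only [arr] at this
      rw [dif_pos ⟨hij, j.2⟩, dif_pos ⟨hij, j.2⟩] at this
      rw [mem_iff_ht hS, mem_iff_ht hS']
      simp only [Fin.eta] at this
      omega
    apply Subtype.ext
    ext ⟨i, j, k⟩
    rcases le_total i j with h | h
    · exact key i j k h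
    · show (i, j, k) ∈ S ↔ (i, j, k) ∈ S'
      rw [hs, hs']; exact key j i k h
  · rintro ⟨h, hh⟩
    let S : Set (Fin n × Fin n × Fin n) := {p | (p.2.2 : ℕ) + (n - 1) <
      h (min p.1 p.2.1 : Fin n) (max p.1 p.2.1 : Fin n) + (max p.1 p.2.1 : Fin n)}
    have hS : IsLowerSet S := by
      rintro ⟨i', j', k'⟩ ⟨i, j, k⟩ ⟨hi, hj, hk⟩ hm
      change (k' : ℕ) + (n - 1) < h (min i' j' : Fin n) (max i' j' : Fin n) + (max i' j' : Fin n) at hm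
      show (k : ℕ) + (n - 1) < h (min i j : Fin n) (max i j : Fin n) + (max i j : Fin n)
      have hk : (k : ℕ) ≤ k' := hk
      have := mono_B hh (i := (min i j : Fin n)) (j := (max i j : Fin n)) (i' := (min i' j' : Fin n))
        (j' := (max i' j' : Fin n)) (Fin.le_def.mp min_le_max)
        (Fin.le_def.mp (max_le_max hi hj)) (Fin.le_def.mp (min_le_min hi hj))
        (Fin.le_def.mp min_le_max) (Fin.is_lt _)
      omega
    refine ⟨⟨S, hS, ?_⟩, ?_⟩
    · intro i j k
      simp only [S, Set.mem_setOf_eq, min_comm i j, max_comm i j]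
    · apply Subtype.ext
      show arr S = h
      ext i j
      simp only [arr]
      split_ifs with hij
      · have h0 := ((mem_B n h).mp hh)
        have m1 := mono_B hh (i := 0) (j := 0) (i' := i) (j' := j) le_rfl (by omega) (by omega) hij.1 hij.2
        have m2 := h0.2.2.2 0 (by omega)
        have m3 := mono_B hh (i := i) (j := j) (i' := i) (j' := n - 1) hij.1 (by omega) le_rfl
          (by omega) (by omega)
        have hi : i < n := by omega
        have mm : ∀ k : Fin n, (k : ℕ) + (n - 1) < h i j + j ↔
            (k : ℕ) < ht S ⟨i, by omega⟩ ⟨j, hij.2⟩ := by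
          intro k
          rw [← mem_iff_ht hS]
          have hle : (⟨i, hi⟩ : Fin n) ≤ ⟨j, hij.2⟩ := hij.1
          simp only [S, Set.mem_setOf_eq, min_eq_left hle, max_eq_right hle]
        have hle := ht_le S ⟨i, by omega⟩ ⟨j, hij.2⟩
        generalize ht S ⟨i, by omega⟩ ⟨j, hij.2⟩ = t at *
        have q1 : ∀ k, k < n → (k + (n - 1) < h i j + j ↔ k < t) := fun k hk => mm ⟨k, hk⟩
        rcases lt_trichotomy (t + (n-1)) (h i j + j) with hlt | heq | hgt
        · have := q1 t (by omega); omega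
        · omega
        · have := q1 (h i j + j - (n-1)) (by omega); omega
      · exact (((mem_B n h).mp hh).1 i j hij).symm

open Polynomial in
noncomputable def chp : ℕ → Polynomial ℝ
  | 0 => 1
  | 1 => X + 1
  | (j+2) => X * chp (j+1) - chp j

open Polynomial in
lemma chp_deg : ∀ j : ℕ, (chp j).natDegree = j ∧ (chp j).Monic ∧
    (chp (j+1)).natDegree = j+1 ∧ (chp (j+1)).Monic := by
  intro j
  induction j with
  | zero =>
    refine ⟨by simp [chp], by simp [chp], ?_, ?_⟩
    · simpa [chp] using natDegree_X_add_C (1:ℝ)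
    · simpa [chp] using monic_X_add_C (1:ℝ)
  | succ j ih =>
    obtain ⟨h1, h2, h3, h4⟩ := ih
    refine ⟨h3, h4, ?_⟩
    have hm : (X * chp (j+1)).Monic := monic_X.mul h4
    have hd : (X * chp (j+1)).natDegree = j + 2 := by
      rw [natDegree_X_mul h4.ne_zero, h3]
    have hlt : (chp j).degree < (X * chp (j+1)).degree := by
      rw [degree_eq_natDegree h2.ne_zero, degree_eq_natDegree hm.ne_zero, hd, h1]
      exact_mod_cast (by omega : j < j + 2)
    have e : chp (j+1+1) = X * chp (j+1) - chp j := rfl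
    rw [e]
    refine ⟨?_, hm.sub_of_left hlt⟩
    rw [natDegree_sub_eq_left_of_natDegree_lt (by rw [hd, h1]; omega), hd]

lemma chp_eval (z : ℝ) (hz : z ≠ 0) : ∀ j : ℕ,
    ((z - z⁻¹) * (chp j).eval (z^2 + (z⁻¹)^2) = z^(2*j+1) - (z⁻¹)^(2*j+1)) ∧
    ((z - z⁻¹) * (chp (j+1)).eval (z^2 + (z⁻¹)^2) = z^(2*(j+1)+1) - (z⁻¹)^(2*(j+1)+1)) := by
  have hzz : z * z⁻¹ = 1 := mul_inv_cancel₀ hz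
  generalize z⁻¹ = w at *
  intro j
  induction j with
  | zero =>
    refine ⟨by simp [chp], ?_⟩
    simp [chp]
    linear_combination (w - z) * hzz
  | succ j ih =>
    refine ⟨ih.2, ?_⟩
    have e : chp (j+1+1) = Polynomial.X * chp (j+1) - chp j := rfl
    rw [e, Polynomial.eval_sub, Polynomial.eval_mul, Polynomial.eval_X]
    have e2 : z^(2*(j+1)+1) * w^2 = z^(2*j+1) := by
      linear_combination z^(2*j+1) * (z * w + 1) * hzz
    have e3 : w^(2*(j+1)+1) * z^2 = w^(2*j+1) := by
      linear_combination w^(2*j+1) * (z * w + 1) * hzz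
    linear_combination (z^2 + w^2) * ih.2 - ih.1 + e2 - e3

noncomputable def xs {n : ℕ} (t : ℝ) (j : Fin n) : ℝ := Real.exp (2 * t * (2 * (j : ℕ) + 1))

lemma M_xs (n N : ℕ) (t : ℝ) :
    M N (xs (n := n) t) = (∏ j : Fin n, Real.exp (t * (2 * (j:ℕ) + 1) * (N + n - 1))) *
      ((∏ i : Fin n, (Real.exp ((N + n - 1 - 2 * (i:ℕ)) * t) - Real.exp (-(N + n - 1 - 2 * (i:ℕ)) * t))) *
      ∏ i : Fin n, ∏ k ∈ Ioi i,
        ((Real.exp (-2 * ((k:ℕ) - (i:ℕ)) * t) - Real.exp (2 * ((k:ℕ) - (i:ℕ)) * t)) *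
        (Real.exp (2 * (N + n - 1 - (i:ℕ) - (k:ℕ)) * t)
          - Real.exp (-2 * (N + n - 1 - (i:ℕ) - (k:ℕ)) * t)))) := by
  let z : Fin n → ℝ := fun i => Real.exp ((N + n - 1 - 2 * (i:ℕ)) * t)
  have hz : ∀ i, z i ≠ 0 := fun i => (Real.exp_pos _).ne'
  have hV := det_eval_matrixOfPolynomials_eq_det_vandermonde (fun i => z i ^ 2 + (z i)⁻¹ ^ 2)
      (fun j => chp j) (fun j => (chp_deg j).1) (fun j => (chp_deg j).2.1)
  have h1 : ∏ i : Fin n, ∏ k ∈ Ioi i,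
        ((Real.exp (-2 * ((k:ℕ) - (i:ℕ)) * t) - Real.exp (2 * ((k:ℕ) - (i:ℕ)) * t)) *
        (Real.exp (2 * (N + n - 1 - (i:ℕ) - (k:ℕ)) * t)
          - Real.exp (-2 * (N + n - 1 - (i:ℕ) - (k:ℕ)) * t))) =
      ∏ i : Fin n, ∏ k ∈ Ioi i, ((z k ^ 2 + (z k)⁻¹ ^ 2) - (z i ^ 2 + (z i)⁻¹ ^ 2)) := by
    refine Finset.prod_congr rfl (fun i _ => Finset.prod_congr rfl (fun k _ => ?_))
    have a1 : Real.exp (-2 * ((k:ℕ) - (i:ℕ)) * t) = z k * (z i)⁻¹ := by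
      simp only [z, ← Real.exp_neg, ← Real.exp_add]; ring_nf
    have a2 : Real.exp (2 * ((k:ℕ) - (i:ℕ)) * t) = z i * (z k)⁻¹ := by
      simp only [z, ← Real.exp_neg, ← Real.exp_add]; ring_nf
    have a3 : Real.exp (2 * (N + n - 1 - (i:ℕ) - (k:ℕ)) * t) = z i * z k := by
      simp only [z, ← Real.exp_add]; ring_nf
    have a4 : Real.exp (-2 * (N + n - 1 - (i:ℕ) - (k:ℕ)) * t) = (z i)⁻¹ * (z k)⁻¹ := by
      simp only [z, ← Real.exp_neg, ← Real.exp_add]; ring_nf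
    rw [a1, a2, a3, a4]
    have b1 := hz i
    have b2 := hz k
    field_simp
    ring
  rw [h1, ← det_vandermonde, hV]
  have h2 : ∀ i : Fin n, Real.exp (-(N + n - 1 - 2 * (i:ℕ)) * t) = (z i)⁻¹ := by
    intro i; simp only [z, ← Real.exp_neg]; ring_nf
  simp only [h2]
  rw [← Matrix.det_mul_column, ← Matrix.det_mul_row, ← Matrix.det_transpose]
  unfold M
  rw [← Matrix.det_transpose]
  rw [← Matrix.det_transpose]
  congr 1
  ext j i
  simp only [Matrix.transpose_apply, Matrix.of_apply]
  have := (chp_eval (z i) (hz i) j).1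
  change _ = _ * ((z i - (z i)⁻¹) * _)
  rw [this]
  simp only [z, xs, ← Real.exp_neg, ← Real.exp_nat_mul, ← Real.exp_add, mul_sub]
  push_cast
  ring_nf

lemma F_xs (n N : ℕ) (t : ℝ) :
    F N (xs (n := n) t) = ∑ l ∈ L n N, (∏ i : Fin n, Real.exp (2 * t * l i)) *
      ∏ i : Fin n, ∏ k ∈ Ioi i, (Real.exp (4 * l k * t) - Real.exp (4 * l i * t)) := by
  unfold F
  refine Finset.sum_congr rfl (fun l _ => ?_)
  rw [← det_vandermonde (fun i => Real.exp (4 * l i * t)), ← Matrix.det_mul_column]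
  congr 1
  ext i j
  simp only [Matrix.of_apply, vandermonde_apply, xs, ← Real.exp_nat_mul, ← Real.exp_add]
  congr 1; ring

lemma E_xs (n : ℕ) (t : ℝ) : E (xs (n := n) t) =
    (∏ i : Fin n, (Real.exp (2 * (2 * (i:ℕ) + 1) * t) - Real.exp (0 * t))) *
    ∏ i : Fin n, ∏ k ∈ Ioi i, (Real.exp (4 * ((i:ℕ) + (k:ℕ) + 1) * t) - Real.exp (0 * t)) := by
  unfold E xs
  simp only [zero_mul, Real.exp_zero, ← Real.exp_add]
  congr 1
  · refine Finset.prod_congr rfl (fun i _ => ?_)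
    ring_nf
  · refine Finset.prod_congr rfl (fun i _ => Finset.prod_congr rfl (fun k _ => ?_))
    ring_nf

open Filter Topology

lemma lim_exp (a b : ℝ) : Tendsto (fun t => (Real.exp (a * t) - Real.exp (b * t)) / t) (𝓝[>] 0)
    (𝓝 (a - b)) := by
  have h : HasDerivAt (fun t => Real.exp (a * t) - Real.exp (b * t)) (a - b) 0 := by
    have h1 := ((hasDerivAt_id (0:ℝ)).const_mul a).exp
    have h2 := ((hasDerivAt_id (0:ℝ)).const_mul b).exp
    have h3 := h1.sub h2
    simp only [id, mul_zero, Real.exp_zero, one_mul, mul_one] at h3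
    exact h3
  have h3 := h.tendsto_slope_zero_right
  refine h3.congr (fun t => ?_)
  simp [div_eq_inv_mul]

lemma lim_one (a b : ℝ) : Tendsto (fun t => Real.exp (a * t * b)) (𝓝[>] 0) (𝓝 1) := by
  have : Continuous (fun t => Real.exp (a * t * b)) := by fun_prop
  have h := this.tendsto 0
  simp only [mul_zero, zero_mul, Real.exp_zero] at h
  exact h.mono_left nhdsWithin_le_nhds

lemma lim_one' (b : ℝ) (d : ℝ) : Tendsto (fun t => Real.exp (t * b * d)) (𝓝[>] 0) (𝓝 1) := by
  have := lim_one b d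
  refine this.congr (fun t => by ring_nf)

lemma limit_identity (n N : ℕ) :
    (∏ i : Fin n, (2 * ((N:ℝ) + n - 1 - 2 * (i:ℕ)))) *
      ∏ i : Fin n, ∏ k ∈ Ioi i, ((-4 * (((k:ℕ):ℝ) - (i:ℕ))) * (4 * ((N:ℝ) + n - 1 - (i:ℕ) - (k:ℕ)))) =
    ((∏ i : Fin n, (2 * (2 * ((i:ℕ):ℝ) + 1))) *
      ∏ i : Fin n, ∏ k ∈ Ioi i, (4 * (((i:ℕ):ℝ) + (k:ℕ) + 1))) *
    ∑ l ∈ L n N, ∏ i : Fin n, ∏ k ∈ Ioi i, (4 * (l k : ℝ) - 4 * l i) := by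
  have key : ∀ t : ℝ, 0 < t →
    (∏ j : Fin n, Real.exp (t * (2 * (j:ℕ) + 1) * (N + n - 1))) *
      ((∏ i : Fin n, (Real.exp ((N + n - 1 - 2 * (i:ℕ)) * t) - Real.exp (-(N + n - 1 - 2 * (i:ℕ)) * t)) / t) *
      ∏ i : Fin n, ∏ k ∈ Ioi i,
        (((Real.exp (-2 * ((k:ℕ) - (i:ℕ)) * t) - Real.exp (2 * ((k:ℕ) - (i:ℕ)) * t)) / t) *
        ((Real.exp (2 * (N + n - 1 - (i:ℕ) - (k:ℕ)) * t)
          - Real.exp (-2 * (N + n - 1 - (i:ℕ) - (k:ℕ)) * t)) / t))) =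
    ((∏ i : Fin n, (Real.exp (2 * (2 * (i:ℕ) + 1) * t) - Real.exp (0 * t)) / t) *
    ∏ i : Fin n, ∏ k ∈ Ioi i, (Real.exp (4 * ((i:ℕ) + (k:ℕ) + 1) * t) - Real.exp (0 * t)) / t) *
    ∑ l ∈ L n N, (∏ i : Fin n, Real.exp (2 * t * l i)) *
      ∏ i : Fin n, ∏ k ∈ Ioi i, (Real.exp (4 * l k * t) - Real.exp (4 * l i * t)) / t := by
    intro t ht
    have h := M_eq_E_mul_F N n (xs t) (by
      intro i j hij
      have := Real.exp_injective hij
      have h2 : (2 * t) ≠ 0 := by positivity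
      have := mul_left_cancel₀ h2 this
      have h3 : ((i:ℕ):ℝ) = (j:ℕ) := by linarith
      exact Fin.ext (by exact_mod_cast h3)) (fun i => Real.exp_pos _)
    rw [M_xs, E_xs, F_xs] at h
    simp only [Finset.prod_div_distrib, Finset.prod_mul_distrib, ← mul_div_assoc, ← Finset.sum_div]
    simp only [Finset.prod_mul_distrib] at h
    have hT2 : ∏ i : Fin n, ∏ k ∈ Ioi i, t ≠ 0 :=
      Finset.prod_ne_zero_iff.mpr fun _ _ => Finset.prod_ne_zero_iff.mpr fun _ _ => ht.ne'
    have hT1 : ∏ i : Fin n, t ≠ 0 := Finset.prod_ne_zero_iff.mpr fun _ _ => ht.ne'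
    generalize ∏ i : Fin n, ∏ k ∈ Ioi i, t = T2 at *
    generalize ∏ i : Fin n, t = T1 at *
    generalize (∏ i : Fin n, (Real.exp (2 * (2 * (i:ℕ) + 1) * t) - Real.exp (0 * t))) = e1 at h ⊢
    generalize (∏ j : Fin n, Real.exp (t * (2 * (j:ℕ) + 1) * (N + n - 1))) = e2 at h ⊢
    generalize (∏ i : Fin n, (Real.exp ((N + n - 1 - 2 * (i:ℕ)) * t) -
      Real.exp (-(N + n - 1 - 2 * (i:ℕ)) * t))) = e3 at h ⊢
    generalize (∏ i : Fin n, ∏ k ∈ Ioi i, (Real.exp (-2 * ((k:ℕ) - (i:ℕ)) * t) -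
      Real.exp (2 * ((k:ℕ) - (i:ℕ)) * t))) = e4 at h ⊢
    generalize (∏ i : Fin n, ∏ k ∈ Ioi i, (Real.exp (2 * (N + n - 1 - (i:ℕ) - (k:ℕ)) * t)
          - Real.exp (-2 * (N + n - 1 - (i:ℕ) - (k:ℕ)) * t))) = e5 at h ⊢
    generalize (∏ i : Fin n, ∏ k ∈ Ioi i, (Real.exp (4 * ((i:ℕ) + (k:ℕ) + 1) * t) -
      Real.exp (0 * t))) = e6 at h ⊢
    generalize (∑ l ∈ L n N, (∏ i : Fin n, Real.exp (2 * t * l i)) *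
      ∏ i : Fin n, ∏ k ∈ Ioi i, (Real.exp (4 * l k * t) - Real.exp (4 * l i * t))) = e7 at h ⊢
    field_simp
    linear_combination h
  have l1 : Tendsto (fun t : ℝ => (∏ j : Fin n, Real.exp (t * (2 * (j:ℕ) + 1) * (N + n - 1))) *
      ((∏ i : Fin n, (Real.exp ((N + n - 1 - 2 * (i:ℕ)) * t) - Real.exp (-(N + n - 1 - 2 * (i:ℕ)) * t)) / t) *
      ∏ i : Fin n, ∏ k ∈ Ioi i,
        (((Real.exp (-2 * ((k:ℕ) - (i:ℕ)) * t) - Real.exp (2 * ((k:ℕ) - (i:ℕ)) * t)) / t) *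
        ((Real.exp (2 * (N + n - 1 - (i:ℕ) - (k:ℕ)) * t)
          - Real.exp (-2 * (N + n - 1 - (i:ℕ) - (k:ℕ)) * t)) / t)))) (𝓝[>] 0)
      (𝓝 ((∏ j : Fin n, 1) * ((∏ i : Fin n, (((N:ℝ) + n - 1 - 2 * (i:ℕ)) - (-((N:ℝ) + n - 1 - 2 * (i:ℕ))))) *
        ∏ i : Fin n, ∏ k ∈ Ioi i, ((-2 * (((k:ℕ):ℝ) - (i:ℕ)) - 2 * (((k:ℕ):ℝ) - (i:ℕ))) *
          (2 * ((N:ℝ) + n - 1 - (i:ℕ) - (k:ℕ)) - (-2 * ((N:ℝ) + n - 1 - (i:ℕ) - (k:ℕ)))))))) := by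
    refine Tendsto.mul (tendsto_finsetProd _ fun j _ => lim_one' _ _) (Tendsto.mul
      (tendsto_finsetProd _ fun j _ => lim_exp _ _)
      (tendsto_finsetProd _ fun j _ => tendsto_finsetProd _ fun k _ => ?_))
    exact (lim_exp _ _).mul (lim_exp _ _)
  have l2 : Tendsto (fun t : ℝ => ((∏ i : Fin n, (Real.exp (2 * (2 * (i:ℕ) + 1) * t) - Real.exp (0 * t)) / t) *
    ∏ i : Fin n, ∏ k ∈ Ioi i, (Real.exp (4 * ((i:ℕ) + (k:ℕ) + 1) * t) - Real.exp (0 * t)) / t) *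
    ∑ l ∈ L n N, (∏ i : Fin n, Real.exp (2 * t * l i)) *
      ∏ i : Fin n, ∏ k ∈ Ioi i, (Real.exp (4 * l k * t) - Real.exp (4 * l i * t)) / t) (𝓝[>] 0)
      (𝓝 (((∏ i : Fin n, ((2 * (2 * ((i:ℕ):ℝ) + 1)) - 0)) *
      ∏ i : Fin n, ∏ k ∈ Ioi i, ((4 * (((i:ℕ):ℝ) + (k:ℕ) + 1)) - 0)) *
    ∑ l ∈ L n N, (∏ i : Fin n, 1) * ∏ i : Fin n, ∏ k ∈ Ioi i, (4 * (l k : ℝ) - 4 * l i))) := by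
    refine Tendsto.mul (Tendsto.mul
      (tendsto_finsetProd _ fun j _ => lim_exp _ _)
      (tendsto_finsetProd _ fun j _ => tendsto_finsetProd _ fun k _ => lim_exp _ _))
      (tendsto_finsetSum _ fun l _ => Tendsto.mul (tendsto_finsetProd _ fun j _ => lim_one _ _)
      (tendsto_finsetProd _ fun j _ => tendsto_finsetProd _ fun k _ => lim_exp _ _))
  have l3 := tendsto_nhds_unique (l1.congr' (by
    filter_upwards [self_mem_nhdsWithin] with t ht using key t ht)) l2
  simp only [Finset.prod_const_one, one_mul, sub_zero] at l3
  rw [← l3]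
  congr 1
  · refine Finset.prod_congr rfl (fun i _ => by ring)
  · refine Finset.prod_congr rfl (fun i _ => Finset.prod_congr rfl (fun k _ => by ring))

/-- number of patterns -/
lemma sum_c (n N : ℕ) : ∑ l ∈ L n N, c n l =
    (∏ i : Fin n, (((N:ℝ) + n - 1 - 2 * (i:ℕ)) / (2 * ((i:ℕ):ℝ) + 1))) *
      ∏ i : Fin n, ∏ k ∈ Ioi i, (((N:ℝ) + n - 1 - (i:ℕ) - (k:ℕ)) / (((i:ℕ):ℝ) + (k:ℕ) + 1)) := by
  have h := limit_identity n N
  have e : ∀ l : Fin n → ℕ, ∏ i : Fin n, ∏ k ∈ Ioi i, (4 * (l k : ℝ) - 4 * l i) =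
      (∏ i : Fin n, ∏ k ∈ Ioi i, (-4 : ℝ)) *
        ((∏ i : Fin n, ∏ k ∈ Ioi i, ((k : ℝ) - (i : ℝ))) * c n l) := by
    intro l
    rw [c_eq]
    simp only [← Finset.prod_mul_distrib]
    refine Finset.prod_congr rfl (fun i _ => Finset.prod_congr rfl (fun k _ => by ring))
  rw [Finset.sum_congr rfl (fun l _ => e l), ← Finset.mul_sum, ← Finset.mul_sum] at h
  simp only [Finset.prod_mul_distrib] at h
  simp only [Finset.prod_div_distrib]
  have p1 : ∏ i : Fin n, (2 * ((i:ℕ):ℝ) + 1) ≠ 0 :=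
    Finset.prod_ne_zero_iff.mpr fun _ _ => by positivity
  have p2 : ∏ i : Fin n, ∏ k ∈ Ioi i, (((i:ℕ):ℝ) + (k:ℕ) + 1) ≠ 0 :=
    Finset.prod_ne_zero_iff.mpr fun _ _ => Finset.prod_ne_zero_iff.mpr fun _ _ => by positivity
  have p3 : ∏ i : Fin n, ∏ k ∈ Ioi i, ((k : ℝ) - (i : ℝ)) ≠ 0 :=
    Finset.prod_ne_zero_iff.mpr fun i _ => Finset.prod_ne_zero_iff.mpr fun k hk => by
      have : (i:ℕ) < k := Fin.lt_def.mp (Finset.mem_Ioi.mp hk)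
      have : ((i:ℕ):ℝ) < (k:ℕ) := by exact_mod_cast this
      exact (sub_pos.mpr this).ne'
  have p4 : ∏ i : Fin n, ∏ k ∈ Ioi i, (4 : ℝ) ≠ 0 :=
    Finset.prod_ne_zero_iff.mpr fun _ _ => Finset.prod_ne_zero_iff.mpr fun _ _ => by norm_num
  have p5 : ∏ i : Fin n, ∏ k ∈ Ioi i, (-4 : ℝ) ≠ 0 :=
    Finset.prod_ne_zero_iff.mpr fun _ _ => Finset.prod_ne_zero_iff.mpr fun _ _ => by norm_num
  have p6 : ∏ i : Fin n, (2 : ℝ) ≠ 0 :=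
    Finset.prod_ne_zero_iff.mpr fun _ _ => by norm_num
  generalize ∏ i : Fin n, (2 * ((i:ℕ):ℝ) + 1) = q1 at *
  generalize ∏ i : Fin n, ∏ k ∈ Ioi i, (((i:ℕ):ℝ) + (k:ℕ) + 1) = q2 at *
  generalize ∏ i : Fin n, ∏ k ∈ Ioi i, ((k : ℝ) - (i : ℝ)) = q3 at *
  generalize ∏ i : Fin n, ∏ k ∈ Ioi i, (4 : ℝ) = q4 at *
  generalize ∏ i : Fin n, ∏ k ∈ Ioi i, (-4 : ℝ) = q5 at *
  generalize ∏ i : Fin n, (2 : ℝ) = q6 at *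
  rw [← mul_div_mul_comm, eq_div_iff (mul_ne_zero p1 p2)]
  have hne : q6 * q5 * q3 * q4 ≠ 0 := by positivity
  apply mul_left_cancel₀ hne
  linear_combination -h

/-- pairs `i ≤ k` -/
lemma pairs_range (n : ℕ) (f : ℕ → ℕ → ℝ) :
    (∏ i : Fin n, f i i) * ∏ i : Fin n, ∏ k ∈ Ioi i, f i k =
      ∏ i ∈ range n, ∏ k ∈ Ico i n, f i k := by
  rw [← Finset.prod_mul_distrib, ← Fin.prod_univ_eq_prod_range (fun i => ∏ k ∈ Ico i n, f i k)]
  refine Finset.prod_congr rfl (fun i _ => ?_)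
  rw [Finset.prod_eq_prod_Ico_succ_bot i.2]
  congr 1
  refine Finset.prod_bij (fun k _ => (k : ℕ)) ?_ ?_ ?_ ?_
  · intro k hk
    have : (i:ℕ) < k := Fin.lt_def.mp (Finset.mem_Ioi.mp hk)
    rw [Finset.mem_Ico]; omega
  · intro a _ b _ h; exact Fin.ext h
  · intro b hb
    rw [Finset.mem_Ico] at hb
    exact ⟨⟨b, hb.2⟩, Finset.mem_Ioi.mpr (Fin.lt_def.mpr (by simpa using hb.1)), rfl⟩
  · intro _ _; rfl

lemma prod_Ico_num (n i : ℕ) : ∀ m, i ≤ m → (∏ k ∈ Ico i m, ((n:ℝ) + 1 + i + k)) *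
    (Nat.factorial (2 * i + n)) = Nat.factorial (i + n + m) := by
  intro m hm
  induction m, hm using Nat.le_induction with
  | base => simp; congr 1; omega
  | succ m hm ih =>
    rw [Finset.prod_Ico_succ_top hm, mul_right_comm, ih, ← add_assoc, Nat.factorial_succ]
    push_cast; ring

lemma num_rev (n : ℕ) : ∏ i ∈ range n, ∏ k ∈ Ico i n, (((2 * n : ℕ):ℝ) + n - 1 - i - k) =
    ∏ i ∈ range n, ∏ k ∈ Ico i n, ((n:ℝ) + 1 + i + k) := by
  rw [Finset.prod_sigma', Finset.prod_sigma']
  refine Finset.prod_bij' (fun p _ => ⟨n - 1 - p.2, n - 1 - p.1⟩) (fun p _ => ⟨n - 1 - p.2, n - 1 - p.1⟩)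
    ?_ ?_ ?_ ?_ ?_
  · rintro ⟨i, k⟩ h
    simp only [Finset.mem_sigma, Finset.mem_range, Finset.mem_Ico] at h ⊢
    omega
  · rintro ⟨i, k⟩ h
    simp only [Finset.mem_sigma, Finset.mem_range, Finset.mem_Ico] at h ⊢
    omega
  · rintro ⟨i, k⟩ h
    simp only [Finset.mem_sigma, Finset.mem_range, Finset.mem_Ico] at h ⊢
    congr 1 <;> omega
  · rintro ⟨i, k⟩ h
    simp only [Finset.mem_sigma, Finset.mem_range, Finset.mem_Ico] at h ⊢
    congr 1 <;> omega
  · rintro ⟨i, k⟩ h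
    simp only [Finset.mem_sigma, Finset.mem_range, Finset.mem_Ico] at h ⊢
    have e1 : ((n - 1 - k : ℕ) : ℝ) = n - 1 - k := by
      rw [Nat.sub_sub, Nat.cast_sub (by omega)]; push_cast; ring
    have e2 : ((n - 1 - i : ℕ) : ℝ) = n - 1 - i := by
      rw [Nat.sub_sub, Nat.cast_sub (by omega)]; push_cast; ring
    rw [e1, e2]; push_cast; ring

lemma final (n : ℕ) : ∑ l ∈ L n (2 * n), c n l = ∏ i ∈ Finset.range n,
        (Nat.factorial (2 * i) * Nat.factorial (i + 2 * n) : ℝ) /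
          (Nat.factorial (2 * i + n) * Nat.factorial (i + n) : ℝ) := by
  rw [sum_c]
  have h1 := pairs_range n (fun i k => (((2 * n : ℕ):ℝ) + n - 1 - i - k) / ((i:ℝ) + k + 1))
  have h2 : (∏ i : Fin n, ((((2 * n : ℕ):ℝ) + n - 1 - 2 * (i:ℕ)) / (2 * ((i:ℕ):ℝ) + 1))) =
      ∏ i : Fin n, ((((2 * n : ℕ):ℝ) + n - 1 - (i:ℕ) - (i:ℕ)) / (((i:ℕ):ℝ) + (i:ℕ) + 1)) := by
    refine Finset.prod_congr rfl (fun i _ => ?_)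
    congr 1 <;> ring
  rw [h2, h1]
  simp only [Finset.prod_div_distrib]
  rw [num_rev]
  simp only [← Finset.prod_div_distrib]
  refine Finset.prod_congr rfl (fun i hi => ?_)
  have hi' : i ≤ n := (Finset.mem_range.mp hi).le
  rw [Finset.prod_div_distrib]
  have a1 := prod_Ico_num n i n hi'
  have a2 := prod_Ico_num 0 i n hi'
  have e : ∏ k ∈ Ico i n, (((0:ℕ):ℝ) + 1 + i + k) = ∏ k ∈ Ico i n, ((i:ℝ) + k + 1) :=
    Finset.prod_congr rfl (fun k _ => by push_cast; ring)
  rw [e] at a2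
  have hpos : ∏ k ∈ Ico i n, ((i:ℝ) + k + 1) ≠ 0 :=
    Finset.prod_ne_zero_iff.mpr fun _ _ => by positivity
  rw [show i + 2 * n = i + n + n by ring, ← a1]
  simp only [add_zero] at a2
  rw [← a2]
  have f1 : (Nat.factorial (2 * i + n) : ℝ) ≠ 0 := by positivity
  have f2 : (Nat.factorial (2 * i) : ℝ) ≠ 0 := by positivity
  field_simp

end SPP

/-- (Andrews) The number of symmetric plane partitions in the `n`-cube, i.e. the number of lower
sets `S` of `Fin n × Fin n × Fin n` under the componentwise order with
`(i,j,k) ∈ S ↔ (j,i,k) ∈ S`, equals `∏_{i=0}^{n-1} (2i)!·(i+2n)!/((2i+n)!·(i+n)!)`. -/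
theorem card_symmetric_planePartitions (n : ℕ) :
    (Nat.card {S : Set (Fin n × Fin n × Fin n) // IsLowerSet S ∧
        ∀ i j k : Fin n, (i, j, k) ∈ S ↔ (j, i, k) ∈ S} : ℚ) =
      ∏ i ∈ Finset.range n,
        (Nat.factorial (2 * i) * Nat.factorial (i + 2 * n) : ℚ) /
          (Nat.factorial (2 * i + n) * Nat.factorial (i + n) : ℚ) := by
  have h := (SPP.card_B n).trans (SPP.final n)
  rw [← SPP.card_spp] at h
  apply Rat.cast_injective (α := ℝ)
  push_cast
  exact h
end

section
/- (Andrews) The number of cyclically symmetric plane partitions in the n-cube, i.e. the number of lower sets S of Fin n × Fin n × Fin n under the componentwise order satisfying (i,j,k) ∈ S ↔ (j,k,i) ∈ S, equals ∏_{i=0}^{n-1} (3i+2)·(3i)!·(i+2n)! / ((2i+n)!·(2i+n+1)!). -/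
namespace CSPP
open Finset Matrix

/-- strictly decreasing tuples -/
abbrev XX (n d : ℕ) := {f : Fin d → Fin n // StrictAnti f}

lemma perm_eq_one_of_strictMono {d : ℕ} (σ : Equiv.Perm (Fin d)) (h : StrictMono σ) : σ = 1 := by
  have := Subsingleton.elim (h.orderIsoOfSurjective σ σ.surjective) (OrderIso.refl _)
  ext i
  have h2 := congrArg (fun e : Fin d ≃o Fin d => e i) this
  simpa using congrArg Fin.val h2

lemma exists_sort {n d : ℕ} (g : Fin d → Fin n) (hg : Function.Injective g) :
    ∃ (f : XX n d) (σ : Equiv.Perm (Fin d)), f.1 ∘ σ = g := by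
  let g' : Fin d → (Fin n)ᵒᵈ := fun i => OrderDual.toDual (g i)
  have hm := Tuple.monotone_sort g'
  refine ⟨⟨g ∘ Tuple.sort g', ?_⟩, (Tuple.sort g').symm, ?_⟩
  · have ha : Antitone (g ∘ Tuple.sort g') := fun a b hab => hm hab
    exact ha.strictAnti_of_injective (hg.comp (Equiv.injective _))
  · ext i; simp

lemma sort_inj {n d : ℕ} (f f' : XX n d) (σ σ' : Equiv.Perm (Fin d))
    (h : f.1 ∘ σ = f'.1 ∘ σ') : f = f' ∧ σ = σ' := by
  have h1 : f.1 = f'.1 ∘ (σ' * σ⁻¹ : Equiv.Perm (Fin d)) := by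
    ext i
    have := congrFun h (σ⁻¹ i)
    simp at this
    simp [this]
  have h2 : σ' * σ⁻¹ = 1 := by
    apply perm_eq_one_of_strictMono
    intro a b hab
    have := f.2 hab
    rw [h1] at this
    exact f'.2.lt_iff_gt.1 this
  refine ⟨?_, ?_⟩
  · apply Subtype.ext
    rw [h1, h2]; rfl
  · exact (mul_inv_eq_one.1 h2).symm

theorem cauchyBinet {n d : ℕ} (A : Matrix (Fin d) (Fin n) ℚ) (B : Matrix (Fin n) (Fin d) ℚ) :
    (A * B).det = ∑ f : XX n d, (A.submatrix id f.1).det * (B.submatrix f.1 id).det := by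
  have h1 : (A * B).det = ∑ g : Fin d → Fin n, (∏ i, A i (g i)) * (B.submatrix g id).det := by
    have : A * B = fun i => ∑ j, A i j • B j := by
      ext i k; simp [Matrix.mul_apply]
    rw [this]
    have := (detRowAlternating (R := ℚ) (n := Fin d)).toMultilinearMap.map_sum
      (fun i (j : Fin n) => A i j • B j)
    refine this.trans ?_
    refine Finset.sum_congr rfl fun g _ => ?_
    have := (detRowAlternating (R := ℚ) (n := Fin d)).toMultilinearMap.map_smul_univ
      (fun i => A i (g i)) (fun i => B (g i))
    refine this.trans ?_
    rfl
  rw [h1]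
  have h2 : ∀ f : XX n d, (A.submatrix id f.1).det * (B.submatrix f.1 id).det =
      ∑ σ : Equiv.Perm (Fin d), (∏ i, A i (f.1 (σ i))) * (B.submatrix (f.1 ∘ σ) id).det := by
    intro f
    have hA : (A.submatrix id f.1).det =
        ∑ σ : Equiv.Perm (Fin d), ((Equiv.Perm.sign σ : ℤ) : ℚ) * ∏ i, A i (f.1 (σ i)) := by
      rw [← det_transpose, det_apply']
      rfl
    rw [hA, Finset.sum_mul]
    refine Finset.sum_congr rfl fun σ _ => ?_
    have : B.submatrix (f.1 ∘ σ) id = (B.submatrix f.1 id).submatrix σ id := rfl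
    rw [this, det_permute]
    ring
  simp_rw [h2]
  rw [← Finset.sum_product']
  symm
  apply Finset.sum_of_injOn (fun p : XX n d × Equiv.Perm (Fin d) => p.1.1 ∘ p.2)
  · rintro ⟨f, σ⟩ _ ⟨f', σ'⟩ _ h
    obtain ⟨h1, h2⟩ := sort_inj f f' σ σ' h
    simp [h1, h2]
  · intro _ _; simp
  · intro g _ hg
    have hinj : ¬ Function.Injective g := by
      intro hi
      obtain ⟨f, σ, h⟩ := exists_sort g hi
      exact hg ⟨(f, σ), by simp, h⟩
    simp only [Function.Injective, not_forall] at hinj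
    obtain ⟨a, b, hab, hne⟩ := hinj
    rw [det_zero_of_row_eq hne, mul_zero]
    ext k; simp [hab]
  · rintro ⟨f, σ⟩ _
    rfl

lemma det_one_add_eq_sum_minors {n : ℕ} (M : Matrix (Fin n) (Fin n) ℚ) :
    (1 + M).det = ∑ d ∈ range (n+1), ∑ f : XX n d, (M.submatrix f.1 f.1).det := by
  have h1 : (1 + M).det = ∑ s : Finset (Fin n),
      (M.submatrix (Subtype.val : s → Fin n) (Subtype.val : s → Fin n)).det := by
    rw [add_comm]
    have := (detRowAlternating (R := ℚ) (n := Fin n)).toMultilinearMap.map_add_univ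
      (fun i => M i) (fun i => (1 : Matrix (Fin n) (Fin n) ℚ) i)
    refine this.trans ?_
    exact Finset.sum_congr rfl fun s _ => det_piecewise_one_eq_submatrix_det M s
  rw [h1, ← Finset.sum_fiberwise_of_maps_to (s := univ) (t := range (n+1)) (g := Finset.card)
    (fun s _ => by
      have := Finset.card_le_univ s
      simp at this ⊢; omega)]
  refine Finset.sum_congr rfl fun d _ => ?_
  symm
  refine Finset.sum_bij (fun f _ => univ.image f.1) ?_ ?_ ?_ ?_
  · intro f _
    simp [Finset.card_image_of_injective _ f.2.injective]
  · intro f _ f' _ h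
    have hr : Set.range f.1 = Set.range f'.1 := by
      have := congrArg (fun s : Finset (Fin n) => (s : Set (Fin n))) h
      simpa using this
    apply Subtype.ext
    have hs1 : StrictMono (fun i => OrderDual.toDual (f.1 i)) := fun a b h => f.2 h
    have hs2 : StrictMono (fun i => OrderDual.toDual (f'.1 i)) := fun a b h => f'.2 h
    have := (StrictMono.range_inj hs1 hs2).1 hr
    exact this
  · intro s hs
    simp at hs
    obtain ⟨f, σ, h⟩ := exists_sort (s.orderEmbOfFin hs) (s.orderEmbOfFin hs).injective
    refine ⟨f, mem_univ _, ?_⟩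
    ext x
    have hx : x ∈ s ↔ x ∈ Set.range (s.orderEmbOfFin hs) := by
      rw [Finset.range_orderEmbOfFin]; rfl
    rw [hx, ← h]
    simp
  · intro f _
    let e : Fin d ≃ (univ.image f.1) :=
      (Equiv.ofInjective f.1 f.2.injective).trans (Equiv.setCongr (by simp))
    rw [← det_submatrix_equiv_self e]
    rfl

/-- LGV-type lemma for noncrossing 0/1 matrices -/
lemma det_noncrossing {n d : ℕ} (ρ : Fin n → Fin n → Prop) [∀ a b, Decidable (ρ a b)]
    (hρ : ∀ a b a' b', a < b → ρ a a' → ρ b b' → a' ≤ b') (f g : XX n d) :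
    ((Matrix.of fun a b => if ρ a b then (1 : ℚ) else 0).submatrix f.1 g.1).det =
      if ∀ t, ρ (f.1 t) (g.1 t) then 1 else 0 := by
  rw [det_apply', Finset.sum_eq_single 1]
  · simp only [Equiv.Perm.sign_one, Equiv.Perm.coe_one, id, submatrix_apply, of_apply]
    rw [Finset.prod_ite_zero]
    simp
  · intro σ _ hσ
    have : ∏ i, ((Matrix.of fun a b => if ρ a b then (1 : ℚ) else 0).submatrix f.1 g.1) (σ i) i = 0 := by
      by_contra hne
      rw [← ne_eq, Finset.prod_ne_zero_iff] at hne
      have hall : ∀ i, ρ (f.1 (σ i)) (g.1 i) := by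
        intro i
        have := hne i (mem_univ _)
        simp at this
        exact this
      apply hσ
      apply perm_eq_one_of_strictMono
      intro a b hab
      by_contra hlt
      have hlt' : σ b < σ a := by
        rcases lt_or_eq_of_le (not_lt.1 hlt) with h | h
        · exact h
        · exact absurd (σ.injective h) (ne_of_gt hab)
      have := hρ _ _ _ _ (f.2 hlt') (hall a) (hall b)
      have h3 := g.2 hab
      exact absurd this (not_le.2 h3)
    rw [this, mul_zero]
  · simp
end CSPP

namespace CSPP
open Finset Matrix

/-- one step of the paths -/
def Rel {n : ℕ} (c : ℕ) (z z' : Fin n) : Prop := z' = z ∨ (z'.val + 1 = z.val ∧ c ≤ z.val)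

instance {n : ℕ} (c : ℕ) (z z' : Fin n) : Decidable (Rel c z z') := by unfold Rel; infer_instance

lemma Rel_noncross {n : ℕ} (c : ℕ) : ∀ a b a' b' : Fin n, a < b → Rel c a a' → Rel c b b' → a' ≤ b' := by
  intro a b a' b' h h1 h2
  simp only [Rel, Fin.ext_iff, Fin.lt_def, Fin.le_def] at *
  omega

/-- transfer matrix -/
def Fm (n c : ℕ) : Matrix (Fin n) (Fin n) ℚ := Matrix.of fun a b => if Rel c a b then (1 : ℚ) else 0

/-- product of transfer matrices -/
def Lp (n : ℕ) : ℕ → Matrix (Fin n) (Fin n) ℚ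
  | 0 => 1
  | m + 1 => Fm n (m + 1) * Lp n m

lemma Lp_apply (n m : ℕ) (z j : Fin n) :
    Lp n m z j = if j.val ≤ z.val then ((min z.val m).choose (z.val - j.val) : ℚ) else 0 := by
  induction m generalizing z with
  | zero =>
    simp only [Lp, Matrix.one_apply, Fin.ext_iff]
    rcases lt_trichotomy z.val j.val with h | h | h
    · rw [if_neg (by omega), if_neg (by omega)]
    · simp [h]
    · rw [if_neg (by omega), if_pos (by omega), Nat.choose_eq_zero_of_lt (by simp; omega)]
      simp
  | succ m ih =>
    simp only [Lp, Matrix.mul_apply, Fm, Matrix.of_apply]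
    by_cases hz : m + 1 ≤ z.val
    · have hz' : z.val - 1 < n := by omega
      have : ∀ x : Fin n, (if Rel (m+1) z x then (1:ℚ) else 0) * Lp n m x j =
          (if x = z then Lp n m z j else 0) + (if x = ⟨z.val - 1, hz'⟩ then Lp n m ⟨z.val - 1, hz'⟩ j else 0) := by
        intro x
        by_cases h1 : x = z
        · subst h1
          rw [if_pos (by simp [Rel]), if_pos rfl, if_neg (by simp only [Fin.ext_iff]; omega)]; ring
        · by_cases h2 : x = ⟨z.val - 1, hz'⟩
          · rw [if_pos (by right; simp only [h2]; omega), if_neg h1, if_pos h2, h2]; ring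
          · rw [if_neg (by simp only [Rel, Fin.ext_iff] at *; omega), if_neg h1, if_neg h2]; ring
      simp_rw [this]
      rw [Finset.sum_add_distrib]
      simp only [Finset.sum_ite_eq', Finset.mem_univ, if_true]
      rw [ih, ih]
      simp only
      rw [min_eq_right (by omega), min_eq_right (by omega), min_eq_right hz]
      by_cases hj : j.val ≤ z.val
      · rw [if_pos hj, if_pos hj]
        by_cases hj' : j.val ≤ z.val - 1
        · rw [if_pos hj']
          obtain ⟨r, hr⟩ : ∃ r, z.val - j.val = r + 1 := ⟨z.val - j.val - 1, by omega⟩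
          rw [hr, show z.val - 1 - j.val = r by omega, Nat.choose_succ_succ]
          push_cast; ring
        · rw [if_neg hj', show z.val - j.val = 0 by omega]; simp
      · rw [if_neg hj, if_neg hj, if_neg (by omega)]; ring
    · have : ∀ x : Fin n, (if Rel (m+1) z x then (1:ℚ) else 0) * Lp n m x j =
          (if x = z then Lp n m z j else 0) := by
        intro x
        by_cases h1 : x = z
        · subst h1; simp [Rel]
        · rw [if_neg (by simp only [Rel, Fin.ext_iff] at *; omega), if_neg h1]; ring
      simp_rw [this]
      simp only [Finset.sum_ite_eq', Finset.mem_univ, if_true]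
      rw [ih, min_eq_left (by omega), min_eq_left (by omega)]

lemma Lp_self (n : ℕ) (z j : Fin n) : Lp n n z j = (z.val.choose j.val : ℚ) := by
  rw [Lp_apply, min_eq_left (by omega)]
  split_ifs with h
  · rw [Nat.choose_symm h]
  · rw [Nat.choose_eq_zero_of_lt (by omega)]; simp

/-- chains of tuples (all the steps, with no boundary conditions) -/
abbrev IsChain (n d m : ℕ) (z : Fin (m+1) → XX n d) : Prop :=
  ∀ c : Fin m, ∀ t, Rel (c.val + 1) ((z c.succ).1 t) ((z c.castSucc).1 t)

/-- chains with boundary conditions -/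
abbrev Chain (n d m : ℕ) (f g : XX n d) :=
  {z : Fin (m+1) → XX n d // IsChain n d m z ∧ z (Fin.last m) = f ∧ z 0 = g}

lemma sigma_chain_ext {n d m : ℕ} {f g : XX n d}
    (p q : Σ h : {h : XX n d // ∀ t, Rel (m+1) (f.1 t) (h.1 t)}, Chain n d m h.1 g)
    (e : p.2.1 = q.2.1) : p = q := by
  obtain ⟨⟨h, hh⟩, ⟨z, hz, hl, h0⟩⟩ := p
  obtain ⟨⟨h', hh'⟩, ⟨z', hz', hl', h0'⟩⟩ := q
  simp only at e hl hl'
  subst e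
  subst hl
  subst hl'
  rfl

/-- splitting off the last step -/
def chainEquiv (n d m : ℕ) (f g : XX n d) : Chain n d (m+1) f g ≃
    Σ h : {h : XX n d // ∀ t, Rel (m+1) (f.1 t) (h.1 t)}, Chain n d m h.1 g where
  toFun z := ⟨⟨z.1 (Fin.last m).castSucc, fun t => by
      have := z.2.1 (Fin.last m) t
      rw [Fin.succ_last, z.2.2.1] at this
      exact this⟩, ⟨fun c => z.1 c.castSucc, fun c t => z.2.1 c.castSucc t, rfl, z.2.2.2⟩⟩
  invFun p := ⟨Fin.snoc (α := fun _ => XX n d) p.2.1 f, by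
    refine ⟨fun c => ?_, by simp, ?_⟩
    · refine Fin.lastCases ?_ (fun c => ?_) c
      · intro t
        rw [Fin.succ_last, Fin.snoc_last, Fin.snoc_castSucc, p.2.2.2.1]
        exact p.1.2 t
      · intro t
        rw [Fin.snoc_castSucc, Fin.succ_castSucc, Fin.snoc_castSucc]
        exact p.2.2.1 c t
    · have : (0 : Fin (m+1+1)) = (0 : Fin (m+1)).castSucc := rfl
      rw [this, Fin.snoc_castSucc, p.2.2.2.2]⟩
  left_inv z := by
    apply Subtype.ext
    funext c
    refine Fin.lastCases ?_ (fun c => ?_) c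
    · simp [z.2.2.1]
    · simp
  right_inv p := by
    apply sigma_chain_ext
    funext c
    simp

lemma card_chain (n d m : ℕ) (f g : XX n d) :
    (Nat.card (Chain n d m f g) : ℚ) = ((Lp n m).submatrix f.1 g.1).det := by
  induction m generalizing f with
  | zero =>
    have h1 : (Lp n 0) = (Matrix.of fun a b : Fin n => if Rel n a b then (1 : ℚ) else 0) := by
      ext a b
      simp only [Lp, Matrix.one_apply, Rel, Matrix.of_apply, Fin.ext_iff]
      congr 1
      apply propext
      omega
    rw [h1, det_noncrossing _ (Rel_noncross n)]
    by_cases hfg : f = g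
    · rw [if_pos (by intro t; left; rw [hfg])]
      have : Unique (Chain n d 0 f g) :=
        { default := ⟨fun _ => f, fun c => c.elim0, rfl, hfg⟩
          uniq := by
            intro z
            apply Subtype.ext
            funext c
            have hc : c = Fin.last 0 := by ext; simp
            rw [hc]; exact z.2.2.1 }
      simp
    · rw [if_neg]
      · have : IsEmpty (Chain n d 0 f g) := by
          constructor
          intro z
          apply hfg
          exact z.2.2.1.symm.trans z.2.2.2
        simp
      · intro h
        apply hfg
        apply Subtype.ext
        funext t
        have := h t
        simp only [Rel] at this
        rcases this with h | h
        · exact h.symm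
        · omega
  | succ m ih =>
    rw [Nat.card_congr (chainEquiv n d m f g), Nat.card_sigma]
    push_cast
    simp_rw [ih]
    have : (Lp n (m+1)).submatrix f.1 g.1 = (Fm n (m+1)).submatrix f.1 id * (Lp n m).submatrix id g.1 := by
      ext a b; simp [Lp, Matrix.mul_apply]
    rw [this, cauchyBinet]
    have h2 : ∀ h : XX n d, (((Fm n (m+1)).submatrix f.1 id).submatrix id h.1).det =
        if ∀ t, Rel (m+1) (f.1 t) (h.1 t) then 1 else 0 := by
      intro h
      exact det_noncrossing _ (Rel_noncross (m+1)) f h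
    simp_rw [h2, ite_mul, one_mul, zero_mul]
    rw [← Finset.sum_filter]
    symm
    rw [Finset.sum_subtype _ (p := fun h : XX n d => ∀ t, Rel (m+1) (f.1 t) (h.1 t)) (by simp)]
    rfl

lemma sum_card_sq (n : ℕ) :
    (∑ d ∈ range (n+1), ∑ f : XX n d, ∑ g : XX n d, (Nat.card (Chain n d n f g) : ℚ)^2) =
      (1 + Lp n n * (Lp n n)ᵀ).det := by
  rw [det_one_add_eq_sum_minors]
  refine Finset.sum_congr rfl fun d _ => Finset.sum_congr rfl fun f _ => ?_
  have : (Lp n n * (Lp n n)ᵀ).submatrix f.1 f.1 =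
      (Lp n n).submatrix f.1 id * ((Lp n n).submatrix f.1 id)ᵀ := by
    ext a b; simp [Matrix.mul_apply]
  rw [this, cauchyBinet]
  refine Finset.sum_congr rfl fun g _ => ?_
  rw [card_chain, sq, ← det_transpose (Matrix.submatrix _ g.1 id)]
  rfl

end CSPP

namespace CSPP
open Finset Matrix

/-- lower sets of the poset `t ≤ j ≤ i < n` -/
def IsU (n : ℕ) (U : ℕ → ℕ → ℕ → Prop) : Prop :=
  (∀ i j t, U i j t → t ≤ j ∧ j ≤ i ∧ i < n) ∧
  (∀ i j t a b c, U i j t → a ≤ i → b ≤ j → c ≤ t → c ≤ b → b ≤ a → U a b c)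

/-- numerical chains -/
structure Good (n d : ℕ) (Z : ℕ → ℕ → ℕ) : Prop where
  step : ∀ c t, c < n → t < d → Z c t = Z (c+1) t ∨ (Z c t + 1 = Z (c+1) t ∧ c + 1 ≤ Z (c+1) t)
  anti : ∀ c t t', c ≤ n → t < t' → t' < d → Z c t' < Z c t
  bound : ∀ c t, c ≤ n → t < d → Z c t < n

/-- the lower set of a chain -/
def UZ (n d : ℕ) (Z : ℕ → ℕ → ℕ) (i j t : ℕ) : Prop :=
  t < d ∧ t ≤ j ∧ j ≤ i ∧ i < n ∧ i - t ≤ Z (i - j) t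

variable {n d : ℕ} {Z : ℕ → ℕ → ℕ}

lemma Good.mono (h : Good n d Z) (c k t : ℕ) (hc : c + k ≤ n) (ht : t < d) :
    Z c t ≤ Z (c + k) t ∧ Z (c + k) t ≤ Z c t + k := by
  induction k with
  | zero => simp
  | succ k ih =>
    have := ih (by omega)
    have := h.step (c + k) t (by omega) ht
    rw [← add_assoc]
    omega

lemma Good.freeze (h : Good n d Z) (u c k t : ℕ) (hc : c + k ≤ n) (ht : t < d) (hu : u ≤ c)
    (h2 : u ≤ Z (c + k) t) : u ≤ Z c t := by
  induction k with
  | zero => simpa using h2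
  | succ k ih =>
    have := h.step (c + k) t (by omega) ht
    rw [← add_assoc] at h2
    apply ih (by omega)
    omega

lemma Good.anti' (h : Good n d Z) (c t k : ℕ) (hc : c ≤ n) (ht : t + k < d) :
    Z c (t + k) + k ≤ Z c t := by
  induction k with
  | zero => simp
  | succ k ih =>
    have := ih (by omega)
    have := h.anti c (t + k) (t + k + 1) hc (by omega) (by omega)
    rw [show t + (k+1) = t + k + 1 by omega]
    omega

lemma Good.isU (h : Good n d Z) : IsU n (UZ n d Z) := by
  refine ⟨fun i j t hU => ⟨hU.2.1, hU.2.2.1, hU.2.2.2.1⟩, ?_⟩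
  rintro i j t i' j' t' ⟨h1, h2, h3, h4, h5⟩ hi hj ht ht' hj'
  refine ⟨by omega, ht', hj', by omega, ?_⟩
  have a1 := h.anti' (i - j) t' (t - t') (by omega) (by omega)
  rw [show t' + (t - t') = t by omega] at a1
  rcases le_total (i - j) (i' - j') with hc | hc
  · have := h.mono (i - j) (i' - j' - (i - j)) t' (by omega) (by omega)
    rw [show i - j + (i' - j' - (i - j)) = i' - j' by omega] at this
    omega
  · have := h.mono (i' - j') (i - j - (i' - j')) t' (by omega) (by omega)
    rw [show i' - j' + (i - j - (i' - j')) = i - j by omega] at this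
    omega

lemma Good.le_iff (h : Good n d Z) (c t u : ℕ) (hc : c ≤ n) (ht : t < d) :
    u ≤ Z c t ↔ UZ n d Z (t + u) (t + (u - c)) t := by
  have hb := h.anti' c 0 t hc (by omega)
  have hb0 := h.bound c 0 hc (by omega)
  rw [zero_add] at hb
  simp only [UZ]
  rcases le_total c u with hcu | hcu
  · rw [show t + u - (t + (u - c)) = c by omega]
    constructor
    · intro hu
      omega
    · rintro ⟨-, -, -, -, h5⟩
      omega
  · rw [show t + u - (t + (u - c)) = u by omega]
    constructor
    · intro hu
      have := h.freeze u u (c - u) t (by omega) ht le_rfl (by rwa [show u + (c - u) = c by omega])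
      omega
    · rintro ⟨-, -, -, -, h5⟩
      have := h.mono u (c - u) t (by omega) ht
      rw [show u + (c - u) = c by omega] at this
      omega

lemma UZ_diag (hd : d ≤ n) (t : ℕ) : UZ n d Z t t t ↔ t < d := by
  simp only [UZ]
  constructor
  · exact fun h => h.1
  · intro h
    refine ⟨h, le_rfl, le_rfl, by omega, by omega⟩

lemma exists_bound (p : ℕ → Prop) (n : ℕ) (hp : ∀ a b, a ≤ b → p b → p a) (hn : ¬ p n) :
    ∃ d ≤ n, ∀ u, p u ↔ u < d := by
  classical
  have hex : ∃ m, ¬ p m := ⟨n, hn⟩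
  refine ⟨Nat.find hex, Nat.find_min' hex hn, fun u => ?_⟩
  constructor
  · intro hu
    by_contra hlt
    exact Nat.find_spec hex (hp _ _ (not_lt.1 hlt) hu)
  · intro hu
    exact not_not.1 (Nat.find_min hex hu)

lemma exists_good (n : ℕ) (U : ℕ → ℕ → ℕ → Prop) (hU : IsU n U) :
    ∃ d ≤ n, ∃ Z, Good n d Z ∧ ∀ i j t, U i j t ↔ UZ n d Z i j t := by
  obtain ⟨d, hd, hd'⟩ := exists_bound (fun t => U t t t) n
    (fun a b hab h => hU.2 _ _ _ _ _ _ h hab hab hab le_rfl le_rfl)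
    (fun h => by have := (hU.1 _ _ _ h).2.2; omega)
  have key : ∀ c t, ∃ z, t < d → (z < n ∧ ∀ u, U (t + u) (t + (u - c)) t ↔ u ≤ z) := by
    intro c t
    by_cases ht : t < d
    · obtain ⟨e, he, he'⟩ := exists_bound (fun u => U (t + u) (t + (u - c)) t) n
        (fun a b hab h => hU.2 _ _ _ _ _ _ h (by omega) (by omega) (by omega) (by omega) (by omega))
        (fun h => by have := (hU.1 _ _ _ h).2.2; omega)
      have h0 : 0 < e := by
        rw [← he' 0]
        simpa using (hd' t).2 ht
      refine ⟨e - 1, fun _ => ⟨by omega, fun u => ?_⟩⟩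
      rw [he' u]; omega
    · exact ⟨0, fun h => absurd h ht⟩
  choose Z hZ using key
  refine ⟨d, hd, Z, ⟨?_, ?_, ?_⟩, ?_⟩
  · intro c t hc ht
    obtain ⟨-, h1⟩ := hZ c t ht
    obtain ⟨-, h2⟩ := hZ (c+1) t ht
    have a1 : Z c t ≤ Z (c+1) t := by
      rw [← h2]
      exact hU.2 _ _ _ _ _ _ ((h1 _).2 le_rfl) (by omega) (by omega) (by omega) (by omega) (by omega)
    have a2 : Z (c+1) t - 1 ≤ Z c t := by
      rw [← h1]
      exact hU.2 _ _ _ _ _ _ ((h2 _).2 le_rfl) (by omega) (by omega) (by omega) (by omega) (by omega)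
    have a3 : Z (c+1) t ≤ c → Z (c+1) t ≤ Z c t := by
      intro hle
      rw [← h1]
      exact hU.2 _ _ _ _ _ _ ((h2 _).2 le_rfl) (by omega) (by omega) (by omega) (by omega) (by omega)
    omega
  · intro c t t' hc ht ht'
    obtain ⟨-, h1⟩ := hZ c t (by omega)
    obtain ⟨-, h2⟩ := hZ c t' ht'
    rw [← Nat.succ_le_iff, ← h1]
    exact hU.2 _ _ _ _ _ _ ((h2 _).2 le_rfl) (by omega) (by omega) (by omega) (by omega) (by omega)
  · intro c t hc ht
    exact (hZ c t ht).1
  · intro i j t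
    constructor
    · intro h
      obtain ⟨h1, h2, h3⟩ := hU.1 _ _ _ h
      have ht : t < d := by
        rw [← hd']
        exact hU.2 _ _ _ _ _ _ h (by omega) (by omega) le_rfl le_rfl le_rfl
      refine ⟨ht, h1, h2, h3, ?_⟩
      rw [← (hZ (i - j) t ht).2, show t + (i - t) = i by omega,
        show t + (i - t - (i - j)) = j by omega]
      exact h
    · rintro ⟨ht, h1, h2, h3, h4⟩
      rw [← (hZ (i - j) t ht).2, show t + (i - t) = i by omega,
        show t + (i - t - (i - j)) = j by omega] at h4
      exact h4

/-- numerical version of a chain -/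
def toZ {n d : ℕ} (z : Fin (n+1) → XX n d) (c t : ℕ) : ℕ :=
  if h : c < n + 1 ∧ t < d then ((z ⟨c, h.1⟩).1 ⟨t, h.2⟩).val else 0

lemma toZ_eq {n d : ℕ} (z : Fin (n+1) → XX n d) (c : Fin (n+1)) (t : Fin d) :
    toZ z c t = ((z c).1 t).val := by
  rw [toZ, dif_pos ⟨c.2, t.2⟩]

lemma toZ_good {n d : ℕ} (z : Fin (n+1) → XX n d) (hz : IsChain n d n z) : Good n d (toZ z) := by
  refine ⟨?_, ?_, ?_⟩
  · intro c t hc ht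
    have := hz ⟨c, hc⟩ ⟨t, ht⟩
    simp only [Rel, Fin.ext_iff] at this
    have e1 := toZ_eq z (⟨c, hc⟩ : Fin n).castSucc ⟨t, ht⟩
    have e2 := toZ_eq z (⟨c, hc⟩ : Fin n).succ ⟨t, ht⟩
    rw [← e1, ← e2] at this
    exact this
  · intro c t t' hc ht ht'
    have e1 := toZ_eq z ⟨c, by omega⟩ ⟨t, by omega⟩
    have e2 := toZ_eq z ⟨c, by omega⟩ ⟨t', ht'⟩
    simp only at e1 e2
    rw [e1, e2]
    exact (z ⟨c, by omega⟩).2 (show (⟨t, by omega⟩ : Fin d) < ⟨t', ht'⟩ from ht)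
  · intro c t hc ht
    have e1 := toZ_eq z ⟨c, by omega⟩ ⟨t, by omega⟩
    simp only at e1
    rw [e1]
    exact Fin.is_lt _

/-- all chains -/
abbrev SigC (n : ℕ) := Σ d : Fin (n+1), {z : Fin (n+1) → XX n d.val // IsChain n d.val n z}

/-- the lower set of a chain -/
def toU (n : ℕ) (p : SigC n) : {U : ℕ → ℕ → ℕ → Prop // IsU n U} :=
  ⟨UZ n p.1.val (toZ p.2.1), (toZ_good p.2.1 p.2.2).isU⟩

lemma toU_injective (n : ℕ) : Function.Injective (toU n) := by
  rintro ⟨⟨d, hd⟩, ⟨z, hz⟩⟩ ⟨⟨d', hd'⟩, ⟨z', hz'⟩⟩ h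
  have h' : UZ n d (toZ z) = UZ n d' (toZ z') := congrArg Subtype.val h
  have hdd : d = d' := by
    have : ∀ t, t < d ↔ t < d' := fun t => by
      rw [← UZ_diag (Z := toZ z) (by omega : d ≤ n) t, ← UZ_diag (Z := toZ z') (by omega : d' ≤ n) t, h']
    have a := this d
    have b := this d'
    omega
  subst hdd
  have : z = z' := by
    funext c
    apply Subtype.ext
    funext t
    apply Fin.ext
    rw [← toZ_eq, ← toZ_eq]
    have e : ∀ u, u ≤ toZ z c t ↔ u ≤ toZ z' c t := fun u => by
      rw [(toZ_good z hz).le_iff c t u (by omega) t.2, (toZ_good z' hz').le_iff c t u (by omega) t.2, h']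
    exact le_antisymm ((e _).1 le_rfl) ((e _).2 le_rfl)
  subst this
  rfl

lemma toU_surjective (n : ℕ) : Function.Surjective (toU n) := by
  rintro ⟨U, hU⟩
  obtain ⟨d, hd, Z, hZ, h⟩ := exists_good n U hU
  let z : Fin (n+1) → XX n d := fun c => ⟨fun t => ⟨Z c t, hZ.bound c t (by omega) t.2⟩,
    fun a b hab => hZ.anti c a b (by omega) hab b.2⟩
  have hz : IsChain n d n z := by
    intro c t
    simp only [Rel, Fin.ext_iff]
    exact hZ.step c t c.2 t.2
  refine ⟨⟨⟨d, by omega⟩, ⟨z, hz⟩⟩, Subtype.ext ?_⟩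
  funext i j t
  apply propext
  change UZ n d (toZ z) i j t ↔ U i j t
  rw [h]
  simp only [UZ]
  apply and_congr_right
  intro ht
  apply and_congr_right
  intro _
  apply and_congr_right
  intro _
  apply and_congr_right
  intro hi
  rw [toZ, dif_pos ⟨by omega, ht⟩]

/-- agreement on the two walls -/
def Agree (U V : ℕ → ℕ → ℕ → Prop) : Prop :=
  (∀ i t, U i t t ↔ V i t t) ∧ (∀ i t, U i i t ↔ V i i t)

lemma agree_iff {n d : ℕ} (z z' : Fin (n+1) → XX n d) (hd : d ≤ n) (hz : IsChain n d n z)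
    (hz' : IsChain n d n z') :
    Agree (UZ n d (toZ z)) (UZ n d (toZ z')) ↔ (z (Fin.last n) = z' (Fin.last n) ∧ z 0 = z' 0) := by
  have g := toZ_good z hz
  have g' := toZ_good z' hz'
  constructor
  · rintro ⟨h1, h2⟩
    have key : ∀ (c : Fin (n+1)), (∀ (t : Fin d) u, u ≤ toZ z c t ↔ u ≤ toZ z' c t) → z c = z' c := by
      intro c h
      apply Subtype.ext
      funext t
      apply Fin.ext
      rw [← toZ_eq, ← toZ_eq]
      exact le_antisymm ((h t _).1 le_rfl) ((h t _).2 le_rfl)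
    constructor
    · apply key
      intro t u
      rcases Nat.lt_or_ge n u with hu | hu
      · have := g.bound n t le_rfl t.2
        have := g'.bound n t le_rfl t.2
        simp only [Fin.val_last]
        omega
      · rw [g.le_iff _ _ _ (by simp) t.2, g'.le_iff _ _ _ (by simp) t.2, Fin.val_last,
          show u - n = 0 by omega]
        exact h1 _ _
    · apply key
      intro t u
      rw [g.le_iff _ _ _ (by simp) t.2, g'.le_iff _ _ _ (by simp) t.2]
      simp only [Fin.val_zero, Nat.sub_zero]
      exact h2 _ _
  · rintro ⟨h1, h2⟩
    constructor
    · intro i t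
      by_cases ht : t < d ∧ t ≤ i ∧ i < n
      · have a := g.le_iff n t (i - t) le_rfl ht.1
        have a' := g'.le_iff n t (i - t) le_rfl ht.1
        rw [show t + (i - t) = i by omega, show t + (i - t - n) = t by omega] at a a'
        rw [← a, ← a']
        have e1 := toZ_eq z (Fin.last n) ⟨t, ht.1⟩
        have e2 := toZ_eq z' (Fin.last n) ⟨t, ht.1⟩
        rw [h1, ← e2] at e1
        simp only [Fin.val_last] at e1
        rw [e1]
      · simp only [UZ]; omega
    · intro i t
      by_cases ht : t < d
      · have e1 := toZ_eq z 0 ⟨t, ht⟩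
        have e2 := toZ_eq z' 0 ⟨t, ht⟩
        rw [h2, ← e2] at e1
        simp only [Fin.val_zero] at e1
        simp only [UZ, Nat.sub_self, e1]
      · simp only [UZ]; omega

/-- pairs of lower sets which agree on the walls -/
abbrev PairU (n : ℕ) := {p : {U : ℕ → ℕ → ℕ → Prop // IsU n U} × {U : ℕ → ℕ → ℕ → Prop // IsU n U} //
  Agree p.1.1 p.2.1}

/-- pairs of chains which agree at both ends -/
abbrev PairC (n : ℕ) := Σ d : Fin (n+1), Σ f : XX n d.val, Σ g : XX n d.val,
  Chain n d.val n f g × Chain n d.val n f g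

/-- from pairs of chains to pairs of lower sets -/
def pairMap (n : ℕ) (q : PairC n) : PairU n :=
  ⟨(toU n ⟨q.1, q.2.2.2.1.1, q.2.2.2.1.2.1⟩, toU n ⟨q.1, q.2.2.2.2.1, q.2.2.2.2.2.1⟩), by
    obtain ⟨d, f, g, ⟨z, hz, hl, h0⟩, ⟨z', hz', hl', h0'⟩⟩ := q
    exact (agree_iff z z' (by omega) hz hz').2 ⟨hl.trans hl'.symm, h0.trans h0'.symm⟩⟩

lemma pairMap_bijective (n : ℕ) : Function.Bijective (pairMap n) := by
  constructor
  · rintro ⟨d, f, g, ⟨z, hz, hl, h0⟩, ⟨z', hz', hl', h0'⟩⟩ ⟨e, f1, g1, ⟨y, hy, kl, k0⟩, ⟨y', hy', kl', k0'⟩⟩ h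
    have h := congrArg Subtype.val h
    have h1 := toU_injective n (congrArg Prod.fst h)
    have h2 := toU_injective n (congrArg Prod.snd h)
    simp only at h1 h2
    obtain rfl : d = e := congrArg Sigma.fst h1
    have k1 := congrArg Subtype.val (eq_of_heq (Sigma.mk.inj h1).2)
    have k2 := congrArg Subtype.val (eq_of_heq (Sigma.mk.inj h2).2)
    simp only at k1 k2
    clear h h1 h2
    subst k1; subst k2; subst hl; subst h0; subst kl; subst k0
    rfl
  · rintro ⟨⟨U, V⟩, hUV⟩
    obtain ⟨⟨d, z, hz⟩, rfl⟩ := toU_surjective n U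
    obtain ⟨⟨d', z', hz'⟩, rfl⟩ := toU_surjective n V
    have hdd : d = d' := by
      have : ∀ t, t < d.val ↔ t < d'.val := fun t => by
        rw [← UZ_diag (Z := toZ z) (by omega : d.val ≤ n) t,
          ← UZ_diag (Z := toZ z') (by omega : d'.val ≤ n) t]
        exact hUV.1 t t
      have a := this d
      have b := this d'
      apply Fin.ext
      omega
    subst hdd
    obtain ⟨e1, e2⟩ := (agree_iff z z' (by omega) hz hz').1 hUV
    exact ⟨⟨d, z (Fin.last n), z 0, ⟨z, hz, rfl, rfl⟩, ⟨z', hz', e1.symm, e2.symm⟩⟩, rfl⟩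

lemma card_PairU (n : ℕ) : (Nat.card (PairU n) : ℚ) = (1 + Lp n n * (Lp n n)ᵀ).det := by
  rw [← Nat.card_congr (Equiv.ofBijective _ (pairMap_bijective n)), ← sum_card_sq]
  simp only [Nat.card_sigma, Nat.card_prod]
  push_cast
  rw [Finset.sum_range]
  simp only [sq]

end CSPP

namespace CSPP
open Finset Matrix

/-- cyclically symmetric plane partitions -/
abbrev CS (n : ℕ) := {S : Set (Fin n × Fin n × Fin n) // IsLowerSet S ∧
        ∀ i j k : Fin n, (i, j, k) ∈ S ↔ (j, k, i) ∈ S}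

/-- membership with natural number coordinates -/
def Mem {n : ℕ} (S : Set (Fin n × Fin n × Fin n)) (i j k : ℕ) : Prop :=
  ∃ (hi : i < n) (hj : j < n) (hk : k < n), ((⟨i, hi⟩ : Fin n), (⟨j, hj⟩ : Fin n), (⟨k, hk⟩ : Fin n)) ∈ S

lemma Mem.lt {n : ℕ} {S : Set (Fin n × Fin n × Fin n)} {i j k : ℕ} (h : Mem S i j k) :
    i < n ∧ j < n ∧ k < n := ⟨h.1, h.2.1, h.2.2.1⟩

lemma Mem.lower {n : ℕ} (S : CS n) {i j k i' j' k' : ℕ} (h : Mem S.1 i j k) (hi : i' ≤ i) (hj : j' ≤ j)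
    (hk : k' ≤ k) : Mem S.1 i' j' k' := by
  obtain ⟨h1, h2, h3, h4⟩ := h
  exact ⟨by omega, by omega, by omega, S.2.1 (show (_ : Fin n × Fin n × Fin n) ≤ _ from ⟨hi, hj, hk⟩) h4⟩

lemma Mem.cyc {n : ℕ} (S : CS n) (i j k : ℕ) : Mem S.1 i j k ↔ Mem S.1 j k i := by
  constructor
  · rintro ⟨h1, h2, h3, h4⟩
    exact ⟨h2, h3, h1, (S.2.2 _ _ _).1 h4⟩
  · rintro ⟨h1, h2, h3, h4⟩
    exact ⟨h3, h1, h2, (S.2.2 _ _ _).2 h4⟩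

/-- the two fundamental domains -/
def csMap (n : ℕ) (S : CS n) : PairU n :=
  ⟨(⟨fun i j t => t ≤ j ∧ j ≤ i ∧ Mem S.1 i j t,
      ⟨fun _ _ _ h => ⟨h.1, h.2.1, h.2.2.lt.1⟩,
       fun _ _ _ _ _ _ h hi hj ht h1 h2 => ⟨h1, h2, h.2.2.lower S hi hj ht⟩⟩⟩,
    ⟨fun i j t => t ≤ j ∧ j ≤ i ∧ Mem S.1 j i t,
      ⟨fun _ _ _ h => ⟨h.1, h.2.1, h.2.2.lt.2.1⟩,
       fun _ _ _ _ _ _ h hi hj ht h1 h2 => ⟨h1, h2, h.2.2.lower S hj hi ht⟩⟩⟩),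
   by
    constructor
    · intro i t
      simp only [Mem.cyc S i t t, Mem.cyc S t t i]
    · intro i t
      rfl⟩

/-- reconstruction -/
def Glue (U V : ℕ → ℕ → ℕ → Prop) (i j k : ℕ) : Prop :=
  U i j k ∨ V j i k ∨ U j k i ∨ V k j i ∨ U k i j ∨ V i k j

lemma Glue_cyc (U V : ℕ → ℕ → ℕ → Prop) (i j k : ℕ) : Glue U V i j k ↔ Glue U V j k i := by
  simp only [Glue]; tauto

section
variable {n : ℕ} {U V : ℕ → ℕ → ℕ → Prop}

lemma Glue_lower_U (hU : IsU n U) (hV : IsU n V) (h : Agree U V) {i j k a b c : ℕ}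
    (hq : U i j k) (ha : a ≤ i) (hb : b ≤ j) (hc : c ≤ k) : Glue U V a b c := by
  obtain ⟨s1, s2, s3⟩ := hU.1 _ _ _ hq
  have dn : ∀ i' j' k', i' ≤ i → j' ≤ j → k' ≤ k → k' ≤ j' → j' ≤ i' → U i' j' k' :=
    fun i' j' k' => hU.2 _ _ _ i' j' k' hq
  rcases le_total a b with h1 | h1 <;> rcases le_total b c with h2 | h2 <;>
    rcases le_total a c with h3 | h3
  · have := (h.1 c c).1 (dn c c c (by omega) (by omega) hc le_rfl le_rfl)
    exact Or.inr (Or.inr (Or.inr (Or.inl (hV.2 _ _ _ _ _ _ this le_rfl h2 h3 h1 h2))))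
  · have : a = b := by omega
    have : b = c := by omega
    subst a; subst b
    exact Or.inl (dn _ _ _ (by omega) (by omega) hc le_rfl le_rfl)
  · exact Or.inr (Or.inr (Or.inl (dn _ _ _ (by omega) (by omega) (by omega) h3 h2)))
  · have := (h.2 b c).1 (dn b b c (by omega) hb hc h2 le_rfl)
    exact Or.inr (Or.inl (hV.2 _ _ _ _ _ _ this le_rfl h1 le_rfl h3 h1))
  · exact Or.inr (Or.inr (Or.inr (Or.inr (Or.inl (dn _ _ _ (by omega) (by omega) (by omega) h1 h3)))))
  · have := (h.1 a c).1 (dn a c c ha (by omega) hc le_rfl h3)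
    exact Or.inr (Or.inr (Or.inr (Or.inr (Or.inr (hV.2 _ _ _ _ _ _ this le_rfl le_rfl h2 h2 h3)))))
  · exact Or.inl (dn _ _ _ ha hb hc h2 h1)
  · exact Or.inl (dn _ _ _ ha hb hc h2 h1)

lemma Glue_swap (i j k : ℕ) : Glue U V i j k ↔ Glue V U j i k := by
  simp only [Glue]; tauto

lemma Glue_lower (hU : IsU n U) (hV : IsU n V) (h : Agree U V) {i j k a b c : ℕ}
    (hq : Glue U V i j k) (ha : a ≤ i) (hb : b ≤ j) (hc : c ≤ k) : Glue U V a b c := by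
  have h' : Agree V U := ⟨fun i t => (h.1 i t).symm, fun i t => (h.2 i t).symm⟩
  rcases hq with hq | hq | hq | hq | hq | hq
  · exact Glue_lower_U hU hV h hq ha hb hc
  · rw [Glue_swap]; exact Glue_lower_U hV hU h' hq hb ha hc
  · rw [Glue_cyc]; exact Glue_lower_U hU hV h hq hb hc ha
  · rw [Glue_cyc, Glue_swap]; exact Glue_lower_U hV hU h' hq hc hb ha
  · rw [Glue_cyc, Glue_cyc]; exact Glue_lower_U hU hV h hq hc ha hb
  · rw [Glue_cyc, Glue_cyc, Glue_swap]; exact Glue_lower_U hV hU h' hq ha hc hb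

lemma Glue_U (hU : IsU n U) (hV : IsU n V) (h : Agree U V) {i j k : ℕ} (h1 : k ≤ j) (h2 : j ≤ i) :
    Glue U V i j k ↔ U i j k := by
  constructor
  · rintro (hq | hq | hq | hq | hq | hq)
    · exact hq
    · have := hV.1 _ _ _ hq
      obtain rfl : i = j := by omega
      exact (h.2 _ _).2 hq
    · have := hU.1 _ _ _ hq
      obtain rfl : i = j := by omega
      obtain rfl : i = k := by omega
      exact hq
    · have := hV.1 _ _ _ hq
      obtain rfl : i = j := by omega
      obtain rfl : i = k := by omega
      exact (h.2 _ _).2 hq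
    · have := hU.1 _ _ _ hq
      obtain rfl : i = j := by omega
      obtain rfl : i = k := by omega
      exact hq
    · have := hV.1 _ _ _ hq
      obtain rfl : j = k := by omega
      exact (h.1 _ _).2 hq
  · exact fun hq => Or.inl hq

lemma Glue_lt (hU : IsU n U) (hV : IsU n V) {i j k : ℕ} (h : Glue U V i j k) :
    i < n ∧ j < n ∧ k < n := by
  rcases h with hq | hq | hq | hq | hq | hq
  all_goals first
    | (have := hU.1 _ _ _ hq; omega)
    | (have := hV.1 _ _ _ hq; omega)
end

lemma csMap_bijective (n : ℕ) : Function.Bijective (csMap n) := by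
  constructor
  · intro S T h
    have h := congrArg Subtype.val h
    have h1 := congrArg Subtype.val (congrArg Prod.fst h)
    have h2 := congrArg Subtype.val (congrArg Prod.snd h)
    have e1 : ∀ i j t, t ≤ j → j ≤ i → (Mem S.1 i j t ↔ Mem T.1 i j t) := by
      intro i j t a b
      have := congrFun (congrFun (congrFun h1 i) j) t
      simpa [csMap, a, b] using this
    have e2 : ∀ i j t, t ≤ j → j ≤ i → (Mem S.1 j i t ↔ Mem T.1 j i t) := by
      intro i j t a b
      have := congrFun (congrFun (congrFun h2 i) j) t
      simpa [csMap, a, b] using this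
    have e3 : ∀ i j t, t ≤ j → t ≤ i → (Mem S.1 i j t ↔ Mem T.1 i j t) := by
      intro i j t a b
      rcases le_total i j with h | h
      · exact e2 _ _ _ b h
      · exact e1 _ _ _ a h
    have e4 : ∀ i j t, (Mem S.1 i j t ↔ Mem T.1 i j t) := by
      intro i j t
      by_cases c1 : t ≤ j ∧ t ≤ i
      · exact e3 _ _ _ c1.1 c1.2
      by_cases c2 : i ≤ j ∧ i ≤ t
      · rw [Mem.cyc S, Mem.cyc T]
        exact e3 _ _ _ c2.2 c2.1
      · rw [Mem.cyc S, Mem.cyc T, Mem.cyc S, Mem.cyc T]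
        exact e3 _ _ _ (by omega) (by omega)
    apply Subtype.ext
    ext ⟨i, j, k⟩
    have := e4 i j k
    simpa [Mem] using this
  · rintro ⟨⟨⟨U, hU⟩, ⟨V, hV⟩⟩, hUV⟩
    have hUV : Agree U V := hUV
    have hVU : Agree V U := ⟨fun i t => (hUV.1 i t).symm, fun i t => (hUV.2 i t).symm⟩
    let S : CS n := ⟨{p | Glue U V p.1 p.2.1 p.2.2}, by
      intro p q hpq hp
      exact Glue_lower hU hV hUV hp hpq.1 hpq.2.1 hpq.2.2, by
      intro i j k
      exact Glue_cyc U V i j k⟩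
    have hS : ∀ i j k, Mem S.1 i j k ↔ Glue U V i j k := by
      intro i j k
      constructor
      · rintro ⟨_, _, _, h⟩
        exact h
      · intro h
        have := Glue_lt hU hV h
        exact ⟨this.1, this.2.1, this.2.2, h⟩
    refine ⟨S, Subtype.ext (Prod.ext (Subtype.ext ?_) (Subtype.ext ?_))⟩
    · funext i j t
      apply propext
      simp only [csMap, hS]
      constructor
      · rintro ⟨a, b, c⟩
        exact (Glue_U hU hV hUV a b).1 c
      · intro h
        have := hU.1 _ _ _ h
        exact ⟨this.1, this.2.1, Or.inl h⟩
    · funext i j t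
      apply propext
      simp only [csMap, hS]
      constructor
      · rintro ⟨a, b, c⟩
        rw [Glue_swap] at c
        exact (Glue_U hV hU hVU a b).1 c
      · intro h
        have := hV.1 _ _ _ h
        exact ⟨this.1, this.2.1, Or.inr (Or.inl h)⟩

lemma card_CS (n : ℕ) : (Nat.card (CS n) : ℚ) = (1 + Lp n n * (Lp n n)ᵀ).det := by
  rw [Nat.card_congr (Equiv.ofBijective _ (csMap_bijective n)), card_PairU]

end CSPP

namespace CSPP
open Finset Matrix

/-- reciprocal factorial, extended by zero to negative integers -/
def rf (z : ℤ) : ℚ := if z < 0 then 0 else ((z.toNat.factorial : ℚ))⁻¹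

lemma rf_nat (n : ℕ) : rf (n : ℤ) = ((n.factorial : ℚ))⁻¹ := by
  simp [rf]

lemma rf_neg {z : ℤ} (h : z < 0) : rf z = 0 := by simp [rf, h]

lemma rf_pred (z w : ℤ) (h : w = z - 1) : rf w = z * rf z := by
  subst h
  rcases lt_trichotomy z 0 with h | h | h
  · rw [rf_neg h, rf_neg (by omega)]; simp
  · subst h; rw [rf_neg (by omega)]; simp
  · obtain ⟨n, rfl⟩ : ∃ n : ℕ, z = (n : ℤ) + 1 := ⟨(z - 1).toNat, by omega⟩
    rw [show (n : ℤ) + 1 - 1 = (n : ℤ) by ring, rf_nat,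
      show (n : ℤ) + 1 = ((n + 1 : ℕ) : ℤ) by push_cast; rfl, rf_nat, Nat.factorial_succ]
    have : (n.factorial : ℚ) ≠ 0 := by exact_mod_cast n.factorial_ne_zero
    push_cast
    field_simp

open Polynomial in
/-- coefficientwise inner product -/
def ip (N : ℕ) (p q : ℚ[X]) : ℚ := ∑ j ∈ range N, p.coeff j * q.coeff j

section
open Polynomial

lemma ip_comm (N : ℕ) (p q : ℚ[X]) : ip N p q = ip N q p :=
  Finset.sum_congr rfl fun _ _ => mul_comm _ _

lemma ip_sub_right (N : ℕ) (p q r : ℚ[X]) : ip N p (q - r) = ip N p q - ip N p r := by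
  simp [ip, mul_sub, Finset.sum_sub_distrib]

lemma ip_sub_left (N : ℕ) (p q r : ℚ[X]) : ip N (q - r) p = ip N q p - ip N r p := by
  rw [ip_comm, ip_sub_right, ip_comm N p q, ip_comm N p r]

lemma ip_C_right (N : ℕ) (p q : ℚ[X]) (c : ℚ) : ip N p (C c * q) = c * ip N p q := by
  simp only [ip, coeff_C_mul, Finset.mul_sum]
  exact Finset.sum_congr rfl fun _ _ => by ring

lemma ip_C_left (N : ℕ) (p q : ℚ[X]) (c : ℚ) : ip N (C c * p) q = c * ip N p q := by
  rw [ip_comm, ip_C_right, ip_comm]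

lemma ip_sum_right (N : ℕ) (p : ℚ[X]) {ι : Type*} (s : Finset ι) (f : ι → ℚ[X]) :
    ip N p (∑ k ∈ s, f k) = ∑ k ∈ s, ip N p (f k) := by
  simp only [ip, finsetSum_coeff, Finset.mul_sum]
  rw [Finset.sum_comm]

lemma ip_sum_left (N : ℕ) (p : ℚ[X]) {ι : Type*} (s : Finset ι) (f : ι → ℚ[X]) :
    ip N (∑ k ∈ s, f k) p = ∑ k ∈ s, ip N (f k) p := by
  rw [ip_comm, ip_sum_right]
  exact Finset.sum_congr rfl fun _ _ => ip_comm _ _ _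

/-- closed form of the inner products -/
def T (a k b l : ℕ) : ℚ :=
  (-1) ^ (a + b) * ((k + l).factorial : ℚ) * rf ((k : ℤ) + a - b) * rf ((l : ℤ) + b - a)

lemma T_succ_right (a k b l : ℕ) : T a k b (l+1) = T a k b l - T a k (b+1) l := by
  simp only [T]
  have h1 := rf_pred ((k : ℤ) + a - b) ((k : ℤ) + a - (b+1 : ℕ)) (by push_cast; ring)
  have h2 := rf_pred (((l+1 : ℕ) : ℤ) + b - a) ((l : ℤ) + b - a) (by push_cast; ring)
  have h3 : ((l : ℤ) + (b+1 : ℕ) - a) = (((l+1 : ℕ) : ℤ) + b - a) := by push_cast; ring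
  rw [h3, h1, h2, ← add_assoc, ← add_assoc, Nat.factorial_succ, pow_succ]
  push_cast
  ring

lemma T_symm (a k b l : ℕ) : T a k b l = T b l a k := by
  simp only [T]
  rw [add_comm a b, add_comm k l]
  ring

lemma T_succ_left (a k b l : ℕ) : T a (k+1) b l = T a k b l - T (a+1) k b l := by
  rw [T_symm, T_succ_right, T_symm, T_symm b l (a+1)]

lemma T_zero (a b : ℕ) : T a 0 b 0 = if a = b then 1 else 0 := by
  simp only [T]
  rcases lt_trichotomy a b with h | h | h
  · rw [rf_neg (by push_cast; omega), if_neg (by omega)]; simp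
  · subst h
    have : rf 0 = 1 := by simp [rf]
    simp [this]
  · rw [rf_neg (z := ((0 : ℕ) : ℤ) + b - a) (by push_cast; omega), if_neg (by omega)]; simp

lemma ip_T (N a k b l : ℕ) (h : a + k < N) :
    ip N (X ^ a * (1 - X) ^ k) (X ^ b * (1 - X) ^ l) = T a k b l := by
  induction k generalizing a with
  | zero =>
    induction l generalizing b with
    | zero =>
      rw [T_zero]
      simp only [ip, pow_zero, mul_one, coeff_X_pow]
      simp only [ite_mul, one_mul, zero_mul]
      rw [Finset.sum_ite_eq' (range N) a, if_pos (by simpa using h)]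
    | succ l ih =>
      rw [T_succ_right, ← ih, ← ih, ← ip_sub_right]
      congr 1
      ring
  | succ k ih =>
    rw [T_succ_left, ← ih a (by omega), ← ih (a+1) (by omega), ← ip_sub_left]
    congr 1
    ring

/-- even Gram entries -/
def ge (i k : ℕ) : ℚ :=
  (-1) ^ (i + k) * ((i + k).factorial : ℚ) * rf (2 * i - k) * rf (2 * k - i)

/-- odd Gram entries -/
def go (i k : ℕ) : ℚ :=
  (-1) ^ (i + k) * ((i + k).factorial : ℚ) * rf (2 * i - k + 1) * rf (2 * k - i + 1) *
    (9 * i * k + 7 * i + 7 * k + 5)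

lemma ip_ge (N i k : ℕ) (h : 2 * i < N) : ip N ((X * (1 - X)) ^ i) ((X * (1 - X)) ^ k) = ge i k := by
  rw [mul_pow, mul_pow, ip_T _ _ _ _ _ (by omega), T, ge]
  congr 2 <;> congr 1
  · congr 1; ring
  · ring

lemma ip_go (N i k : ℕ) (h : 2 * i + 1 < N) :
    ip N ((1 - C 2 * X) * (X * (1 - X)) ^ i) ((1 - C 2 * X) * (X * (1 - X)) ^ k) = go i k := by
  have e : ∀ i : ℕ, (1 - C 2 * X : ℚ[X]) * (X * (1 - X)) ^ i =
      X ^ i * (1 - X) ^ i - C 2 * (X ^ (i+1) * (1 - X) ^ i) := by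
    intro i; rw [mul_pow]; ring
  rw [e, e, ip_sub_left, ip_sub_right, ip_sub_right, ip_C_left, ip_C_right, ip_C_left, ip_C_right,
    ip_T _ _ _ _ _ (by omega), ip_T _ _ _ _ _ (by omega), ip_T _ _ _ _ _ (by omega),
    ip_T _ _ _ _ _ (by omega)]
  simp only [T, go]
  have h1 := rf_pred ((2 : ℤ) * i - k + 1) ((i : ℤ) + i - k) (by ring)
  have h2 := rf_pred ((2 : ℤ) * i - k) ((i : ℤ) + i - (k+1 : ℕ)) (by push_cast; ring)
  have h2' := rf_pred ((2 : ℤ) * i - k + 1) ((2 : ℤ) * i - k) (by ring)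
  have h3 := rf_pred ((2 : ℤ) * k - i + 1) ((k : ℤ) + k - i) (by ring)
  have h4 := rf_pred ((2 : ℤ) * k - i) ((k : ℤ) + k - (i+1 : ℕ)) (by push_cast; ring)
  have h4' := rf_pred ((2 : ℤ) * k - i + 1) ((2 : ℤ) * k - i) (by ring)
  have h5 : (i : ℤ) + (i+1 : ℕ) - k = 2 * i - k + 1 := by push_cast; ring
  have h6 : (k : ℤ) + (k+1 : ℕ) - i = 2 * k - i + 1 := by push_cast; ring
  have h7 : (i : ℤ) + (i+1 : ℕ) - (k+1 : ℕ) = (i : ℤ) + i - k := by push_cast; ring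
  have h8 : (k : ℤ) + (k+1 : ℕ) - (i+1 : ℕ) = (k : ℤ) + k - i := by push_cast; ring
  rw [h5, h6, h7, h8, h1, h2, h2', h3, h4, h4']
  push_cast
  ring

end

end CSPP

namespace CSPP
open Finset Matrix

lemma fac_ne (n : ℕ) : (n.factorial : ℚ) ≠ 0 := by exact_mod_cast n.factorial_ne_zero

/-! ### even case -/

/-- hypergeometric coefficients, even case -/
def ehe (m k : ℕ) : ℚ := ∏ r ∈ range k,
  (2 * ((m : ℚ) - r) * (2 * m + 2 * r + 1)) / ((2 * m - r - 1) * (2 * m + r + 2))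

lemma ehe_rec (m k : ℕ) (hm : 1 ≤ m) (hk : k ≤ m) :
    (2 * (m : ℚ) - k - 1) * (2 * m + k + 2) * ehe m (k+1) =
      2 * ((m : ℚ) - k) * (2 * m + 2 * k + 1) * ehe m k := by
  rw [ehe, Finset.prod_range_succ, ← ehe]
  have h2 : (2 * (m : ℚ) + k + 2) ≠ 0 := by positivity
  rcases hk.lt_or_eq with h | h
  · have h1 : (2 * (m : ℚ) - k - 1) ≠ 0 := by
      have : (k : ℚ) + 1 ≤ m := by exact_mod_cast h
      have : (1 : ℚ) ≤ m := by exact_mod_cast hm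
      intro h; linarith
    field_simp
  · subst h; simp

lemma ehe_ne (m k : ℕ) (hk : k ≤ m) : ehe m k ≠ 0 := by
  rw [ehe, Finset.prod_ne_zero_iff]
  intro r hr
  have : r + 1 ≤ m := by have := Finset.mem_range.1 hr; omega
  have h : (r : ℚ) + 1 ≤ m := by exact_mod_cast this
  have hr0 : (0 : ℚ) ≤ r := by positivity
  apply div_ne_zero
  · apply mul_ne_zero
    · apply mul_ne_zero two_ne_zero
      intro h; linarith
    · positivity
  · apply mul_ne_zero
    · intro h
      have h3 : (r : ℚ) + m = 0 := by linarith
      linarith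
    · positivity

/-- the sums, even case -/
def Se (m i : ℕ) : ℚ := ∑ k ∈ range (m+1), (k * ehe m k) * ge i k

/-- certificate, even case -/
def Ge (m i k : ℕ) : ℚ := ehe m k * (2 * m - k) * (2 * m + k + 1) * (-1) ^ (i + k) *
  ((i + k).factorial : ℚ) * rf (2 * k - i - 2) * rf (2 * i + 2 - k) * (2 * (i + 1) - (3 * i + 2) * k)

lemma Ge_step (m i k : ℕ) (hm : 1 ≤ m) (hk : k ≤ m) :
    2 * ((i : ℚ) + 1 - m) * (2 * i + 2 * m + 3) * (3 * i + 1) * ((k * ehe m k) * ge (i+1) k) +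
      (2 * (m : ℚ) - i) * (2 * m + i + 1) * (3 * i + 4) * ((k * ehe m k) * ge i k) =
    Ge m i (k+1) - Ge m i k := by
  have hr := ehe_rec m k hm hk
  simp only [Ge, ge]
  have h1 := rf_pred ((2 : ℤ) * k - i) (2 * k - (i + 1 : ℕ)) (by push_cast; ring)
  have h2 := rf_pred ((2 : ℤ) * k - (i + 1 : ℕ)) (2 * k - i - 2) (by push_cast; ring)
  have h3 := rf_pred ((2 : ℤ) * i + 2 - k) (2 * i + 2 - (k + 1 : ℕ)) (by push_cast; ring)
  have h4 := rf_pred ((2 : ℤ) * i + 2 - (k + 1 : ℕ)) (2 * i - k) (by push_cast; ring)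
  have h5 : (2 : ℤ) * (k + 1 : ℕ) - i - 2 = 2 * k - i := by push_cast; ring
  have h6 : (2 : ℤ) * (i + 1 : ℕ) - k = 2 * i + 2 - k := by push_cast; ring
  rw [h5, h6, h4, h3, h2, h1, ← add_assoc, show i + 1 + k = i + k + 1 by ring, Nat.factorial_succ,
    pow_succ]
  push_cast
  have hG : ehe m (k + 1) * (2 * (m : ℚ) - (k + 1)) * (2 * m + (k + 1) + 1) =
      2 * ((m : ℚ) - k) * (2 * m + 2 * k + 1) * ehe m k := by rw [← hr]; ring
  rw [hG]
  ring

lemma Se_rec (m i : ℕ) (hm : 1 ≤ m) :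
    2 * ((i : ℚ) + 1 - m) * (2 * i + 2 * m + 3) * (3 * i + 1) * Se m (i+1) =
      -((2 * (m : ℚ) - i) * (2 * m + i + 1) * (3 * i + 4)) * Se m i := by
  have h := Finset.sum_range_sub (Ge m i) (m+1)
  have h' : ∑ k ∈ range (m+1), (Ge m i (k+1) - Ge m i k) =
      2 * ((i : ℚ) + 1 - m) * (2 * i + 2 * m + 3) * (3 * i + 1) * Se m (i+1) +
      (2 * (m : ℚ) - i) * (2 * m + i + 1) * (3 * i + 4) * Se m i := by
    rw [Se, Se, Finset.mul_sum, Finset.mul_sum, ← Finset.sum_add_distrib]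
    refine Finset.sum_congr rfl fun k hk => ?_
    rw [Ge_step m i k hm (by have := Finset.mem_range.1 hk; omega)]
  have h0 : Ge m i 0 = 0 := by
    rw [Ge, rf_neg (z := 2 * ((0 : ℕ) : ℤ) - i - 2) (by push_cast; omega)]; simp
  have h1 : Ge m i (m+1) = 0 := by
    have : ehe m (m+1) = 0 := by rw [ehe, Finset.prod_range_succ]; simp
    rw [Ge, this]; simp
  rw [h0, h1] at h
  rw [h'] at h
  linarith

lemma Se_zero (m i : ℕ) (hi : i < m) : Se m i = 0 := by
  obtain ⟨r, rfl⟩ : ∃ r, m = i + 1 + r := ⟨m - i - 1, by omega⟩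
  induction r generalizing i with
  | zero =>
    have := Se_rec (i + 1 + 0) i (by omega)
    push_cast at this
    have h2 : (2 * ((i : ℚ) + 1 + 0) - i) * (2 * (i + 1 + 0) + i + 1) * (3 * i + 4) ≠ 0 := by
      rw [show (2 * ((i : ℚ) + 1 + 0) - i) = i + 2 by ring]; positivity
    have h3 : ((2 * ((i : ℚ) + 1 + 0) - i) * (2 * (i + 1 + 0) + i + 1) * (3 * i + 4)) *
      Se (i + 1 + 0) i = 0 := by linear_combination this
    exact (mul_eq_zero.1 h3).resolve_left h2
  | succ r ih =>
    have h1 := ih (i + 1) (by omega)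
    rw [show i + 1 + 1 + r = i + 1 + (r + 1) by ring] at h1
    have := Se_rec (i + 1 + (r+1)) i (by omega)
    rw [h1] at this
    push_cast at this
    have h2 : (2 * ((i : ℚ) + 1 + (r+1)) - i) * (2 * (i + 1 + (r+1)) + i + 1) * (3 * i + 4) ≠ 0 := by
      rw [show (2 * ((i : ℚ) + 1 + (r+1)) - i) = i + 2 * r + 4 by ring]; positivity
    have h3 : ((2 * ((i : ℚ) + 1 + (r+1)) - i) * (2 * (i + 1 + (r+1)) + i + 1) * (3 * i + 4)) *
      Se (i + 1 + (r+1)) i = 0 := by linear_combination this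
    exact (mul_eq_zero.1 h3).resolve_left h2

lemma Se_top (m : ℕ) : Se m (2 * m) = (-1) ^ m * (m * ehe m m) := by
  rw [Se, Finset.sum_range_succ, Finset.sum_eq_zero, ge,
    show (2 : ℤ) * (2 * m : ℕ) - m = ((2 * m + m : ℕ) : ℤ) by push_cast; ring,
    show (2 : ℤ) * m - (2 * m : ℕ) = ((0 : ℕ) : ℤ) by push_cast; ring, rf_nat, rf_nat]
  · have := fac_ne (2 * m + m)
    field_simp
    simp [pow_add, pow_mul]
  · intro k hk
    have := Finset.mem_range.1 hk
    rw [ge, rf_neg (z := (2 : ℤ) * k - (2 * m : ℕ)) (by push_cast; omega)]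
    simp

/-- closed form, even case -/
def sge (m r : ℕ) : ℚ := (-1) ^ r * (3 * m + 3 * r + 1) * ((3 * m + r).factorial : ℚ) *
  ((2 * m + r + 1).factorial : ℚ) * rf (m - r) * rf r * rf ((4 * m + 2 * r + 2 : ℕ))

lemma Se_closed (m r : ℕ) (hm : 1 ≤ m) : Se m (m + r) * sge m 0 = sge m r * Se m m := by
  induction r with
  | zero => simp [mul_comm]
  | succ r ih =>
    have h := Se_rec m (m + r) hm
    have hs : 2 * ((r : ℚ) + 1) * (4 * m + 2 * r + 3) * (3 * m + 3 * r + 1) * sge m (r+1) =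
      -((m - r) * (3 * m + r + 1) * (3 * m + 3 * r + 4)) * sge m r := by
      simp only [sge]
      have h1 := rf_pred ((m : ℤ) - r) (m - (r + 1 : ℕ)) (by push_cast; ring)
      have h2 := rf_pred ((r + 1 : ℕ) : ℤ) (r : ℤ) (by push_cast; ring)
      have h3 := rf_pred ((4 * m + 2 * (r + 1) + 2 : ℕ) : ℤ) ((4 * m + 2 * r + 3 : ℕ) : ℤ)
        (by push_cast; ring)
      have h4 := rf_pred ((4 * m + 2 * r + 3 : ℕ) : ℤ) ((4 * m + 2 * r + 2 : ℕ) : ℤ)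
        (by push_cast; ring)
      rw [h1, h2, h4, h3, ← add_assoc, ← add_assoc, Nat.factorial_succ,
        show 2 * m + r + 1 + 1 = (2 * m + r + 1) + 1 by ring, Nat.factorial_succ (2 * m + r + 1), pow_succ]
      push_cast
      ring
    have hne : 2 * ((r : ℚ) + 1) * (4 * m + 2 * r + 3) * (3 * m + 3 * r + 1) ≠ 0 := by positivity
    apply mul_left_cancel₀ hne
    push_cast at h
    rw [← mul_assoc, ← mul_assoc, hs, ← add_assoc]
    linear_combination (sge m 0) * h - ((m - r) * (3 * m + r + 1) * (3 * (m:ℚ) + 3 * r + 4)) * ih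

/-- the ratios -/
def cc (k : ℕ) : ℚ := ((3 * k + 2) * ((3 * k).factorial : ℚ) * (k.factorial : ℚ)) /
  (((2 * k).factorial : ℚ) * ((2 * k + 1).factorial : ℚ))

lemma Se_diag (m : ℕ) (hm : 1 ≤ m) : 2 * Se m m = cc (2 * m) * (m * ehe m m) := by
  have h := Se_closed m m hm
  rw [← two_mul, Se_top] at h
  simp only [sge] at h
  rw [show (m : ℤ) - m = ((0 : ℕ) : ℤ) by simp, show (m : ℤ) - (0 : ℕ) = (m : ℤ) by simp] at h
  simp only [rf_nat] at h
  rw [show 3 * m + m = 4 * m by ring, show 2 * m + m + 1 = 3 * m + 1 by ring,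
    show 4 * m + 2 * m + 2 = 6 * m + 1 + 1 by ring, show 4 * m + 2 * 0 + 2 = 4 * m + 1 + 1 by ring] at h
  simp only [add_zero, Nat.factorial_succ] at h
  rw [cc, show 3 * (2 * m) = 6 * m by ring, show 2 * (2 * m) = 4 * m by ring]
  simp only [Nat.factorial_succ]
  have := fac_ne m
  have := fac_ne (2*m)
  have := fac_ne (3*m)
  have := fac_ne (4*m)
  have := fac_ne (6*m)
  have hh : ((-1 : ℚ)) ^ m ≠ 0 := by positivity
  push_cast at h ⊢
  field_simp at h ⊢
  have hf : 2 * (3 * (m : ℚ) + 1) * (2 * m + 1) * (6 * m + 1) ≠ 0 := by positivity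
  apply mul_left_cancel₀ hf
  linear_combination (-1 : ℚ) * h

/-! ### odd case -/

/-- hypergeometric coefficients, odd case -/
def eho (m k : ℕ) : ℚ := ∏ r ∈ range k,
  (2 * ((m : ℚ) - r) * (2 * m + 2 * r + 3)) / ((2 * m - r) * (2 * m + r + 3))

lemma eho_rec (m k : ℕ) (hk : k ≤ m) :
    (2 * (m : ℚ) - k) * (2 * m + k + 3) * eho m (k+1) =
      2 * ((m : ℚ) - k) * (2 * m + 2 * k + 3) * eho m k := by
  rw [eho, Finset.prod_range_succ, ← eho]
  have h2 : (2 * (m : ℚ) + k + 3) ≠ 0 := by positivity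
  rcases hk.lt_or_eq with h | h
  · have h1 : (2 * (m : ℚ) - k) ≠ 0 := by
      have : (k : ℚ) + 1 ≤ m := by exact_mod_cast h
      have : (0 : ℚ) ≤ k := by positivity
      intro h; linarith
    field_simp
  · subst h; simp

lemma eho_ne (m k : ℕ) (hk : k ≤ m) : eho m k ≠ 0 := by
  rw [eho, Finset.prod_ne_zero_iff]
  intro r hr
  have : r + 1 ≤ m := by have := Finset.mem_range.1 hr; omega
  have h : (r : ℚ) + 1 ≤ m := by exact_mod_cast this
  have hr0 : (0 : ℚ) ≤ r := by positivity
  apply div_ne_zero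
  · apply mul_ne_zero
    · apply mul_ne_zero two_ne_zero
      intro h; linarith
    · positivity
  · apply mul_ne_zero
    · intro h; linarith
    · positivity

/-- the sums, odd case -/
def So (m i : ℕ) : ℚ := ∑ k ∈ range (m+1), ((3 * k + 2) * eho m k) * go i k

/-- certificate, odd case -/
def Go (m i k : ℕ) : ℚ := eho m k * (2 * m - k + 1) * (2 * m + k + 2) * (-1) ^ (i + k) *
  ((i + k).factorial : ℚ) * rf (2 * k - i - 1) * rf (2 * i + 3 - k) *
  ((6 * i ^ 2 + 16 * i + 10) - (3 * i ^ 2 + 13 * i + 12) * k - (27 * i ^ 2 + 75 * i + 46) * k ^ 2)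

lemma Go_step (m i k : ℕ) (hk : k ≤ m) :
    2 * ((i : ℚ) + 1 - m) * (2 * i + 2 * m + 5) * (i + 1) * (((3 * k + 2) * eho m k) * go (i+1) k) +
      (2 * (m : ℚ) + 1 - i) * (2 * m + i + 2) * (i + 2) * (((3 * k + 2) * eho m k) * go i k) =
    Go m i (k+1) - Go m i k := by
  have hr := eho_rec m k hk
  simp only [Go, go]
  have h1 := rf_pred ((2 : ℤ) * k - i + 1) (2 * k - (i + 1 : ℕ) + 1) (by push_cast; ring)
  have h2 := rf_pred ((2 : ℤ) * k - (i + 1 : ℕ) + 1) (2 * k - i - 1) (by push_cast; ring)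
  have h3 := rf_pred ((2 : ℤ) * i + 3 - k) (2 * i + 3 - (k + 1 : ℕ)) (by push_cast; ring)
  have h4 := rf_pred ((2 : ℤ) * i + 3 - (k + 1 : ℕ)) (2 * i - k + 1) (by push_cast; ring)
  have h5 : (2 : ℤ) * (k + 1 : ℕ) - i - 1 = 2 * k - i + 1 := by push_cast; ring
  have h6 : (2 : ℤ) * (i + 1 : ℕ) - k + 1 = 2 * i + 3 - k := by push_cast; ring
  rw [h5, h6, h4, h3, h2, h1, ← add_assoc, show i + 1 + k = i + k + 1 by ring, Nat.factorial_succ,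
    pow_succ]
  push_cast
  have hG : eho m (k + 1) * (2 * (m : ℚ) - (k + 1) + 1) * (2 * m + (k + 1) + 2) =
      2 * ((m : ℚ) - k) * (2 * m + 2 * k + 3) * eho m k := by rw [← hr]; ring
  rw [hG]
  ring

lemma So_rec (m i : ℕ) :
    2 * ((i : ℚ) + 1 - m) * (2 * i + 2 * m + 5) * (i + 1) * So m (i+1) =
      -((2 * (m : ℚ) + 1 - i) * (2 * m + i + 2) * (i + 2)) * So m i := by
  have h := Finset.sum_range_sub (Go m i) (m+1)
  have h' : ∑ k ∈ range (m+1), (Go m i (k+1) - Go m i k) =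
      2 * ((i : ℚ) + 1 - m) * (2 * i + 2 * m + 5) * (i + 1) * So m (i+1) +
      (2 * (m : ℚ) + 1 - i) * (2 * m + i + 2) * (i + 2) * So m i := by
    rw [So, So, Finset.mul_sum, Finset.mul_sum, ← Finset.sum_add_distrib]
    refine Finset.sum_congr rfl fun k hk => ?_
    rw [Go_step m i k (by have := Finset.mem_range.1 hk; omega)]
  have h0 : Go m i 0 = 0 := by
    rw [Go, rf_neg (z := 2 * ((0 : ℕ) : ℤ) - i - 1) (by push_cast; omega)]; simp
  have h1 : Go m i (m+1) = 0 := by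
    have : eho m (m+1) = 0 := by rw [eho, Finset.prod_range_succ]; simp
    rw [Go, this]; simp
  rw [h0, h1] at h
  rw [h'] at h
  linarith

lemma So_zero (m i : ℕ) (hi : i < m) : So m i = 0 := by
  obtain ⟨r, rfl⟩ : ∃ r, m = i + 1 + r := ⟨m - i - 1, by omega⟩
  induction r generalizing i with
  | zero =>
    have := So_rec (i + 1 + 0) i
    push_cast at this
    have h2 : (2 * ((i : ℚ) + 1 + 0) + 1 - i) * (2 * (i + 1 + 0) + i + 2) * (i + 2) ≠ 0 := by
      rw [show (2 * ((i : ℚ) + 1 + 0) + 1 - i) = i + 3 by ring]; positivity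
    have h3 : ((2 * ((i : ℚ) + 1 + 0) + 1 - i) * (2 * (i + 1 + 0) + i + 2) * (i + 2)) *
      So (i + 1 + 0) i = 0 := by linear_combination this
    exact (mul_eq_zero.1 h3).resolve_left h2
  | succ r ih =>
    have h1 := ih (i + 1) (by omega)
    rw [show i + 1 + 1 + r = i + 1 + (r + 1) by ring] at h1
    have := So_rec (i + 1 + (r+1)) i
    rw [h1] at this
    push_cast at this
    have h2 : (2 * ((i : ℚ) + 1 + (r+1)) + 1 - i) * (2 * (i + 1 + (r+1)) + i + 2) * (i + 2) ≠ 0 := by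
      rw [show (2 * ((i : ℚ) + 1 + (r+1)) + 1 - i) = i + 2 * r + 5 by ring]; positivity
    have h3 : ((2 * ((i : ℚ) + 1 + (r+1)) + 1 - i) * (2 * (i + 1 + (r+1)) + i + 2) * (i + 2)) *
      So (i + 1 + (r+1)) i = 0 := by linear_combination this
    exact (mul_eq_zero.1 h3).resolve_left h2

lemma So_top (m : ℕ) : So m (2 * m + 1) = 2 * (-1) ^ (m + 1) * ((3 * m + 2) * eho m m) := by
  rw [So, Finset.sum_range_succ, Finset.sum_eq_zero, go,
    show (2 : ℤ) * (2 * m + 1 : ℕ) - m + 1 = ((3 * m + 1 + 1 + 1 : ℕ) : ℤ) by push_cast; ring,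
    show (2 : ℤ) * m - (2 * m + 1 : ℕ) + 1 = ((0 : ℕ) : ℤ) by push_cast; ring, rf_nat, rf_nat,
    show 2 * m + 1 + m = 3 * m + 1 by ring, Nat.factorial_succ (3 * m + 1 + 1),
    Nat.factorial_succ (3 * m + 1)]
  · have := fac_ne (3 * m + 1)
    have e : ((-1 : ℚ)) ^ (3 * m + 1) = (-1) ^ (m + 1) := by
      rw [show 3 * m + 1 = 2 * m + (m + 1) by ring, pow_add, pow_mul]; simp
    rw [e]
    push_cast
    field_simp
    ring
  · intro k hk
    have := Finset.mem_range.1 hk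
    rw [go, rf_neg (z := (2 : ℤ) * k - (2 * m + 1 : ℕ) + 1) (by push_cast; omega)]
    simp

/-- closed form, odd case -/
def sgo (m r : ℕ) : ℚ := (-1) ^ r * (m + r + 1) * ((3 * m + 1 + r).factorial : ℚ) *
  ((2 * m + 2 + r).factorial : ℚ) * rf (m + 1 - r) * rf r * rf ((4 * m + 2 * r + 4 : ℕ))

lemma So_closed (m r : ℕ) : So m (m + r) * sgo m 0 = sgo m r * So m m := by
  induction r with
  | zero => simp [mul_comm]
  | succ r ih =>
    have h := So_rec m (m + r)
    have hs : 2 * ((r : ℚ) + 1) * (4 * m + 2 * r + 5) * (m + r + 1) * sgo m (r+1) =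
      -((m + 1 - r) * (3 * m + r + 2) * (m + r + 2)) * sgo m r := by
      simp only [sgo]
      have h1 := rf_pred ((m : ℤ) + 1 - r) (m + 1 - (r + 1 : ℕ)) (by push_cast; ring)
      have h2 := rf_pred ((r + 1 : ℕ) : ℤ) (r : ℤ) (by push_cast; ring)
      have h3 := rf_pred ((4 * m + 2 * (r + 1) + 4 : ℕ) : ℤ) ((4 * m + 2 * r + 5 : ℕ) : ℤ)
        (by push_cast; ring)
      have h4 := rf_pred ((4 * m + 2 * r + 5 : ℕ) : ℤ) ((4 * m + 2 * r + 4 : ℕ) : ℤ)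
        (by push_cast; ring)
      rw [h1, h2, h4, h3, ← add_assoc, ← add_assoc, Nat.factorial_succ,
        Nat.factorial_succ (2 * m + 2 + r), pow_succ]
      push_cast
      ring
    have hne : 2 * ((r : ℚ) + 1) * (4 * m + 2 * r + 5) * (m + r + 1) ≠ 0 := by positivity
    apply mul_left_cancel₀ hne
    push_cast at h
    rw [← mul_assoc, ← mul_assoc, hs, ← add_assoc]
    linear_combination (sgo m 0) * h - ((m + 1 - r) * (3 * m + r + 2) * ((m:ℚ) + r + 2)) * ih

lemma So_diag (m : ℕ) : So m m = 2 * cc (2 * m + 1) * ((3 * m + 2) * eho m m) := by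
  have h := So_closed m (m + 1)
  rw [show m + (m + 1) = 2 * m + 1 by ring, So_top] at h
  simp only [sgo] at h
  rw [show (m : ℤ) + 1 - (m + 1 : ℕ) = ((0 : ℕ) : ℤ) by simp,
    show (m : ℤ) + 1 - (0 : ℕ) = ((m + 1 : ℕ) : ℤ) by simp] at h
  simp only [rf_nat] at h
  rw [show 3 * m + 1 + (m + 1) = 4 * m + 1 + 1 by ring, show 2 * m + 2 + (m + 1) = 3 * m + 1 + 1 + 1 by ring,
    show 4 * m + 2 * (m + 1) + 4 = 6 * m + 1 + 1 + 1 + 1 + 1 + 1 by ring,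
    show 4 * m + 2 * 0 + 4 = 4 * m + 1 + 1 + 1 + 1 by ring,
    show 2 * m + 2 + 0 = 2 * m + 1 + 1 by ring] at h
  simp only [add_zero, Nat.factorial_succ] at h
  rw [cc, show 3 * (2 * m + 1) = 6 * m + 1 + 1 + 1 by ring, show 2 * (2 * m + 1) = 4 * m + 1 + 1 by ring]
  simp only [Nat.factorial_succ]
  have := fac_ne m
  have := fac_ne (2*m)
  have := fac_ne (3*m)
  have := fac_ne (4*m)
  have := fac_ne (6*m)
  have hh : ((-1 : ℚ)) ^ m ≠ 0 := by positivity
  rw [pow_succ] at h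
  push_cast at h ⊢
  field_simp at h ⊢
  have hf : 24 * ((m : ℚ) + 1) ^ 3 * (3 * m + 2) ≠ 0 := by positivity
  apply mul_left_cancel₀ hf
  linear_combination h

end CSPP

namespace CSPP
open Finset Matrix

section
open Polynomial

/-- coefficients, even case -/
def ee (m k : ℕ) : ℚ := if m = 0 then 1 else k * ehe m k

/-- coefficients, odd case -/
def eo (m k : ℕ) : ℚ := (3 * k + 2) * eho m k

/-- even orthogonal polynomials -/
noncomputable def qe (m : ℕ) : ℚ[X] := ∑ k ∈ range (m+1), C (ee m k) * (X * (1 - X)) ^ k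

/-- odd orthogonal polynomials -/
noncomputable def qo (m : ℕ) : ℚ[X] :=
  ∑ k ∈ range (m+1), C (eo m k) * ((1 - C 2 * X) * (X * (1 - X)) ^ k)

lemma deg_y : (X * (1 - X) : ℚ[X]).natDegree ≤ 2 := by compute_degree

lemma deg_ypow (k : ℕ) : ((X * (1 - X) : ℚ[X]) ^ k).natDegree ≤ 2 * k := by
  refine natDegree_pow_le.trans ?_
  rw [mul_comm]
  exact Nat.mul_le_mul_right _ deg_y

lemma coeff_ypow (k : ℕ) : ((X * (1 - X) : ℚ[X]) ^ k).coeff (2 * k) = (-1) ^ k := by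
  rw [mul_comm 2 k, coeff_pow_of_natDegree_le deg_y]
  congr 1
  rw [show (2 : ℕ) = 1 + 1 from rfl, coeff_X_mul]
  simp [coeff_one]

lemma deg_lin : (1 - C 2 * X : ℚ[X]).natDegree ≤ 1 := by compute_degree

lemma deg_ypow' (k : ℕ) : ((1 - C 2 * X : ℚ[X]) * (X * (1 - X)) ^ k).natDegree ≤ 2 * k + 1 := by
  refine natDegree_mul_le.trans ?_
  have := deg_lin
  have := deg_ypow k
  omega

lemma coeff_ypow' (k : ℕ) :
    ((1 - C 2 * X : ℚ[X]) * (X * (1 - X)) ^ k).coeff (2 * k + 1) = -2 * (-1) ^ k := by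
  rw [add_comm (2 * k) 1, coeff_mul_add_eq_of_natDegree_le deg_lin (deg_ypow k), coeff_ypow]
  congr 1
  simp [coeff_one]

lemma deg_qe (m : ℕ) : (qe m).natDegree ≤ 2 * m := by
  refine natDegree_sum_le_of_forall_le _ _ fun k hk => ?_
  have := Finset.mem_range.1 hk
  exact (natDegree_C_mul_le _ _).trans ((deg_ypow k).trans (by omega))

lemma deg_qo (m : ℕ) : (qo m).natDegree ≤ 2 * m + 1 := by
  refine natDegree_sum_le_of_forall_le _ _ fun k hk => ?_
  have := Finset.mem_range.1 hk
  exact (natDegree_C_mul_le _ _).trans ((deg_ypow' k).trans (by omega))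

lemma coeff_qe (m : ℕ) : (qe m).coeff (2 * m) = ee m m * (-1) ^ m := by
  rcases Nat.eq_zero_or_pos m with h | h
  · subst h; simp [qe]
  rw [qe, Finset.sum_range_succ, coeff_add, coeff_C_mul, coeff_ypow, coeff_eq_zero_of_natDegree_lt,
    zero_add]
  refine lt_of_le_of_lt (natDegree_sum_le_of_forall_le (n := 2 * m - 1) _ _ fun k hk => ?_) (by omega)
  have := Finset.mem_range.1 hk
  exact (natDegree_C_mul_le _ _).trans ((deg_ypow k).trans (by omega))

lemma coeff_qo (m : ℕ) : (qo m).coeff (2 * m + 1) = eo m m * (-2 * (-1) ^ m) := by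
  rw [qo, Finset.sum_range_succ, coeff_add, coeff_C_mul, coeff_ypow', coeff_eq_zero_of_natDegree_lt,
    zero_add]
  refine lt_of_le_of_lt (natDegree_sum_le_of_forall_le (n := 2 * m) _ _ fun k hk => ?_) (by omega)
  have := Finset.mem_range.1 hk
  exact (natDegree_C_mul_le _ _).trans ((deg_ypow' k).trans (by omega))

lemma comp_qe (m : ℕ) : (qe m).comp (1 - X) = qe m := by
  simp only [qe, Polynomial.sum_comp, mul_comp, C_comp, pow_comp, X_comp, sub_comp, one_comp]
  refine Finset.sum_congr rfl fun k _ => ?_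
  congr 2
  ring

lemma comp_qo (m : ℕ) : (qo m).comp (1 - X) = - qo m := by
  simp only [qo, Polynomial.sum_comp, mul_comp, C_comp, pow_comp, X_comp, sub_comp, one_comp]
  rw [← Finset.sum_neg_distrib]
  refine Finset.sum_congr rfl fun k _ => ?_
  rw [← mul_neg, ← neg_mul]
  congr 2
  · have : (C 2 : ℚ[X]) = 2 := rfl
    rw [this]; ring
  · congr 1
    ring

lemma ip_qe (N m' m : ℕ) (h : 2 * m' < N) (hm : 1 ≤ m) :
    ip N (qe m') (qe m) = ∑ i ∈ range (m'+1), ee m' i * Se m i := by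
  rw [qe, ip_sum_left]
  refine Finset.sum_congr rfl fun i hi => ?_
  have := Finset.mem_range.1 hi
  rw [ip_C_left, qe, ip_sum_right, Se]
  congr 1
  refine Finset.sum_congr rfl fun k _ => ?_
  rw [ip_C_right, ip_ge _ _ _ (by omega), ee, if_neg (by omega)]

lemma ip_qo (N m' m : ℕ) (h : 2 * m' + 1 < N) :
    ip N (qo m') (qo m) = ∑ i ∈ range (m'+1), eo m' i * So m i := by
  rw [qo, ip_sum_left]
  refine Finset.sum_congr rfl fun i hi => ?_
  have := Finset.mem_range.1 hi
  rw [ip_C_left, qo, ip_sum_right, So]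
  congr 1
  refine Finset.sum_congr rfl fun k _ => ?_
  rw [ip_C_right, ip_go _ _ _ (by omega), eo]

/-- orthogonal polynomials -/
noncomputable def qq (k : ℕ) : ℚ[X] := if k % 2 = 0 then qe (k / 2) else qo (k / 2)

lemma qq_even (m : ℕ) : qq (2 * m) = qe m := by
  rw [qq, if_pos (by omega), show 2 * m / 2 = m by omega]

lemma qq_odd (m : ℕ) : qq (2 * m + 1) = qo m := by
  rw [qq, if_neg (by omega), show (2 * m + 1) / 2 = m by omega]

lemma deg_qq (k : ℕ) : (qq k).natDegree ≤ k := by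
  obtain ⟨m, rfl | rfl⟩ := Nat.even_or_odd' k
  · rw [qq_even]; exact deg_qe m
  · rw [qq_odd]; exact deg_qo m

lemma comp_qq (k : ℕ) : (qq k).comp (1 - X) = C ((-1) ^ k) * qq k := by
  obtain ⟨m, rfl | rfl⟩ := Nat.even_or_odd' k
  · rw [qq_even, comp_qe]; simp [pow_mul]
  · rw [qq_odd, comp_qo]; simp [pow_add, pow_mul]

lemma lead_ne (k : ℕ) : (qq k).coeff k ≠ 0 := by
  obtain ⟨m, rfl | rfl⟩ := Nat.even_or_odd' k
  · rw [qq_even, coeff_qe]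
    apply mul_ne_zero _ (by positivity)
    rw [ee]
    split_ifs with h
    · exact one_ne_zero
    · exact mul_ne_zero (by exact_mod_cast h) (ehe_ne _ _ le_rfl)
  · rw [qq_odd, coeff_qo]
    apply mul_ne_zero
    · exact mul_ne_zero (by positivity) (eho_ne _ _ le_rfl)
    · apply mul_ne_zero (by norm_num) (by positivity)

lemma ip_diag (N k : ℕ) (h : k < N) : 2 * ip N (qq k) (qq k) = cc k * (qq k).coeff k ^ 2 := by
  obtain ⟨m, rfl | rfl⟩ := Nat.even_or_odd' k
  · rw [qq_even, coeff_qe]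
    rcases Nat.eq_zero_or_pos m with hm | hm
    · subst hm
      have : qe 0 = X ^ 0 * (1 - X) ^ 0 := by simp [qe, ee]
      rw [this, ip_T _ _ _ _ _ (by omega), T_zero]
      simp [cc, ee]
    · rw [ip_qe _ _ _ h hm, Finset.sum_range_succ, Finset.sum_eq_zero, zero_add, mul_left_comm,
        Se_diag m hm, ee, if_neg (by omega)]
      · have : ((-1 : ℚ) ^ m) ^ 2 = 1 := by rw [← pow_mul, mul_comm, pow_mul]; simp
        rw [mul_pow, this]
        ring
      · intro i hi
        rw [Se_zero m i (by simpa using hi), mul_zero]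
  · rw [qq_odd, coeff_qo, ip_qo _ _ _ h, Finset.sum_range_succ, Finset.sum_eq_zero, zero_add, So_diag, eo]
    · have : ((-1 : ℚ) ^ m) ^ 2 = 1 := by rw [← pow_mul, mul_comm, pow_mul]; simp
      linear_combination (-4 : ℚ) * cc (2 * m + 1) * ((3 * m + 2) * eho m m) ^ 2 * this
    · intro i hi
      rw [So_zero m i (by simpa using hi), mul_zero]

lemma ip_off_lt (N k l : ℕ) (h : l < N) (hkl : k < l) (he : Even (k + l)) : ip N (qq k) (qq l) = 0 := by
  obtain ⟨m, rfl | rfl⟩ := Nat.even_or_odd' k <;> obtain ⟨m', rfl | rfl⟩ := Nat.even_or_odd' l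
  · rw [qq_even, qq_even, ip_qe _ _ _ (by omega) (by omega)]
    refine Finset.sum_eq_zero fun i hi => ?_
    have := Finset.mem_range.1 hi
    rw [Se_zero _ _ (by omega), mul_zero]
  · rw [Nat.even_iff] at he; omega
  · rw [Nat.even_iff] at he; omega
  · rw [qq_odd, qq_odd, ip_qo _ _ _ (by omega)]
    refine Finset.sum_eq_zero fun i hi => ?_
    have := Finset.mem_range.1 hi
    rw [So_zero _ _ (by omega), mul_zero]

lemma ip_off (N k l : ℕ) (hk : k < N) (hl : l < N) (hkl : k ≠ l) (he : Even (k + l)) :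
    ip N (qq k) (qq l) = 0 := by
  rcases lt_or_gt_of_ne hkl with h | h
  · exact ip_off_lt N k l hl h he
  · rw [ip_comm]; exact ip_off_lt N l k hk h (by rwa [add_comm])

lemma coeff_one_sub_pow (i j : ℕ) : ((1 - X : ℚ[X]) ^ i).coeff j = (-1) ^ j * (i.choose j : ℚ) := by
  have : (1 - X : ℚ[X]) ^ i = C ((-1) ^ i) * (X - C 1) ^ i := by
    rw [C_pow, ← mul_pow]; congr 1; simp
  rw [this, coeff_C_mul, show (X - C 1 : ℚ[X]) = X + C (-1) by rw [C_neg]; ring, coeff_X_add_C_pow]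
  rcases le_or_gt j i with h | h
  · rw [← mul_assoc, ← pow_add, show i + (i - j) = 2 * (i - j) + j by omega, pow_add, pow_mul]
    simp
  · rw [Nat.choose_eq_zero_of_lt h]; simp

lemma coeff_comp (n : ℕ) (p : ℚ[X]) (hp : p.natDegree < n) (j : ℕ) :
    (p.comp (1 - X)).coeff j = ∑ i ∈ range n, p.coeff i * ((i.choose j : ℚ) * (-1) ^ j) := by
  rw [Polynomial.comp, eval₂_eq_sum_range' _ hp, finsetSum_coeff]
  refine Finset.sum_congr rfl fun i _ => ?_
  rw [coeff_C_mul, coeff_one_sub_pow]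
  ring

/-- coefficient matrix -/
noncomputable def Qm (n : ℕ) : Matrix (Fin n) (Fin n) ℚ := Matrix.of fun k j => (qq k).coeff j

/-- signs -/
def Dm (n : ℕ) : Matrix (Fin n) (Fin n) ℚ := Matrix.diagonal fun k => (-1) ^ k.val

lemma Dm_sq (n : ℕ) : Dm n * Dm n = 1 := by
  rw [Dm, Matrix.diagonal_mul_diagonal]
  simp [← pow_add, ← two_mul, pow_mul]

lemma Dm_T (n : ℕ) : (Dm n)ᵀ = Dm n := by
  rw [Dm, Matrix.diagonal_transpose]

lemma Qm_L (n : ℕ) : Qm n * Lp n n * Dm n = Dm n * Qm n := by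
  ext k j
  rw [Dm, Matrix.mul_diagonal, Matrix.diagonal_mul, Matrix.mul_apply]
  have h := congrArg (fun p => p.coeff j.val) (comp_qq k)
  simp only [coeff_C_mul] at h
  rw [coeff_comp n _ (lt_of_le_of_lt (deg_qq k) k.2), Finset.sum_range] at h
  simp only [Qm, Matrix.of_apply, Lp_self]
  rw [← h, Finset.sum_mul]
  exact Finset.sum_congr rfl fun i _ => by ring

lemma QQ_apply (n : ℕ) (k l : Fin n) : (Qm n * (Qm n)ᵀ) k l = ip n (qq k) (qq l) := by
  simp only [Matrix.mul_apply, Matrix.transpose_apply, Qm, Matrix.of_apply, ip, Finset.sum_range]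

lemma QMQ (n : ℕ) : Qm n * (1 + Lp n n * (Lp n n)ᵀ) * (Qm n)ᵀ =
    Matrix.diagonal fun k : Fin n => cc k * (qq k).coeff k ^ 2 := by
  have h1 : Qm n * Lp n n = Dm n * Qm n * Dm n := by
    rw [← Qm_L, Matrix.mul_assoc, Dm_sq, Matrix.mul_one]
  have h2 : Qm n * (1 + Lp n n * (Lp n n)ᵀ) * (Qm n)ᵀ =
      Qm n * (Qm n)ᵀ + Dm n * (Qm n * (Qm n)ᵀ) * Dm n := by
    have : Qm n * (1 + Lp n n * (Lp n n)ᵀ) * (Qm n)ᵀ =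
      Qm n * (Qm n)ᵀ + (Qm n * Lp n n) * (Qm n * Lp n n)ᵀ := by
      rw [Matrix.transpose_mul, Matrix.mul_add, Matrix.add_mul, Matrix.mul_one]
      simp only [Matrix.mul_assoc]
    rw [this, h1, Matrix.transpose_mul, Matrix.transpose_mul, Dm_T]
    congr 1
    calc Dm n * Qm n * Dm n * (Dm n * ((Qm n)ᵀ * Dm n)) 
        = Dm n * Qm n * (Dm n * Dm n) * ((Qm n)ᵀ * Dm n) := by simp only [Matrix.mul_assoc]
      _ = _ := by rw [Dm_sq, Matrix.mul_one]; simp only [Matrix.mul_assoc]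
  rw [h2]
  ext k l
  rw [Matrix.add_apply, Dm, Matrix.mul_diagonal, Matrix.diagonal_mul, QQ_apply, Matrix.diagonal_apply]
  by_cases hkl : k = l
  · subst hkl
    rw [if_pos rfl, ← ip_diag n k k.2]
    have : ((-1 : ℚ) ^ k.val) * (-1) ^ k.val = 1 := by rw [← pow_add, ← two_mul, pow_mul]; simp
    linear_combination (ip n (qq k) (qq k)) * this
  · rw [if_neg hkl]
    rcases Nat.even_or_odd (k.val + l.val) with he | ho
    · rw [ip_off n k l k.2 l.2 (by simpa [Fin.ext_iff] using hkl) he]; simp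
    · have : ((-1 : ℚ) ^ k.val) * (-1) ^ l.val = -1 := by rw [← pow_add, ho.neg_one_pow]
      linear_combination (ip n (qq k) (qq l)) * this

lemma det_Qm (n : ℕ) : (Qm n).det = ∏ k : Fin n, (qq k).coeff k := by
  rw [Matrix.det_of_isLowerTriangular]
  · rfl
  · intro i j hij
    exact coeff_eq_zero_of_natDegree_lt (lt_of_le_of_lt (deg_qq i) hij)

lemma det_eval (n : ℕ) : (1 + Lp n n * (Lp n n)ᵀ).det = ∏ k ∈ range n, cc k := by
  have h := congrArg Matrix.det (QMQ n)
  rw [Matrix.det_mul, Matrix.det_mul, Matrix.det_transpose, Matrix.det_diagonal, det_Qm,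
    Finset.prod_mul_distrib, Finset.prod_pow] at h
  have hne : (∏ k : Fin n, (qq k).coeff k) ≠ 0 := Finset.prod_ne_zero_iff.2 fun k _ => lead_ne k
  rw [Finset.prod_range]
  apply mul_left_cancel₀ (pow_ne_zero 2 hne)
  linear_combination h

end

/-- superfactorial -/
def sf (n : ℕ) : ℚ := ∏ j ∈ range n, (j.factorial : ℚ)

lemma sf_ne (n : ℕ) : sf n ≠ 0 := Finset.prod_ne_zero_iff.2 fun k _ => fac_ne k

lemma sf_succ (n : ℕ) : sf (n+1) = sf n * (n.factorial : ℚ) := Finset.prod_range_succ _ _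

lemma prod_pairs (g : ℕ → ℚ) (n : ℕ) :
    ∏ i ∈ range n, (g (2 * i) * g (2 * i + 1)) = ∏ j ∈ range (2 * n), g j := by
  induction n with
  | zero => simp
  | succ n ih =>
    rw [Finset.prod_range_succ, ih, show 2 * (n + 1) = 2 * n + 1 + 1 by ring, Finset.prod_range_succ,
      Finset.prod_range_succ]
    ring

lemma prod_cc (n : ℕ) : (∏ k ∈ range n, cc k) * sf (2 * n) =
    (∏ i ∈ range n, ((3 * i + 2) * (3 * i).factorial : ℚ)) * sf n := by
  induction n with
  | zero => simp
  | succ n ih =>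
    rw [Finset.prod_range_succ, Finset.prod_range_succ, show 2 * (n + 1) = 2 * n + 1 + 1 by ring, sf_succ,
      sf_succ, sf_succ, cc]
    have := fac_ne (2 * n)
    have := fac_ne (2 * n + 1)
    field_simp
    linear_combination ih

lemma rhs_eval (n : ℕ) : ∏ i ∈ Finset.range n,
        ((3 * i + 2) * Nat.factorial (3 * i) * Nat.factorial (i + 2 * n) : ℚ) /
          (Nat.factorial (2 * i + n) * Nat.factorial (2 * i + n + 1) : ℚ) = ∏ k ∈ range n, cc k := by
  rw [Finset.prod_div_distrib, Finset.prod_mul_distrib]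
  have h1 : sf (3 * n) = sf (2 * n) * ∏ i ∈ range n, ((i + 2 * n).factorial : ℚ) := by
    rw [sf, show 3 * n = 2 * n + n by ring, Finset.prod_range_add, sf]
    congr 1
    exact Finset.prod_congr rfl fun i _ => by rw [add_comm]
  have h2 : sf (3 * n) = sf n *
      ∏ i ∈ range n, (((2 * i + n).factorial : ℚ) * ((2 * i + n + 1).factorial : ℚ)) := by
    have := prod_pairs (fun j => ((n + j).factorial : ℚ)) n
    rw [sf, show 3 * n = n + 2 * n by ring, Finset.prod_range_add, sf, ← this]
    congr 1
    exact Finset.prod_congr rfl fun i _ => by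
      rw [add_comm n (2 * i), show n + (2 * i + 1) = 2 * i + n + 1 by ring]
  have h3 := prod_cc n
  have n1 := sf_ne n
  have n2 := sf_ne (2 * n)
  have n3 := sf_ne (3 * n)
  have hB : (∏ i ∈ range n, (((2 * i + n).factorial : ℚ) * ((2 * i + n + 1).factorial : ℚ))) ≠ 0 := by
    intro h0
    rw [h0, mul_zero] at h2
    exact n3 h2
  rw [div_eq_iff hB]
  apply mul_left_cancel₀ (mul_ne_zero n1 n2)
  rw [h1] at h2
  linear_combination (∏ i ∈ range n, ((3 * i + 2) * (3 * i).factorial : ℚ)) * sf n * h2 -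
    sf n * (∏ i ∈ range n, (((2 * i + n).factorial : ℚ) * ((2 * i + n + 1).factorial : ℚ))) * h3

end CSPP

/-- (Andrews) The number of cyclically symmetric plane partitions in the `n`-cube, i.e. the
number of lower sets `S` of `Fin n × Fin n × Fin n` under the componentwise order with
`(i,j,k) ∈ S ↔ (j,k,i) ∈ S`, equals
`∏_{i=0}^{n-1} (3i+2)·(3i)!·(i+2n)!/((2i+n)!·(2i+n+1)!)`. -/
theorem card_cyclicallySymmetric_planePartitions (n : ℕ) :
    (Nat.card {S : Set (Fin n × Fin n × Fin n) // IsLowerSet S ∧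
        ∀ i j k : Fin n, (i, j, k) ∈ S ↔ (j, k, i) ∈ S} : ℚ) =
      ∏ i ∈ Finset.range n,
        ((3 * i + 2) * Nat.factorial (3 * i) * Nat.factorial (i + 2 * n) : ℚ) /
          (Nat.factorial (2 * i + n) * Nat.factorial (2 * i + n + 1) : ℚ) := by
  rw [CSPP.rhs_eval, ← CSPP.det_eval]
  exact CSPP.card_CS n
end
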